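/- (Weakened-moment version of Theorem 1, Remark 5): Assume conditions (A1), (A2), (A3). If for some δ > 0 the prior satisfies ∫₀^∞ λ^{2(1+δ)} π(λ²) dλ² < ∞ and τ_n² ⪯ n^{−1 − 1/(1+δ)} q_n, then E₀ ‖E(K_n β_n | Y_n) − K_n β_{0n}‖² ⪯ q_n as n → ∞. -/

import Mathlib

open MeasureTheory Matrix Filter

noncomputable section

namespace RVM

/-- Squared Euclidean norm of a vector in `ℝⁿ`. -/
def sqnorm {n : ℕ} (v : Fin n → ℝ) : ℝ := v ⬝ᵥ v

/-- The hierarchical Bayesian relevance vector machine model (Model 1) of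
Fang–Ghosh.  For each `n`, `K n` is a symmetric positive definite `n × n` kernel matrix,
`β0 n` is the true coefficient vector, `σ0sq` the true error variance, `τsq n` the global
shrinkage parameter, `pr` the common prior density of the local parameters `λᵢ²` on `(0, ∞)`,
and `a, b` the hyperparameters of the inverse-gamma prior on `σ²`. -/
structure Model where
  K : (n : ℕ) → Matrix (Fin n) (Fin n) ℝ
  β0 : (n : ℕ) → Fin n → ℝ
  σ0sq : ℝ
  τsq : ℕ → ℝ
  pr : ℝ → ℝ
  a : ℝ
  b : ℝ
  hK : ∀ n, (K n).PosDef
  hσ0 : 0 < σ0sq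
  ha : 0 < a
  hb : 0 < b
  hpr_nonneg : ∀ x, 0 ≤ pr x
  hpr_supp : ∀ x ≤ 0, pr x = 0
  hpr_int : ∫ x in Set.Ioi (0 : ℝ), pr x = 1

namespace Model

variable (M : Model)

/-- `q n`: the number of nonzero entries of the true coefficient vector `β0 n`. -/
def q (n : ℕ) : ℕ := {i : Fin n | M.β0 n i ≠ 0}.ncard

/-- The unnormalized joint posterior density of `(β, σ², λ²)` given data `Y`:
`(σ²)^{−n−a/2−1} ∏ᵢ π(λᵢ²) · |Λ²|^{−1/2} ·
  exp[(−b − βᵀ τ⁻² Λ⁻² β − (Y − Kβ)ᵀ(Y − Kβ)) / (2σ²)]`. -/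
def jd (n : ℕ) (Y : Fin n → ℝ) (β : Fin n → ℝ) (s : ℝ) (l : Fin n → ℝ) : ℝ :=
  s ^ (-(n : ℝ) - M.a / 2 - 1) * (∏ i, M.pr (l i)) * (∏ i, l i) ^ (-(1 : ℝ) / 2) *
    Real.exp ((-M.b - (M.τsq n)⁻¹ * ∑ i, (β i) ^ 2 / l i
        - sqnorm (Y - M.K n *ᵥ β)) / (2 * s))

/-- The region `{(β, σ², λ²) : σ² > 0, λᵢ² > 0 ∀ i}` over which the posterior lives. -/
def posSet (n : ℕ) : Set ((Fin n → ℝ) × ℝ × (Fin n → ℝ)) :=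
  {p | 0 < p.2.1 ∧ ∀ i, 0 < p.2.2 i}

/-- Normalizing constant of the posterior given `Y`. -/
def Z (n : ℕ) (Y : Fin n → ℝ) : ℝ :=
  ∫ p in posSet n, M.jd n Y p.1 p.2.1 p.2.2

/-- Posterior mean `E(βₙ | Yₙ)` of the coefficient vector. -/
def postMean (n : ℕ) (Y : Fin n → ℝ) : Fin n → ℝ :=
  (M.Z n Y)⁻¹ • ∫ p in posSet n, M.jd n Y p.1 p.2.1 p.2.2 • p.1

/-- Posterior probability `P(βₙ ∈ E | Yₙ)`. -/
def postProb (n : ℕ) (Y : Fin n → ℝ) (E : Set (Fin n → ℝ)) : ℝ :=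
  (∫ p in posSet n ∩ {p | p.1 ∈ E}, M.jd n Y p.1 p.2.1 p.2.2) / M.Z n Y

/-- Trace of the posterior covariance matrix `V(βₙ | Yₙ)`,
i.e. `E(‖βₙ − E(βₙ|Yₙ)‖² | Yₙ)`. -/
def trPostVar (n : ℕ) (Y : Fin n → ℝ) : ℝ :=
  (M.Z n Y)⁻¹ * ∫ p in posSet n, M.jd n Y p.1 p.2.1 p.2.2 * sqnorm (p.1 - M.postMean n Y)

/-- Trace of the posterior covariance matrix `V(Kₙ βₙ | Yₙ)`,
i.e. `E(‖Kₙβₙ − Kₙ E(βₙ|Yₙ)‖² | Yₙ)`. -/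
def trPostVarK (n : ℕ) (Y : Fin n → ℝ) : ℝ :=
  (M.Z n Y)⁻¹ * ∫ p in posSet n,
    M.jd n Y p.1 p.2.1 p.2.2 * sqnorm (M.K n *ᵥ p.1 - M.K n *ᵥ M.postMean n Y)

/-- Density of the true data-generating distribution `N(Kₙ β₀ₙ, σ₀² Iₙ)`. -/
def trueDens (n : ℕ) (Y : Fin n → ℝ) : ℝ :=
  (2 * Real.pi * M.σ0sq) ^ (-(n : ℝ) / 2) *
    Real.exp (-sqnorm (Y - M.K n *ᵥ M.β0 n) / (2 * M.σ0sq))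

/-- Expectation `E₀` under the true data-generating distribution `Yₙ ~ N(Kₙ β₀ₙ, σ₀² Iₙ)`. -/
def E0 (n : ℕ) (f : (Fin n → ℝ) → ℝ) : ℝ :=
  ∫ Y, f Y * M.trueDens n Y

/-- Condition (A1): `c₁ Iₙ ≤ Kₙ ≤ c₂ Iₙ` for sufficiently large `n`, with constants
`0 < c₁ ≤ c₂` not depending on `n`. -/
def CondA1 : Prop :=
  ∃ c₁ c₂ : ℝ, 0 < c₁ ∧ c₁ ≤ c₂ ∧ ∃ N : ℕ, ∀ n ≥ N,
    (M.K n - c₁ • (1 : Matrix (Fin n) (Fin n) ℝ)).PosSemidef ∧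
      (c₂ • (1 : Matrix (Fin n) (Fin n) ℝ) - M.K n).PosSemidef

/-- Condition (A2): the true coefficients are uniformly bounded, `|β₀ₙ,ᵢ| < M₀` with `M₀`
independent of `n`. -/
def CondA2 : Prop := ∃ M₀ : ℝ, ∀ n, ∀ i : Fin n, |M.β0 n i| < M₀

/-- Condition (A3): `qₙ = o(n)`. -/
def CondA3 : Prop := Tendsto (fun n => (M.q n : ℝ) / n) atTop (nhds 0)

/-- Finite fourth moment of the prior: `∫ λ⁴ π(λ²) dλ² < ∞`. -/
def Moment4 : Prop := IntegrableOn (fun x => x ^ 2 * M.pr x) (Set.Ioi (0 : ℝ))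

/-- Finite inverse second moment of the prior: `∫ λ⁻² π(λ²) dλ² < ∞`. -/
def MomentNeg2 : Prop := IntegrableOn (fun x => x⁻¹ * M.pr x) (Set.Ioi (0 : ℝ))

end Model

end RVM

open RVM Filter
namespace RVM

lemma sqnorm_eq_sum {n : ℕ} (v : Fin n → ℝ) : sqnorm v = ∑ i, v i ^ 2 := by
  simp [sqnorm, dotProduct, sq]

lemma sqnorm_nonneg {n : ℕ} (v : Fin n → ℝ) : 0 ≤ sqnorm v := by
  rw [sqnorm_eq_sum]; positivity

lemma sqnorm_sub {n : ℕ} (v w : Fin n → ℝ) :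
    sqnorm (v - w) = sqnorm v - 2 * (v ⬝ᵥ w) + sqnorm w := by
  simp only [sqnorm, sub_dotProduct, dotProduct_sub, dotProduct_comm w v]; ring

lemma sqnorm_add {n : ℕ} (v w : Fin n → ℝ) :
    sqnorm (v + w) = sqnorm v + 2 * (v ⬝ᵥ w) + sqnorm w := by
  simp only [sqnorm, add_dotProduct, dotProduct_add, dotProduct_comm w v]; ring

/-- A positive semidefinite matrix bounded above by `c` has operator norm at most `c`. -/
lemma sqnorm_mulVec_le {n : ℕ} {K : Matrix (Fin n) (Fin n) ℝ} (hK : K.PosDef) {c : ℝ}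
    (hc : 0 < c) (hle : (c • (1 : Matrix (Fin n) (Fin n) ℝ) - K).PosSemidef) (v : Fin n → ℝ) :
    sqnorm (K *ᵥ v) ≤ c ^ 2 * sqnorm v := by
  have hsymm : Kᵀ = K := by simpa using hK.isHermitian.eq
  have hs (x y : Fin n → ℝ) : x ⬝ᵥ (K *ᵥ y) = (K *ᵥ x) ⬝ᵥ y := by
    rw [dotProduct_mulVec, ← mulVec_transpose, hsymm]
  have h1 (x : Fin n → ℝ) : x ⬝ᵥ (K *ᵥ x) ≤ c * (x ⬝ᵥ x) := by
    have := hle.dotProduct_mulVec_nonneg x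
    simp only [sub_mulVec, smul_mulVec, one_mulVec, dotProduct_sub, dotProduct_smul, star_trivial,
      smul_eq_mul] at this
    linarith
  have h2 := hK.posSemidef.dotProduct_mulVec_nonneg (c • v - K *ᵥ v)
  simp only [mulVec_sub, mulVec_smul, dotProduct_sub, sub_dotProduct, smul_dotProduct,
    dotProduct_smul, star_trivial, smul_eq_mul] at h2
  have h3 := h1 (K *ᵥ v)
  have h4 := h1 v
  have h5 : v ⬝ᵥ (K *ᵥ (K *ᵥ v)) = (K *ᵥ v) ⬝ᵥ (K *ᵥ v) := hs _ _
  simp only [sqnorm]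
  rw [h5] at h2
  nlinarith

/-- For every coordinate set `J` there is an orthogonal change of coordinates whose rows
outside `J` are orthogonal to all columns of `K` indexed by `J`. -/
lemma exists_adapted {n : ℕ} (K : Matrix (Fin n) (Fin n) ℝ) (J : Finset (Fin n)) :
    ∃ O : Matrix (Fin n) (Fin n) ℝ, Oᵀ * O = 1 ∧ O * Oᵀ = 1 ∧
      ∀ j ∉ J, ∀ i ∈ J, (O * K) j i = 0 := by
  classical
  let φ : EuclideanSpace ℝ (Fin n) →ₗ[ℝ] (J → ℝ) :=
    { toFun := fun v i => ∑ k, v k * K k i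
      map_add' := fun v w => by ext i; simp [add_mul, Finset.sum_add_distrib]
      map_smul' := fun c v => by ext i; simp [Finset.mul_sum, mul_assoc] }
  let W := LinearMap.ker φ
  have hdim : Fintype.card {j // j ∉ J} ≤ Module.finrank ℝ W := by
    have h1 := LinearMap.finrank_range_add_finrank_ker φ
    have h2 : Module.finrank ℝ (LinearMap.range φ) ≤ J.card := by
      refine (Submodule.finrank_le _).trans ?_
      simp
    have h3 : Module.finrank ℝ (EuclideanSpace ℝ (Fin n)) = n := by simp
    have h4 : Fintype.card {j // j ∉ J} = n - J.card := by
      rw [Fintype.card_subtype_compl]; simp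
    have : Module.finrank ℝ W = Module.finrank ℝ (LinearMap.ker φ) := rfl
    omega
  obtain ⟨e⟩ : Nonempty ({j // j ∉ J} ↪ Fin (Module.finrank ℝ W)) := by
    apply Function.Embedding.nonempty_of_card_le
    simpa using hdim
  let w := stdOrthonormalBasis ℝ W
  let v : Fin n → EuclideanSpace ℝ (Fin n) := fun j =>
    if h : j ∉ J then (w (e ⟨j, h⟩) : EuclideanSpace ℝ (Fin n)) else 0
  have hv : Orthonormal ℝ (({j | j ∉ J} : Set (Fin n)).domRestrict v) := by
    have h1 : Orthonormal ℝ (fun j : {j // j ∉ J} => (w (e j) : EuclideanSpace ℝ (Fin n))) := by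
      have := (w.orthonormal.comp e e.injective)
      exact this.comp_linearIsometry W.subtypeₗᵢ
    have h2 : (({j | j ∉ J} : Set (Fin n)).domRestrict v) =
        fun j : {j // j ∉ J} => (w (e j) : EuclideanSpace ℝ (Fin n)) :=
      funext fun j => dif_pos j.2
    rw [h2]
    exact h1
  obtain ⟨b, hb⟩ := hv.exists_orthonormalBasis_extension_of_card_eq (by simp)
  let O : Matrix (Fin n) (Fin n) ℝ := Matrix.of fun j k => b j k
  have hO : O * Oᵀ = 1 := by
    ext i j
    have := orthonormal_iff_ite.mp b.orthonormal i j
    rw [PiLp.inner_apply] at this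
    simp only [Matrix.mul_apply, transpose_apply, O, Matrix.one_apply, Matrix.of_apply]
    rw [← this]
    simp [mul_comm]
  refine ⟨O, mul_eq_one_comm.mp hO, hO, fun j hj i hi => ?_⟩
  have h1 : b j = w (e ⟨j, hj⟩) := by
    rw [hb j hj]; simp [v, hj]
  have h2 : (w (e ⟨j, hj⟩) : EuclideanSpace ℝ (Fin n)) ∈ W := (w (e ⟨j, hj⟩)).2
  have h3 := congrFun (LinearMap.mem_ker.mp h2) ⟨i, hi⟩
  simp only [Matrix.mul_apply, O, Matrix.of_apply, h1]
  simpa only [φ, LinearMap.coe_mk, AddHom.coe_mk, Pi.zero_apply] using h3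

/-- The orthogonal change of coordinates adapted to `K` and the coordinate set `J`. -/
def adapted {n : ℕ} (K : Matrix (Fin n) (Fin n) ℝ) (J : Finset (Fin n)) :
    Matrix (Fin n) (Fin n) ℝ := (exists_adapted K J).choose

lemma adapted_transpose_mul {n : ℕ} (K : Matrix (Fin n) (Fin n) ℝ) (J : Finset (Fin n)) :
    (adapted K J)ᵀ * adapted K J = 1 := (exists_adapted K J).choose_spec.1

lemma adapted_mul_transpose {n : ℕ} (K : Matrix (Fin n) (Fin n) ℝ) (J : Finset (Fin n)) :
    adapted K J * (adapted K J)ᵀ = 1 := (exists_adapted K J).choose_spec.2.1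

lemma adapted_mul_apply {n : ℕ} (K : Matrix (Fin n) (Fin n) ℝ) {J : Finset (Fin n)} {i j : Fin n}
    (hj : j ∉ J) (hi : i ∈ J) : (adapted K J * K) j i = 0 :=
  (exists_adapted K J).choose_spec.2.2 j hj i hi

/-- Squared norm of the component of `Y` in the span of the first `J`-adapted directions. -/
def pf {n : ℕ} (K : Matrix (Fin n) (Fin n) ℝ) (J : Finset (Fin n)) (Y : Fin n → ℝ) : ℝ :=
  ∑ j ∈ J, (adapted K J *ᵥ Y) j ^ 2

/-- Squared norm of the component of `Y` orthogonal to the columns of `K` indexed by `J`. -/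
def qf {n : ℕ} (K : Matrix (Fin n) (Fin n) ℝ) (J : Finset (Fin n)) (Y : Fin n → ℝ) : ℝ :=
  ∑ j ∈ Jᶜ, (adapted K J *ᵥ Y) j ^ 2

/-- The component of `Y` orthogonal to the columns of `K` indexed by `J`. -/
def orthPart {n : ℕ} (K : Matrix (Fin n) (Fin n) ℝ) (J : Finset (Fin n)) (Y : Fin n → ℝ) :
    Fin n → ℝ :=
  (adapted K J)ᵀ *ᵥ (fun j => if j ∈ J then 0 else (adapted K J *ᵥ Y) j)

section Adapted

variable {n : ℕ} (K : Matrix (Fin n) (Fin n) ℝ) (J : Finset (Fin n)) (Y : Fin n → ℝ)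

lemma pf_nonneg : 0 ≤ pf K J Y := Finset.sum_nonneg fun _ _ => sq_nonneg _

lemma qf_nonneg : 0 ≤ qf K J Y := Finset.sum_nonneg fun _ _ => sq_nonneg _

lemma sqnorm_mulVec_of_orthogonal {O : Matrix (Fin n) (Fin n) ℝ} (hO : Oᵀ * O = 1)
    (v : Fin n → ℝ) : sqnorm (O *ᵥ v) = sqnorm v := by
  rw [sqnorm, dotProduct_mulVec, ← mulVec_transpose, mulVec_mulVec, hO, one_mulVec, sqnorm]

lemma pf_add_qf : pf K J Y + qf K J Y = sqnorm Y := by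
  rw [pf, qf, Finset.sum_add_sum_compl, ← sqnorm_eq_sum,
    sqnorm_mulVec_of_orthogonal (adapted_transpose_mul K J)]

lemma dotProduct_orthPart : Y ⬝ᵥ orthPart K J Y = qf K J Y := by
  rw [orthPart, dotProduct_mulVec, ← mulVec_transpose, transpose_transpose, dotProduct, qf,
    ← Finset.sum_add_sum_compl J]
  rw [Finset.sum_eq_zero fun i hi => by simp [hi], zero_add]
  refine Finset.sum_congr rfl fun i hi => ?_
  simp [Finset.mem_compl.mp hi, sq]

lemma sqnorm_orthPart : sqnorm (orthPart K J Y) = qf K J Y := by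
  rw [orthPart, sqnorm_mulVec_of_orthogonal, sqnorm_eq_sum, qf, ← Finset.sum_add_sum_compl J]
  · rw [Finset.sum_eq_zero fun i hi => by simp [hi], zero_add]
    refine Finset.sum_congr rfl fun i hi => ?_
    simp [Finset.mem_compl.mp hi]
  · rw [transpose_transpose]; exact adapted_mul_transpose K J

lemma sqnorm_sub_orthPart : sqnorm (Y - orthPart K J Y) = pf K J Y := by
  rw [sqnorm_sub, dotProduct_orthPart, sqnorm_orthPart, ← pf_add_qf K J Y]; ring

variable {K} in
lemma mulVec_orthPart (hK : Kᵀ = K) {i : Fin n} (hi : i ∈ J) : (K *ᵥ orthPart K J Y) i = 0 := by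
  have h1 : K * (adapted K J)ᵀ = (adapted K J * K)ᵀ := by rw [transpose_mul, hK]
  rw [orthPart, mulVec_mulVec, h1, mulVec, dotProduct]
  refine Finset.sum_eq_zero fun j _ => ?_
  by_cases hj : j ∈ J
  · simp [hj]
  · simp only [transpose_apply]
    rw [adapted_mul_apply K hj hi, zero_mul]

lemma sqnorm_sum_mem_le {c : ℝ} (hK : Kᵀ = K)
    (hc : ∀ v : Fin n → ℝ, sqnorm (K *ᵥ v) ≤ c ^ 2 * sqnorm v) :
    ∑ i ∈ J, (K *ᵥ Y) i ^ 2 ≤ c ^ 2 * pf K J Y := by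
  have h1 : ∀ i ∈ J, (K *ᵥ Y) i ^ 2 = (K *ᵥ (Y - orthPart K J Y)) i ^ 2 := fun i hi => by
    rw [mulVec_sub, Pi.sub_apply, mulVec_orthPart J Y hK hi, sub_zero]
  rw [Finset.sum_congr rfl h1, ← sqnorm_sub_orthPart]
  refine le_trans ?_ (hc _)
  rw [sqnorm_eq_sum]
  exact Finset.sum_le_sum_of_subset_of_nonneg (Finset.subset_univ _) fun _ _ _ => sq_nonneg _

lemma integrable_exp_neg_sq_adapted {x y : ℝ} (hx : 0 < x) (hy : 0 < y) :
    Integrable (fun Y => Real.exp (-(x * pf K J Y + y * qf K J Y))) ∧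
    ∫ Y, Real.exp (-(x * pf K J Y + y * qf K J Y)) =
      √(Real.pi / x) ^ J.card * √(Real.pi / y) ^ (n - J.card) := by
  classical
  set O := adapted K J with hOdef
  have hO : Oᵀ * O = 1 := adapted_transpose_mul K J
  let c : Fin n → ℝ := fun j => if j ∈ J then x else y
  have hc : ∀ j, 0 < c j := fun j => by simp only [c]; split_ifs <;> assumption
  let f : (Fin n → ℝ) → ℝ := fun z => ∏ j, Real.exp (-c j * z j ^ 2)
  have hf : ∀ Y, Real.exp (-(x * pf K J Y + y * qf K J Y)) = f (O *ᵥ Y) := fun Y => by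
    simp only [f]
    rw [← Real.exp_sum, pf, qf, ← Finset.sum_add_sum_compl J, ← hOdef]
    congr 1
    rw [neg_add, Finset.mul_sum, Finset.mul_sum, ← Finset.sum_neg_distrib, ← Finset.sum_neg_distrib]
    congr 1 <;> refine Finset.sum_congr rfl fun i hi => ?_
    · simp [c, hi]
    · simp [c, Finset.mem_compl.mp hi]
  have hfi : Integrable f := Integrable.fintype_prod fun j => integrable_exp_neg_mul_sq (hc j)
  have hdet : |O.det| = 1 := by
    have := congrArg Matrix.det hO
    rw [det_mul, det_transpose, det_one] at this
    rw [← sq, sq_eq_one_iff] at this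
    rcases this with h | h <;> simp [h]
  have hdet0 : O.det ≠ 0 := fun h => by simp [h] at hdet
  have hmap : Measure.map (Matrix.toLin' O) (volume : Measure (Fin n → ℝ)) = volume := by
    rw [Real.map_matrix_volume_pi_eq_smul_volume_pi hdet0, abs_inv, hdet]; simp
  have hmp : MeasurePreserving (Matrix.toLin' O) (volume : Measure (Fin n → ℝ)) volume :=
    ⟨(Matrix.toLin' O).continuous_of_finiteDimensional.measurable, hmap⟩
  have hfun : (fun Y => Real.exp (-(x * pf K J Y + y * qf K J Y))) = f ∘ Matrix.toLin' O := by
    funext Y; rw [hf Y]; simp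
  have hfi' : AEStronglyMeasurable f (Measure.map (Matrix.toLin' O) volume) := by
    rw [hmap]; exact hfi.aestronglyMeasurable
  constructor
  · rw [hfun]; exact hmp.integrable_comp_of_integrable hfi
  · rw [hfun]
    calc ∫ Y, (f ∘ Matrix.toLin' O) Y = ∫ z, f z ∂(Measure.map (Matrix.toLin' O) volume) :=
          (integral_map hmp.measurable.aemeasurable hfi').symm
      _ = ∫ z, f z := by rw [hmap]
      _ = ∏ j, √(Real.pi / c j) := by
          simp only [f]
          rw [integral_fintype_prod_volume_eq_prod (fun j t => Real.exp (-c j * t ^ 2))]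
          simp only [integral_gaussian]
      _ = _ := by
          rw [← Finset.prod_mul_prod_compl J]
          congr 1
          · rw [Finset.prod_congr rfl fun i hi => by rw [show c i = x by simp [c, hi]],
              Finset.prod_const]
          · rw [Finset.prod_congr rfl fun i hi => by
              rw [show c i = y by simp [c, Finset.mem_compl.mp hi]],
              Finset.prod_const, Finset.card_compl, Fintype.card_fin]

end Adapted

section Quadratic

variable {n : ℕ}

/-- The penalized least-squares criterion in the conditional posterior of `β`. -/
def crit (K : Matrix (Fin n) (Fin n) ℝ) (τ : ℝ) (Y l β : Fin n → ℝ) : ℝ :=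
  τ⁻¹ * ∑ i, (β i) ^ 2 / l i + sqnorm (Y - K *ᵥ β)

/-- The quadratic form of the conditional posterior precision of `β`. -/
def quad (K : Matrix (Fin n) (Fin n) ℝ) (τ : ℝ) (l u : Fin n → ℝ) : ℝ :=
  τ⁻¹ * ∑ i, (u i) ^ 2 / l i + sqnorm (K *ᵥ u)

variable {K : Matrix (Fin n) (Fin n) ℝ} {τ : ℝ}

lemma transpose_eq_self (hK : K.PosDef) : Kᵀ = K := by
  have := hK.isHermitian.eq
  rwa [conjTranspose_eq_transpose_of_trivial] at this

lemma quad_neg (l u : Fin n → ℝ) : quad K τ l (-u) = quad K τ l u := by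
  simp [quad, mulVec_neg, sqnorm]

lemma exists_ridge (hK : K.PosDef) (hτ : 0 < τ) (Y l : Fin n → ℝ) (hl : ∀ i, 0 < l i) :
    ∃ β : Fin n → ℝ, ∀ i, τ⁻¹ * (β i / l i) = (K *ᵥ (Y - K *ᵥ β)) i := by
  set D : Matrix (Fin n) (Fin n) ℝ := diagonal fun i => τ⁻¹ * (l i)⁻¹ with hD
  have h1 : D.PosDef := PosDef.diagonal fun i => by have := hl i; positivity
  have h2 : (K * K).PosSemidef := by
    have := posSemidef_conjTranspose_mul_self K
    rwa [hK.isHermitian.eq] at this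
  have h3 : IsUnit (D + K * K) := (h1.add_posSemidef h2).isUnit
  refine ⟨(D + K * K)⁻¹ *ᵥ (K *ᵥ Y), fun i => ?_⟩
  set β := (D + K * K)⁻¹ *ᵥ (K *ᵥ Y) with hβ
  have h4 : (D + K * K) *ᵥ β = K *ᵥ Y := by
    rw [hβ, mulVec_mulVec, mul_nonsing_inv _ ((isUnit_iff_isUnit_det _).mp h3), one_mulVec]
  have h5 := congrFun h4 i
  rw [add_mulVec, Pi.add_apply, hD, mulVec_diagonal, ← mulVec_mulVec] at h5
  rw [mulVec_sub, Pi.sub_apply, ← h5]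
  ring

lemma exists_center (hK : K.PosDef) (hτ : 0 < τ) (Y l : Fin n → ℝ) (hl : ∀ i, 0 < l i) :
    ∃ β : Fin n → ℝ, ∀ u, crit K τ Y l (β + u) = crit K τ Y l β + quad K τ l u := by
  have hKT : Kᵀ = K := transpose_eq_self hK
  obtain ⟨β, hβ⟩ := exists_ridge hK hτ Y l hl
  refine ⟨β, fun u => ?_⟩
  have h1 : (Y - K *ᵥ β) ⬝ᵥ (K *ᵥ u) = ∑ i, τ⁻¹ * (β i / l i) * u i := by
    rw [dotProduct_mulVec, ← mulVec_transpose, hKT, dotProduct]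
    exact Finset.sum_congr rfl fun i _ => by rw [hβ]
  have h2 : sqnorm (Y - K *ᵥ (β + u)) =
      sqnorm (Y - K *ᵥ β) - 2 * ∑ i, τ⁻¹ * (β i / l i) * u i + sqnorm (K *ᵥ u) := by
    rw [mulVec_add, ← sub_sub, sqnorm_sub, h1]
  have h3 : ∑ i, (β + u) i ^ 2 / l i =
      ∑ i, β i ^ 2 / l i + 2 * ∑ i, β i / l i * u i + ∑ i, u i ^ 2 / l i := by
    rw [Finset.mul_sum, ← Finset.sum_add_distrib, ← Finset.sum_add_distrib]
    refine Finset.sum_congr rfl fun i _ => ?_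
    have := (hl i).ne'
    simp only [Pi.add_apply]
    field_simp
    ring
  have h4 : ∑ i, τ⁻¹ * (β i / l i) * u i = τ⁻¹ * ∑ i, β i / l i * u i := by
    rw [Finset.mul_sum]; exact Finset.sum_congr rfl fun i _ => by ring
  rw [crit, crit, quad, h2, h3, h4]
  ring

lemma crit_nonneg (hτ : 0 < τ) (Y β : Fin n → ℝ) {l : Fin n → ℝ} (hl : ∀ i, 0 < l i) :
    0 ≤ crit K τ Y l β := by
  have : 0 ≤ ∑ i, β i ^ 2 / l i := Finset.sum_nonneg fun i _ => by have := hl i; positivity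
  have := sqnorm_nonneg (Y - K *ᵥ β)
  rw [crit]; positivity

lemma le_crit (hK : K.PosDef) (hτ : 0 < τ) (Y β y : Fin n → ℝ) {l : Fin n → ℝ}
    (hl : ∀ i, 0 < l i) :
    2 * (Y ⬝ᵥ y) - sqnorm y - τ * ∑ i, l i * (K *ᵥ y) i ^ 2 ≤ crit K τ Y l β := by
  have hKT : Kᵀ = K := transpose_eq_self hK
  have h1 : 2 * ((Y - K *ᵥ β) ⬝ᵥ y) - sqnorm y ≤ sqnorm (Y - K *ᵥ β) := by
    have h := sqnorm_nonneg (Y - K *ᵥ β - y)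
    rw [sqnorm_sub] at h; linarith
  have h2 : (Y - K *ᵥ β) ⬝ᵥ y = Y ⬝ᵥ y - ∑ i, β i * (K *ᵥ y) i := by
    rw [sub_dotProduct, dotProduct_comm (K *ᵥ β), dotProduct_mulVec, ← mulVec_transpose, hKT,
      dotProduct_comm (K *ᵥ y)]
    rfl
  have h3 : 2 * ∑ i, β i * (K *ᵥ y) i - τ * ∑ i, l i * (K *ᵥ y) i ^ 2 ≤
      τ⁻¹ * ∑ i, β i ^ 2 / l i := by
    rw [Finset.mul_sum, Finset.mul_sum, Finset.mul_sum, ← Finset.sum_sub_distrib]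
    refine Finset.sum_le_sum fun i _ => ?_
    have h4 := hl i
    have h5 : 0 ≤ (β i - τ * l i * (K *ᵥ y) i) ^ 2 / (τ * l i) := by positivity
    have h6 : (β i - τ * l i * (K *ᵥ y) i) ^ 2 / (τ * l i) = τ⁻¹ * (β i ^ 2 / l i) -
        (2 * (β i * (K *ᵥ y) i) - τ * (l i * (K *ᵥ y) i ^ 2)) := by
      have := h4.ne'
      have := hτ.ne'
      field_simp; ring
    linarith
  rw [crit]
  rw [h2] at h1
  linarith

lemma crit_add_le (Y l β : Fin n → ℝ) (hτ : 0 < τ) (hl : ∀ i, 0 < l i)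
    (hβ : ∀ u, crit K τ Y l (β + u) = crit K τ Y l β + quad K τ l u) :
    crit K τ Y l β + sqnorm (K *ᵥ β) ≤ sqnorm Y := by
  have h1 := hβ (-β)
  have h2 : crit K τ Y l (β + -β) = sqnorm Y := by simp [crit]
  have h3 : sqnorm (K *ᵥ β) ≤ quad K τ l (-β) := by
    rw [quad_neg, quad]
    have : 0 ≤ ∑ i, β i ^ 2 / l i := Finset.sum_nonneg fun i _ => by have := hl i; positivity
    have : 0 ≤ τ⁻¹ * ∑ i, β i ^ 2 / l i := by positivity
    linarith
  linarith

lemma continuous_quad (l : Fin n → ℝ) : Continuous (quad K τ l) := by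
  unfold quad sqnorm
  simp only [dotProduct, mulVec]
  fun_prop

lemma integrable_exp_neg_quad (hτ : 0 < τ) {l : Fin n → ℝ} (hl : ∀ i, 0 < l i) {s : ℝ}
    (hs : 0 < s) :
    Integrable (fun u => Real.exp (-quad K τ l u / (2 * s))) ∧
    ∫ u, Real.exp (-quad K τ l u / (2 * s)) ≤ ∏ i, √(2 * Real.pi * s * τ * l i) := by
  have h0 : ∀ u : Fin n → ℝ, Real.exp (-quad K τ l u / (2 * s)) ≤
      ∏ i, Real.exp (-(1 / (2 * s * τ * l i)) * u i ^ 2) := fun u => by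
    rw [← Real.exp_sum, Real.exp_le_exp, neg_div, ← Finset.sum_congr rfl fun i _ =>
      (neg_mul _ _).symm, Finset.sum_neg_distrib, neg_le_neg_iff, le_div_iff₀ (by positivity)]
    have h1 : (∑ i, 1 / (2 * s * τ * l i) * u i ^ 2) * (2 * s) = τ⁻¹ * ∑ i, u i ^ 2 / l i := by
      rw [Finset.mul_sum, Finset.sum_mul]
      refine Finset.sum_congr rfl fun i _ => ?_
      have := (hl i).ne'
      field_simp
    rw [h1, quad]
    linarith [sqnorm_nonneg (K *ᵥ u)]
  have hpos : ∀ i, 0 < 1 / (2 * s * τ * l i) := fun i => by have := hl i; positivity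
  have h1 : Integrable fun u : Fin n → ℝ => ∏ i, Real.exp (-(1 / (2 * s * τ * l i)) * u i ^ 2) :=
    Integrable.fintype_prod fun i => integrable_exp_neg_mul_sq (hpos i)
  constructor
  · refine h1.mono' ?_ (ae_of_all _ fun u => ?_)
    · exact ((Real.continuous_exp.comp ((continuous_quad l).neg.div_const _))).aestronglyMeasurable
    · rw [Real.norm_eq_abs, abs_of_pos (Real.exp_pos _)]; exact h0 u
  · refine (integral_mono_of_nonneg (ae_of_all _ fun u => (Real.exp_pos _).le) h1
      (ae_of_all _ h0)).trans_eq ?_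
    rw [integral_fintype_prod_volume_eq_prod
      (fun i (t : ℝ) => Real.exp (-(1 / (2 * s * τ * l i)) * t ^ 2))]
    refine Finset.prod_congr rfl fun i _ => ?_
    rw [integral_gaussian]
    congr 1
    field_simp

lemma le_integral_exp_neg_quad (hτ : 0 < τ) {l : Fin n → ℝ} (hl : ∀ i, 0 < l i) {s : ℝ}
    (hs : 0 < s) {c : ℝ} (hc : ∀ v : Fin n → ℝ, sqnorm (K *ᵥ v) ≤ c ^ 2 * sqnorm v) :
    ∏ i, √(2 * Real.pi * s * τ * l i / (1 + c ^ 2 * τ * l i)) ≤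
      ∫ u, Real.exp (-quad K τ l u / (2 * s)) := by
  have hp : ∀ i, 0 < 1 + c ^ 2 * τ * l i := fun i => by have := hl i; positivity
  have h0 : ∀ u : Fin n → ℝ, ∏ i, Real.exp (-((1 + c ^ 2 * τ * l i) / (2 * s * τ * l i)) * u i ^ 2)
      ≤ Real.exp (-quad K τ l u / (2 * s)) := fun u => by
    rw [← Real.exp_sum, Real.exp_le_exp, neg_div, ← Finset.sum_congr rfl fun i _ =>
      (neg_mul _ _).symm, Finset.sum_neg_distrib, neg_le_neg_iff, div_le_iff₀ (by positivity)]
    have h1 : (∑ i, (1 + c ^ 2 * τ * l i) / (2 * s * τ * l i) * u i ^ 2) * (2 * s) =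
        τ⁻¹ * ∑ i, u i ^ 2 / l i + c ^ 2 * sqnorm u := by
      rw [sqnorm_eq_sum, Finset.mul_sum, Finset.mul_sum, Finset.sum_mul, ← Finset.sum_add_distrib]
      refine Finset.sum_congr rfl fun i _ => ?_
      have := (hl i).ne'
      field_simp
    rw [h1, quad]
    linarith [hc u]
  refine le_trans (le_of_eq ?_) (integral_mono_of_nonneg
    (ae_of_all _ fun u => Finset.prod_nonneg fun i _ => (Real.exp_pos _).le)
    (integrable_exp_neg_quad hτ hl hs).1 (ae_of_all _ h0))
  rw [integral_fintype_prod_volume_eq_prod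
    (fun i (t : ℝ) => Real.exp (-((1 + c ^ 2 * τ * l i) / (2 * s * τ * l i)) * t ^ 2))]
  refine Finset.prod_congr rfl fun i _ => ?_
  rw [integral_gaussian]
  congr 1
  have := (hl i).ne'
  have := (hp i).ne'
  field_simp

lemma inverseGamma_integral {p B : ℝ} (hp : 0 < p) (hB : 0 < B) :
    IntegrableOn (fun s : ℝ => s ^ (-p - 1) * Real.exp (-B / (2 * s))) (Set.Ioi 0) ∧
    ∫ s in Set.Ioi (0 : ℝ), s ^ (-p - 1) * Real.exp (-B / (2 * s)) =
      (2 / B) ^ p * Real.Gamma p := by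
  let f : ℝ → ℝ := fun t => t ^ (p - 1) * Real.exp (-(B / 2 * t))
  have h1 : Set.EqOn (fun s : ℝ => (|(-1 : ℝ)| * s ^ ((-1 : ℝ) - 1)) • f (s ^ (-1 : ℝ)))
      (fun s : ℝ => s ^ (-p - 1) * Real.exp (-B / (2 * s))) (Set.Ioi 0) := by
    intro s hs
    have hs : 0 < s := hs
    simp only [f, smul_eq_mul, abs_neg, abs_one, one_mul]
    rw [← Real.rpow_mul hs.le, ← mul_assoc, ← Real.rpow_add hs, Real.rpow_neg_one]
    congr 2
    · ring
    · field_simp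
  have hf : IntegrableOn f (Set.Ioi 0) := by
    have := integrableOn_rpow_mul_exp_neg_mul_rpow (p := 1) (s := p - 1) (b := B / 2)
      (by linarith) one_pos (by positivity)
    simpa [f, neg_mul] using this
  constructor
  · exact (integrableOn_congr_fun h1 measurableSet_Ioi).mp
      ((integrableOn_Ioi_comp_rpow_iff f (by norm_num)).mpr hf)
  · rw [← setIntegral_congr_fun measurableSet_Ioi h1, integral_comp_rpow_Ioi f (by norm_num)]
    simp only [f]
    rw [Real.integral_rpow_mul_exp_neg_mul_Ioi hp (by positivity)]
    congr 2
    field_simp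

lemma integral_mul_of_reflection {φ L : (Fin n → ℝ) → ℝ} {β : Fin n → ℝ}
    (hφ : ∀ u, φ (β + u) = φ (β - u)) (hL : ∀ u, L (β + u) = 2 * L β - L (β - u))
    (h1 : Integrable φ) (h2 : Integrable fun u => φ u * L u) :
    ∫ u, φ u * L u = L β * ∫ u, φ u := by
  have h3 : ∫ u, φ u * L u = ∫ u, φ u * (2 * L β - L u) := by
    rw [← integral_sub_left_eq_self (fun u => φ u * L u) volume (2 • β)]
    congr 1
    funext u
    have ha := hφ (β - u)
    have hb := hL (β - u)
    have e1 : β + (β - u) = 2 • β - u := by rw [two_smul]; abel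
    have e2 : β - (β - u) = u := by abel
    rw [e1, e2] at ha hb
    rw [ha, hb]
  have h4 : ∫ u, φ u * (2 * L β - L u) = 2 * L β * (∫ u, φ u) - ∫ u, φ u * L u := by
    rw [← integral_const_mul, ← integral_sub (h1.const_mul _) h2]
    congr 1; funext u; ring
  linarith

end Quadratic

/-- The open positive orthant. -/
def orthant (n : ℕ) : Set (Fin n → ℝ) := Set.univ.pi fun _ => Set.Ioi 0

lemma mem_orthant {n : ℕ} {l : Fin n → ℝ} : l ∈ orthant n ↔ ∀ i, 0 < l i := by
  simp [orthant]

lemma measurableSet_orthant (n : ℕ) : MeasurableSet (orthant n) :=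
  MeasurableSet.univ_pi fun _ => measurableSet_Ioi

lemma volume_restrict_orthant (n : ℕ) : (volume : Measure (Fin n → ℝ)).restrict (orthant n) =
    Measure.pi fun _ => volume.restrict (Set.Ioi 0) := by
  rw [orthant, volume_pi, Measure.restrict_pi_pi]

lemma integral_orthant_prod {n : ℕ} (f : Fin n → ℝ → ℝ) :
    ∫ l in orthant n, ∏ i, f i (l i) = ∏ i, ∫ x in Set.Ioi (0 : ℝ), f i x := by
  rw [volume_restrict_orthant, integral_fintype_prod_eq_prod]

lemma integrableOn_orthant_prod {n : ℕ} {f : Fin n → ℝ → ℝ}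
    (hf : ∀ i, IntegrableOn (f i) (Set.Ioi 0)) :
    IntegrableOn (fun l => ∏ i, f i (l i)) (orthant n) := by
  rw [IntegrableOn, volume_restrict_orthant]
  exact Integrable.fintype_prod hf

lemma volume_restrict_posSet (n : ℕ) :
    (volume : Measure ((Fin n → ℝ) × ℝ × (Fin n → ℝ))).restrict (Model.posSet n) =
      (volume : Measure (Fin n → ℝ)).prod
        (((volume : Measure ℝ).restrict (Set.Ioi 0)).prod
          ((volume : Measure (Fin n → ℝ)).restrict (orthant n))) := by
  rw [Measure.prod_restrict]
  have h := Measure.prod_restrict (μ := (volume : Measure (Fin n → ℝ)))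
    (ν := (volume : Measure ℝ).prod (volume : Measure (Fin n → ℝ))) Set.univ
    (Set.Ioi 0 ×ˢ orthant n)
  rw [Measure.restrict_univ] at h
  rw [h]
  congr 1
  ext p
  simp [Model.posSet, mem_orthant]

namespace Model

variable (M : Model) {n : ℕ}

lemma jd_nonneg (Y β : Fin n → ℝ) {s : ℝ} {l : Fin n → ℝ} (hs : 0 < s) (hl : l ∈ orthant n) :
    0 ≤ M.jd n Y β s l := by
  have h1 : 0 ≤ ∏ i, M.pr (l i) := Finset.prod_nonneg fun i _ => M.hpr_nonneg _
  have h2 : 0 ≤ ∏ i, l i := Finset.prod_nonneg fun i _ => (mem_orthant.mp hl i).le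
  unfold jd
  positivity

/-- The part of the joint density that does not depend on `β`. -/
def jdWeight (n : ℕ) (s R : ℝ) (l : Fin n → ℝ) : ℝ :=
  s ^ (-(n : ℝ) - M.a / 2 - 1) * (∏ i, M.pr (l i)) * (∏ i, l i) ^ (-(1 : ℝ) / 2) *
    Real.exp (-(M.b + R) / (2 * s))

lemma jdWeight_nonneg {s : ℝ} (R : ℝ) {l : Fin n → ℝ} (hs : 0 < s) (hl : l ∈ orthant n) :
    0 ≤ M.jdWeight n s R l := by
  have h1 : 0 ≤ ∏ i, M.pr (l i) := Finset.prod_nonneg fun i _ => M.hpr_nonneg _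
  have h2 : 0 ≤ ∏ i, l i := Finset.prod_nonneg fun i _ => (mem_orthant.mp hl i).le
  unfold jdWeight
  positivity

lemma jd_eq (Y l β u : Fin n → ℝ) (s : ℝ)
    (hβ : ∀ u, crit (M.K n) (M.τsq n) Y l (β + u) =
      crit (M.K n) (M.τsq n) Y l β + quad (M.K n) (M.τsq n) l u) :
    M.jd n Y (β + u) s l = M.jdWeight n s (crit (M.K n) (M.τsq n) Y l β) l *
      Real.exp (-quad (M.K n) (M.τsq n) l u / (2 * s)) := by
  rw [jdWeight, mul_assoc, ← Real.exp_add, jd]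
  congr 2
  have := hβ u
  rw [crit] at this
  rw [← add_div]
  congr 1
  linarith

lemma integral_jd_eq (Y l β : Fin n → ℝ) (s : ℝ)
    (hβ : ∀ u, crit (M.K n) (M.τsq n) Y l (β + u) =
      crit (M.K n) (M.τsq n) Y l β + quad (M.K n) (M.τsq n) l u) :
    ∫ β', M.jd n Y β' s l = M.jdWeight n s (crit (M.K n) (M.τsq n) Y l β) l *
      ∫ u, Real.exp (-quad (M.K n) (M.τsq n) l u / (2 * s)) := by
  rw [← integral_add_left_eq_self _ β, ← integral_const_mul]
  congr 1
  funext u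
  exact M.jd_eq Y l β u s hβ

lemma jdWeight_mul_prod {s : ℝ} (R : ℝ) {l : Fin n → ℝ} (hs : 0 < s) (hl : l ∈ orthant n)
    (hτ : 0 < M.τsq n) (d : Fin n → ℝ) (hd : ∀ i, 0 < d i) :
    M.jdWeight n s R l * ∏ i, √(2 * Real.pi * s * M.τsq n * l i / d i) =
      √(2 * Real.pi * M.τsq n) ^ n * (∏ i, M.pr (l i) * (√(d i))⁻¹) *
        (s ^ (-((n + M.a) / 2) - 1) * Real.exp (-(M.b + R) / (2 * s))) := by
  have hl' := mem_orthant.mp hl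
  have h1 : ∏ i, √(2 * Real.pi * s * M.τsq n * l i / d i) =
      √(2 * Real.pi * M.τsq n) ^ n * s ^ ((n : ℝ) / 2) * (∏ i, √(l i)) * ∏ i, (√(d i))⁻¹ := by
    have : ∀ i, √(2 * Real.pi * s * M.τsq n * l i / d i) =
        √(2 * Real.pi * M.τsq n) * √s * √(l i) * (√(d i))⁻¹ := fun i => by
      rw [← div_eq_mul_inv, Real.sqrt_div' _ (hd i).le, ← Real.sqrt_mul (by positivity),
        ← Real.sqrt_mul (by positivity)]
      congr 2; ring
    simp only [this, Finset.prod_mul_distrib, Finset.prod_const, Finset.card_univ,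
      Fintype.card_fin]
    congr 3
    rw [Real.sqrt_eq_rpow, ← Real.rpow_natCast, ← Real.rpow_mul hs.le]
    congr 1; ring
  have h2 : (∏ i, l i) ^ (-(1 : ℝ) / 2) * ∏ i, √(l i) = 1 := by
    rw [← Real.finsetProd_rpow _ _ fun i _ => (hl' i).le, ← Finset.prod_mul_distrib]
    refine Finset.prod_eq_one fun i _ => ?_
    rw [Real.sqrt_eq_rpow, ← Real.rpow_add (hl' i)]
    norm_num
  have h3 : s ^ (-(n : ℝ) - M.a / 2 - 1) * s ^ ((n : ℝ) / 2) =
      s ^ (-((n + M.a) / 2) - 1) := by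
    rw [← Real.rpow_add hs]; congr 1; ring
  rw [h1, jdWeight, ← h3, Finset.prod_mul_distrib]
  calc _ = √(2 * Real.pi * M.τsq n) ^ n * ((∏ i, M.pr (l i)) * ∏ i, (√(d i))⁻¹) *
        (s ^ (-(n : ℝ) - M.a / 2 - 1) * s ^ ((n : ℝ) / 2) *
          Real.exp (-(M.b + R) / (2 * s))) *
        ((∏ i, l i) ^ (-(1 : ℝ) / 2) * ∏ i, √(l i)) := by ring
    _ = _ := by rw [h2, mul_one]

lemma integral_jd_le (Y : Fin n → ℝ) {l β : Fin n → ℝ} {s : ℝ} (hs : 0 < s) (hl : l ∈ orthant n)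
    (hτ : 0 < M.τsq n)
    (hβ : ∀ u, crit (M.K n) (M.τsq n) Y l (β + u) =
      crit (M.K n) (M.τsq n) Y l β + quad (M.K n) (M.τsq n) l u) :
    ∫ β', M.jd n Y β' s l ≤ √(2 * Real.pi * M.τsq n) ^ n * (∏ i, M.pr (l i)) *
      (s ^ (-((n + M.a) / 2) - 1) *
        Real.exp (-(M.b + crit (M.K n) (M.τsq n) Y l β) / (2 * s))) := by
  rw [M.integral_jd_eq Y l β s hβ]
  have h := M.jdWeight_mul_prod (crit (M.K n) (M.τsq n) Y l β) hs hl hτ (fun _ => 1)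
    fun _ => one_pos
  simp only [div_one, Real.sqrt_one, inv_one, mul_one] at h
  rw [← h]
  exact mul_le_mul_of_nonneg_left (integrable_exp_neg_quad hτ (mem_orthant.mp hl) hs).2
    (M.jdWeight_nonneg _ hs hl)

lemma le_integral_jd (Y : Fin n → ℝ) {l β : Fin n → ℝ} {s : ℝ} (hs : 0 < s) (hl : l ∈ orthant n)
    (hτ : 0 < M.τsq n) {c : ℝ} (hc : ∀ v : Fin n → ℝ, sqnorm (M.K n *ᵥ v) ≤ c ^ 2 * sqnorm v)
    (hβ : ∀ u, crit (M.K n) (M.τsq n) Y l (β + u) =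
      crit (M.K n) (M.τsq n) Y l β + quad (M.K n) (M.τsq n) l u) :
    √(2 * Real.pi * M.τsq n) ^ n * (∏ i, M.pr (l i) * (√(1 + c ^ 2 * M.τsq n * l i))⁻¹) *
      (s ^ (-((n + M.a) / 2) - 1) * Real.exp (-(M.b + sqnorm Y) / (2 * s))) ≤
      ∫ β', M.jd n Y β' s l := by
  have hl' := mem_orthant.mp hl
  rw [M.integral_jd_eq Y l β s hβ]
  have h := M.jdWeight_mul_prod (crit (M.K n) (M.τsq n) Y l β) hs hl hτ
    (fun i => 1 + c ^ 2 * M.τsq n * l i) fun i => by have := hl' i; positivity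
  refine le_trans ?_ (mul_le_mul_of_nonneg_left (le_integral_exp_neg_quad hτ hl' hs hc)
    (M.jdWeight_nonneg _ hs hl))
  rw [h]
  have h1 := crit_add_le Y l β hτ hl' hβ
  have h2 := sqnorm_nonneg (M.K n *ᵥ β)
  have h3 : 0 ≤ ∏ i, M.pr (l i) * (√(1 + c ^ 2 * M.τsq n * l i))⁻¹ :=
    Finset.prod_nonneg fun i _ => mul_nonneg (M.hpr_nonneg _) (by positivity)
  gcongr
  linarith

end Model

namespace Model

variable (M : Model) {n : ℕ}

/-- The prior normalization factor appearing in the lower bound for the marginal likelihood. -/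
def normFactor (n : ℕ) (c : ℝ) : ℝ :=
  (∫ x in Set.Ioi (0 : ℝ), M.pr x * (√(1 + c ^ 2 * M.τsq n * x))⁻¹) ^ n

/-- `w` behaves like the marginal posterior density of `λ²` and `R` like the residual
functional of the ridge regression with weights `λ²`. -/
structure IsMarginal (M : Model) (n : ℕ) (c : ℝ) (Y : Fin n → ℝ) (w R : (Fin n → ℝ) → ℝ) :
    Prop where
  integrable : IntegrableOn w (orthant n)
  nonneg : ∀ l ∈ orthant n, 0 ≤ w l
  integral_eq_one : ∫ l in orthant n, w l = 1
  resid_nonneg : ∀ l ∈ orthant n, 0 ≤ R l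
  le_resid : ∀ l ∈ orthant n, ∀ y, 2 * (Y ⬝ᵥ y) - sqnorm y -
    M.τsq n * ∑ i, l i * (M.K n *ᵥ y) i ^ 2 ≤ R l
  le_prior : ∀ l ∈ orthant n, w l * M.normFactor n c ≤
    (∏ i, M.pr (l i)) * ((M.b + sqnorm Y) / (M.b + R l)) ^ ((n + M.a) / 2)
  sqnorm_le : ∀ V : (Fin n → ℝ) → ℝ, IntegrableOn (fun l => w l * V l) (orthant n) →
    (∀ l ∈ orthant n, sqnorm Y - R l ≤ V l) →
    sqnorm (M.K n *ᵥ M.postMean n Y) ≤ ∫ l in orthant n, w l * V l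

lemma normFactor_nonneg (c : ℝ) : 0 ≤ M.normFactor n c :=
  pow_nonneg (setIntegral_nonneg measurableSet_Ioi fun _ _ =>
    mul_nonneg (M.hpr_nonneg _) (by positivity)) _

lemma exists_isMarginal (hτ : 0 < M.τsq n) {c : ℝ}
    (hc : ∀ v : Fin n → ℝ, sqnorm (M.K n *ᵥ v) ≤ c ^ 2 * sqnorm v) (Y : Fin n → ℝ) :
    M.postMean n Y = 0 ∨ ∃ w R, M.IsMarginal n c Y w R := by
  by_cases hZ0 : M.Z n Y = 0
  · left; simp [postMean, hZ0]
  let μ2 : Measure ℝ := (volume : Measure ℝ).restrict (Set.Ioi 0)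
  let μ3 : Measure (Fin n → ℝ) := (volume : Measure (Fin n → ℝ)).restrict (orthant n)
  let f : (Fin n → ℝ) × ℝ × (Fin n → ℝ) → ℝ := fun p => M.jd n Y p.1 p.2.1 p.2.2
  have hres : (volume : Measure ((Fin n → ℝ) × ℝ × (Fin n → ℝ))).restrict (Model.posSet n) =
      (volume : Measure (Fin n → ℝ)).prod (μ2.prod μ3) := volume_restrict_posSet n
  have hZ : M.Z n Y = ∫ p, f p ∂((volume : Measure (Fin n → ℝ)).prod (μ2.prod μ3)) := by
    rw [← hres]; rfl
  have hf : Integrable f ((volume : Measure (Fin n → ℝ)).prod (μ2.prod μ3)) := by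
    by_contra h
    exact hZ0 (by rw [hZ, integral_undef h])
  by_cases hf1 : Integrable (fun p => f p • p.1)
      ((volume : Measure (Fin n → ℝ)).prod (μ2.prod μ3))
  swap
  · left
    rw [postMean]
    rw [hres, integral_undef hf1, smul_zero]
  right
  have hpos2 : ∀ᵐ s ∂μ2, 0 < s := ae_restrict_mem measurableSet_Ioi
  have hpos3 : ∀ᵐ l ∂μ3, l ∈ orthant n := ae_restrict_mem (measurableSet_orthant n)
  have hpos23 : ∀ᵐ p ∂(μ2.prod μ3), 0 < p.1 ∧ p.2 ∈ orthant n := by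
    have : μ2.prod μ3 = (volume.prod volume).restrict (Set.Ioi 0 ×ˢ orthant n) :=
      Measure.prod_restrict _ _
    rw [this]
    filter_upwards [ae_restrict_mem (measurableSet_Ioi.prod (measurableSet_orthant n))] with p hp
    exact hp
  have hex : ∀ l, ∃ β, l ∈ orthant n → ∀ u, crit (M.K n) (M.τsq n) Y l (β + u) =
      crit (M.K n) (M.τsq n) Y l β + quad (M.K n) (M.τsq n) l u := fun l => by
    by_cases hl : l ∈ orthant n
    · obtain ⟨β, hβ⟩ := exists_center (M.hK n) hτ Y l (mem_orthant.mp hl)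
      exact ⟨β, fun _ => hβ⟩
    · exact ⟨0, fun h => absurd h hl⟩
  choose β hβ using hex
  let R : (Fin n → ℝ) → ℝ := fun l => crit (M.K n) (M.τsq n) Y l (β l)
  let G : ℝ → (Fin n → ℝ) → ℝ := fun s l => ∫ β', M.jd n Y β' s l
  let W : (Fin n → ℝ) → ℝ := fun l => ∫ s in Set.Ioi (0 : ℝ), G s l
  have hGint : Integrable (fun p : ℝ × (Fin n → ℝ) => G p.1 p.2) (μ2.prod μ3) :=
    hf.integral_prod_right
  have hWint : Integrable W μ3 := hGint.integral_prod_right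
  have hZW : M.Z n Y = ∫ l in orthant n, W l := by
    rw [hZ, integral_prod_symm _ hf]
    exact integral_prod_symm _ hGint
  have hG0 : ∀ s, 0 < s → ∀ l ∈ orthant n, 0 ≤ G s l := fun s hs l hl =>
    integral_nonneg fun β' => M.jd_nonneg Y β' hs hl
  have hW0 : ∀ l ∈ orthant n, 0 ≤ W l := fun l hl =>
    setIntegral_nonneg measurableSet_Ioi fun s hs => hG0 s hs l hl
  have hZpos : 0 < M.Z n Y := lt_of_le_of_ne
    (by rw [hZW]; exact setIntegral_nonneg (measurableSet_orthant n) hW0) (Ne.symm hZ0)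
  have hR0 : ∀ l ∈ orthant n, 0 ≤ R l := fun l hl => crit_nonneg hτ Y _ (mem_orthant.mp hl)
  have hp : 0 < ((n : ℝ) + M.a) / 2 := by have := M.ha; positivity
  have hb := M.hb
  have hY := sqnorm_nonneg Y
  set C0 := √(2 * Real.pi * M.τsq n) ^ n with hC0
  have hC0pos : 0 < C0 := by positivity
  have hΓ : 0 < Real.Gamma ((n + M.a) / 2) := Real.Gamma_pos_of_pos hp
  have hWub : ∀ l ∈ orthant n, W l ≤ C0 * (∏ i, M.pr (l i)) *
      ((2 / (M.b + R l)) ^ (((n : ℝ) + M.a) / 2) * Real.Gamma ((n + M.a) / 2)) := fun l hl => by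
    have h := inverseGamma_integral hp (B := M.b + R l) (by linarith [hR0 l hl])
    rw [← h.2, ← integral_const_mul]
    refine integral_mono_of_nonneg ?_ (h.1.const_mul _) ?_
    · filter_upwards [hpos2] with s hs using hG0 s hs l hl
    · filter_upwards [hpos2] with s hs using M.integral_jd_le Y hs hl hτ (hβ l hl)
  have hWlb : ∀ᵐ l ∂μ3, C0 * (∏ i, M.pr (l i) * (√(1 + c ^ 2 * M.τsq n * l i))⁻¹) *
      ((2 / (M.b + sqnorm Y)) ^ (((n : ℝ) + M.a) / 2) * Real.Gamma ((n + M.a) / 2)) ≤ W l := by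
    filter_upwards [hpos3, hGint.prod_left_ae] with l hl hl2
    have h := inverseGamma_integral hp (B := M.b + sqnorm Y) (by linarith)
    rw [← h.2, ← integral_const_mul]
    refine integral_mono_ae (h.1.const_mul _) hl2 ?_
    filter_upwards [hpos2] with s hs using M.le_integral_jd Y hs hl hτ hc (hβ l hl)
  have hprnn : ∀ l : Fin n → ℝ, 0 ≤ ∏ i, M.pr (l i) := fun l =>
    Finset.prod_nonneg fun i _ => M.hpr_nonneg _
  have hZlb : C0 * M.normFactor n c * ((2 / (M.b + sqnorm Y)) ^ (((n : ℝ) + M.a) / 2) *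
      Real.Gamma ((n + M.a) / 2)) ≤ M.Z n Y := by
    have h1 : M.normFactor n c =
        ∫ l in orthant n, ∏ i, M.pr (l i) * (√(1 + c ^ 2 * M.τsq n * l i))⁻¹ := by
      rw [integral_orthant_prod fun _ x => M.pr x * (√(1 + c ^ 2 * M.τsq n * x))⁻¹]
      simp [normFactor]
    rw [hZW, h1, ← integral_const_mul, ← integral_mul_const]
    refine integral_mono_of_nonneg (ae_of_all _ fun l => ?_) hWint hWlb
    have h3 : 0 ≤ ∏ i, M.pr (l i) * (√(1 + c ^ 2 * M.τsq n * l i))⁻¹ :=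
      Finset.prod_nonneg fun i _ => mul_nonneg (M.hpr_nonneg _) (by positivity)
    simp only [Pi.zero_apply]
    positivity
  refine ⟨fun l => (M.Z n Y)⁻¹ * W l, R, ?_⟩
  constructor
  · exact hWint.const_mul _
  · exact fun l hl => mul_nonneg (inv_nonneg.mpr hZpos.le) (hW0 l hl)
  · rw [integral_const_mul, ← hZW, inv_mul_cancel₀ hZ0]
  · exact hR0
  · exact fun l hl y => le_crit (M.hK n) hτ Y _ y (mem_orthant.mp hl)
  · intro l hl
    have hbR : 0 < M.b + R l := by linarith [hR0 l hl]
    have hbY : 0 < M.b + sqnorm Y := by linarith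
    rw [mul_assoc, inv_mul_le_iff₀ hZpos]
    have e1 : ((M.b + sqnorm Y) / (M.b + R l)) ^ (((n : ℝ) + M.a) / 2) *
        (2 / (M.b + sqnorm Y)) ^ (((n : ℝ) + M.a) / 2) =
        (2 / (M.b + R l)) ^ (((n : ℝ) + M.a) / 2) := by
      rw [← Real.mul_rpow (by positivity) (by positivity)]
      congr 1
      field_simp
    calc W l * M.normFactor n c ≤ _ :=
          mul_le_mul_of_nonneg_right (hWub l hl) (M.normFactor_nonneg c)
      _ = (C0 * M.normFactor n c * ((2 / (M.b + sqnorm Y)) ^ (((n : ℝ) + M.a) / 2) *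
            Real.Gamma ((n + M.a) / 2))) * ((∏ i, M.pr (l i)) *
            ((M.b + sqnorm Y) / (M.b + R l)) ^ (((n : ℝ) + M.a) / 2)) := by
          rw [← e1]; ring
      _ ≤ _ := mul_le_mul_of_nonneg_right hZlb (mul_nonneg (hprnn l) (by positivity))
  · intro V hV hRV
    set m := M.K n *ᵥ M.postMean n Y with hm
    let L : (Fin n → ℝ) → ℝ := fun b => m ⬝ᵥ (M.K n *ᵥ b)
    let Lc : (Fin n → ℝ) →L[ℝ] ℝ := LinearMap.toContinuousLinearMap
      { toFun := L
        map_add' := fun x y => by simp only [L, mulVec_add, dotProduct_add]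
        map_smul' := fun r x => by simp [L, mulVec_smul, dotProduct_smul] }
    have hLc : ∀ b, Lc b = L b := fun _ => rfl
    have hfL : Integrable (fun p => f p * L p.1)
        ((volume : Measure (Fin n → ℝ)).prod (μ2.prod μ3)) := by
      have := Lc.integrable_comp hf1
      refine this.congr (ae_of_all _ fun p => ?_)
      exact Lc.map_smul (f p) p.1
    have hmL : sqnorm m = (M.Z n Y)⁻¹ *
        ∫ p, f p * L p.1 ∂((volume : Measure (Fin n → ℝ)).prod (μ2.prod μ3)) := by
      have h1 : sqnorm m = Lc (M.postMean n Y) := rfl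
      rw [h1, postMean, map_smul, hres, ← Lc.integral_comp_comm hf1, smul_eq_mul]
      congr 2
      funext p
      exact Lc.map_smul (f p) p.1
    have hmean : ∀ᵐ p ∂(μ2.prod μ3), ∫ b, M.jd n Y b p.1 p.2 * L b = L (β p.2) * G p.1 p.2 := by
      filter_upwards [hpos23, hf.prod_left_ae, hfL.prod_left_ae] with p hp h1 h2
      refine integral_mul_of_reflection (fun u => ?_) (fun u => ?_) h1 h2
      · rw [sub_eq_add_neg, M.jd_eq Y p.2 _ u p.1 (hβ _ hp.2),
          M.jd_eq Y p.2 _ (-u) p.1 (hβ _ hp.2), quad_neg]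
      · simp only [← hLc, map_add, map_sub]; ring
    have hmi : Integrable (fun p : ℝ × (Fin n → ℝ) => L (β p.2) * G p.1 p.2) (μ2.prod μ3) :=
      hfL.integral_prod_right.congr hmean
    have hmi2 : Integrable (fun l => L (β l) * W l) μ3 := by
      refine hmi.integral_prod_right.congr (ae_of_all _ fun l => ?_)
      exact integral_const_mul (L (β l)) fun s => G s l
    have hI : ∫ p, f p * L p.1 ∂((volume : Measure (Fin n → ℝ)).prod (μ2.prod μ3)) =
        ∫ l in orthant n, L (β l) * W l := by
      rw [integral_prod_symm _ hfL]
      rw [integral_congr_ae (g := fun p : ℝ × (Fin n → ℝ) => L (β p.2) * G p.1 p.2) hmean]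
      rw [integral_prod_symm _ hmi]
      congr 1
      funext l
      exact integral_const_mul (L (β l)) fun s => G s l
    have hle : (M.Z n Y)⁻¹ * ∫ l in orthant n, L (β l) * W l ≤
        ∫ l in orthant n, (1 / 2 * sqnorm m * ((M.Z n Y)⁻¹ * W l) +
          1 / 2 * ((M.Z n Y)⁻¹ * W l * V l)) := by
      rw [← integral_const_mul]
      refine integral_mono_ae (hmi2.const_mul _)
        (((hWint.const_mul _).const_mul _).add (hV.const_mul _)) ?_
      filter_upwards [hpos3] with l hl
      have h1 : L (β l) ≤ 1 / 2 * sqnorm m + 1 / 2 * V l := by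
        have h2 := sqnorm_nonneg (m - M.K n *ᵥ β l)
        rw [sqnorm_sub] at h2
        have h3 := crit_add_le Y l (β l) hτ (mem_orthant.mp hl) (hβ l hl)
        have h4 := hRV l hl
        simp only [R, L] at h4 ⊢
        linarith
      have h2 : 0 ≤ (M.Z n Y)⁻¹ * W l := mul_nonneg (inv_nonneg.mpr hZpos.le) (hW0 l hl)
      have h3 := mul_le_mul_of_nonneg_right h1 h2
      nlinarith
    rw [integral_add ((hWint.const_mul _).const_mul _) (hV.const_mul _), integral_const_mul,
      integral_const_mul, integral_const_mul, ← hZW, inv_mul_cancel₀ hZ0] at hle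
    rw [hI] at hmL
    rw [← hmL] at hle
    linarith

end Model

section Cells

variable {n : ℕ} {K : Matrix (Fin n) (Fin n) ℝ} {τ t c : ℝ}

/-- The set of coordinates whose scaled local parameter exceeds the threshold `t`. -/
def active (τ t : ℝ) (l : Fin n → ℝ) : Finset (Fin n) := {i | t < τ * l i}

/-- The part of the orthant where the active set is `J`. -/
def cell (n : ℕ) (τ t : ℝ) (J : Finset (Fin n)) : Set (Fin n → ℝ) :=
  {l | l ∈ orthant n ∧ active τ t l = J}

lemma mem_cell {J : Finset (Fin n)} {l : Fin n → ℝ} :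
    l ∈ cell n τ t J ↔ l ∈ orthant n ∧ ∀ i, t < τ * l i ↔ i ∈ J := by
  simp [cell, active, Finset.ext_iff]

lemma measurableSet_cell (J : Finset (Fin n)) : MeasurableSet (cell n τ t J) := by
  have h : cell n τ t J = orthant n ∩ ⋂ i, {l | t < τ * l i ↔ i ∈ J} := by
    ext l; simp [mem_cell]
  rw [h]
  refine (measurableSet_orthant n).inter (MeasurableSet.iInter fun i => ?_)
  have h1 : MeasurableSet {l : Fin n → ℝ | t < τ * l i} :=
    measurableSet_lt measurable_const (by fun_prop)
  by_cases hi : i ∈ J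
  · simpa [hi] using h1
  · have h2 : {l : Fin n → ℝ | t < τ * l i ↔ i ∈ J} = {l : Fin n → ℝ | t < τ * l i}ᶜ := by
      ext l; simp [hi]
    rw [h2]
    exact h1.compl

lemma cell_subset (J : Finset (Fin n)) : cell n τ t J ⊆ orthant n := fun _ h => h.1

lemma iUnion_cell : ⋃ J, cell n τ t J = orthant n := by
  ext l; simp [cell]

lemma pairwise_disjoint_cell : Pairwise (Function.onFun Disjoint (cell n τ t)) := by
  intro J J' hne
  refine Set.disjoint_left.mpr fun l h1 h2 => hne ?_
  rw [← h1.2, ← h2.2]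

lemma integrableOn_of_cells {F : Finset (Fin n) → (Fin n → ℝ) → ℝ}
    (hF : ∀ J, IntegrableOn (F J) (cell n τ t J)) :
    IntegrableOn (fun l => F (active τ t l) l) (orthant n) := by
  rw [← iUnion_cell (τ := τ) (t := t), integrableOn_finite_iUnion]
  intro J
  refine (hF J).congr_fun (fun l hl => ?_) (measurableSet_cell J)
  simp only [hl.2]

lemma integral_eq_sum_cells {F : Finset (Fin n) → (Fin n → ℝ) → ℝ}
    (hF : ∀ J, IntegrableOn (F J) (cell n τ t J)) :
    ∫ l in orthant n, F (active τ t l) l = ∑ J, ∫ l in cell n τ t J, F J l := by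
  have h1 : ∀ J, Set.EqOn (fun l => F (active τ t l) l) (F J) (cell n τ t J) := fun J l hl => by
    simp only [hl.2]
  rw [← iUnion_cell (τ := τ) (t := t), integral_iUnion_fintype measurableSet_cell
    pairwise_disjoint_cell fun J => (hF J).congr_fun (h1 J).symm (measurableSet_cell J)]
  exact Finset.sum_congr rfl fun J _ => setIntegral_congr_fun (measurableSet_cell J) (h1 J)

/-- Upper bound for the explained sum of squares on the cell with active set `J`. -/
def cellBound (K : Matrix (Fin n) (Fin n) ℝ) (τ t c : ℝ) (J : Finset (Fin n))
    (Y l : Fin n → ℝ) : ℝ :=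
  (1 + 2 * (t * c ^ 2)) * pf K J Y + 2 * ∑ i ∈ Jᶜ, τ * l i * (K *ᵥ Y) i ^ 2

lemma continuous_cellBound (J : Finset (Fin n)) (Y : Fin n → ℝ) :
    Continuous (cellBound K τ t c J Y) := by
  unfold cellBound; fun_prop

lemma sum_compl_le_of_mem_cell {J : Finset (Fin n)} {l : Fin n → ℝ} (ht : 0 < t)
    (hc : ∀ v : Fin n → ℝ, sqnorm (K *ᵥ v) ≤ c ^ 2 * sqnorm v)
    (hl : l ∈ cell n τ t J) (y : Fin n → ℝ) :
    ∑ i ∈ Jᶜ, τ * l i * (K *ᵥ y) i ^ 2 ≤ t * c ^ 2 * sqnorm y := by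
  have h1 : ∑ i ∈ Jᶜ, τ * l i * (K *ᵥ y) i ^ 2 ≤ ∑ i ∈ Jᶜ, t * (K *ᵥ y) i ^ 2 := by
    refine Finset.sum_le_sum fun i hi => mul_le_mul_of_nonneg_right ?_ (sq_nonneg _)
    by_contra h
    exact Finset.mem_compl.mp hi (((mem_cell.mp hl).2 i).mp (not_le.mp h))
  have h2 : ∑ i ∈ Jᶜ, (K *ᵥ y) i ^ 2 ≤ sqnorm (K *ᵥ y) := by
    rw [sqnorm_eq_sum]
    exact Finset.sum_le_sum_of_subset_of_nonneg (Finset.subset_univ _) fun _ _ _ => sq_nonneg _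
  rw [← Finset.mul_sum] at h1
  calc _ ≤ t * (c ^ 2 * sqnorm y) := h1.trans (mul_le_mul_of_nonneg_left (h2.trans (hc y)) ht.le)
    _ = _ := by ring

lemma cellBound_nonneg {J : Finset (Fin n)} (Y : Fin n → ℝ) {l : Fin n → ℝ} (ht : 0 < t)
    (hτ : 0 < τ) (hl : l ∈ orthant n) : 0 ≤ cellBound K τ t c J Y l := by
  have h1 := pf_nonneg K J Y
  have h2 : 0 ≤ ∑ i ∈ Jᶜ, τ * l i * (K *ᵥ Y) i ^ 2 := Finset.sum_nonneg fun i _ => by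
    have := mem_orthant.mp hl i; positivity
  unfold cellBound
  positivity

lemma cellBound_le {J : Finset (Fin n)} (Y : Fin n → ℝ) {l : Fin n → ℝ} (ht : 0 < t)
    (hc : ∀ v : Fin n → ℝ, sqnorm (K *ᵥ v) ≤ c ^ 2 * sqnorm v) (hl : l ∈ cell n τ t J) :
    cellBound K τ t c J Y l ≤ (1 + 4 * (t * c ^ 2)) * sqnorm Y := by
  have h1 := sum_compl_le_of_mem_cell ht hc hl Y
  have h2 : pf K J Y ≤ sqnorm Y := by linarith [pf_add_qf K J Y, qf_nonneg K J Y]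
  have h3 : 0 ≤ 1 + 2 * (t * c ^ 2) := by positivity
  have h4 := mul_le_mul_of_nonneg_left h2 h3
  unfold cellBound
  linarith

variable {M : Model} {Y : Fin n → ℝ} {w R : (Fin n → ℝ) → ℝ}

lemma sum_orthPart (hK : Kᵀ = K) (τ : ℝ) (J : Finset (Fin n)) (Y l : Fin n → ℝ) :
    τ * ∑ i, l i * (K *ᵥ orthPart K J Y) i ^ 2 =
      ∑ i ∈ Jᶜ, τ * l i * (K *ᵥ orthPart K J Y) i ^ 2 := by
  rw [Finset.mul_sum, ← Finset.sum_add_sum_compl J, Finset.sum_eq_zero, zero_add]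
  · exact Finset.sum_congr rfl fun i _ => by ring
  · intro i hi; rw [mulVec_orthPart J Y hK hi]; ring

namespace Model.IsMarginal

lemma qf_le_resid (h : M.IsMarginal n c Y w R) (ht : 0 < t)
    (hc : ∀ v : Fin n → ℝ, sqnorm (M.K n *ᵥ v) ≤ c ^ 2 * sqnorm v) {J : Finset (Fin n)}
    {l : Fin n → ℝ} (hl : l ∈ cell n (M.τsq n) t J) :
    (1 - t * c ^ 2) * qf (M.K n) J Y ≤ R l := by
  have h1 := h.le_resid l hl.1 (orthPart (M.K n) J Y)
  have hK := transpose_eq_self (M.hK n)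
  rw [dotProduct_orthPart, sqnorm_orthPart, sum_orthPart hK] at h1
  have h2 := sum_compl_le_of_mem_cell ht hc hl (orthPart (M.K n) J Y)
  rw [sqnorm_orthPart] at h2
  linarith

lemma sub_resid_le (h : M.IsMarginal n c Y w R) (hτ : 0 < M.τsq n) (ht : 0 < t)
    (hc : ∀ v : Fin n → ℝ, sqnorm (M.K n *ᵥ v) ≤ c ^ 2 * sqnorm v) {J : Finset (Fin n)}
    {l : Fin n → ℝ} (hl : l ∈ cell n (M.τsq n) t J) :
    sqnorm Y - R l ≤ cellBound (M.K n) (M.τsq n) t c J Y l := by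
  have h1 := h.le_resid l hl.1 (orthPart (M.K n) J Y)
  have hK := transpose_eq_self (M.hK n)
  rw [dotProduct_orthPart, sqnorm_orthPart, sum_orthPart hK] at h1
  have h2 := sum_compl_le_of_mem_cell ht hc hl (Y - orthPart (M.K n) J Y)
  rw [sqnorm_sub_orthPart] at h2
  have h3 : ∑ i ∈ Jᶜ, M.τsq n * l i * (M.K n *ᵥ orthPart (M.K n) J Y) i ^ 2 ≤
      2 * ∑ i ∈ Jᶜ, M.τsq n * l i * (M.K n *ᵥ Y) i ^ 2 +
      2 * ∑ i ∈ Jᶜ, M.τsq n * l i * (M.K n *ᵥ (Y - orthPart (M.K n) J Y)) i ^ 2 := by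
    rw [Finset.mul_sum, Finset.mul_sum, ← Finset.sum_add_distrib]
    refine Finset.sum_le_sum fun i _ => ?_
    have h4 : 0 ≤ M.τsq n * l i := mul_nonneg hτ.le (mem_orthant.mp hl.1 i).le
    rw [mulVec_sub, Pi.sub_apply]
    nlinarith [mul_nonneg h4 (sq_nonneg (2 * (M.K n *ᵥ Y) i -
      (M.K n *ᵥ orthPart (M.K n) J Y) i))]
  have h5 := pf_add_qf (M.K n) J Y
  unfold cellBound
  linarith

lemma integrableOn_cell (h : M.IsMarginal n c Y w R) (J : Finset (Fin n)) (τ t : ℝ)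
    {g : (Fin n → ℝ) → ℝ} (hg : Continuous g) {B : ℝ}
    (hB : ∀ l ∈ cell n τ t J, |g l| ≤ B) :
    IntegrableOn (fun l => w l * g l) (cell n τ t J) := by
  have h1 : IntegrableOn w (cell n τ t J) := h.integrable.mono_set (cell_subset J)
  refine (h1.norm.mul_const B).mono' (h1.aestronglyMeasurable.mul hg.aestronglyMeasurable) ?_
  filter_upwards [ae_restrict_mem (measurableSet_cell J)] with l hl
  rw [norm_mul]
  exact mul_le_mul_of_nonneg_left (hB l hl) (norm_nonneg _)

end Model.IsMarginal

end Cells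

section CellMass

variable {n : ℕ}

namespace Model

variable (M : Model)

lemma integrableOn_pr : IntegrableOn M.pr (Set.Ioi 0) := by
  by_contra h
  have := M.hpr_int
  rw [integral_undef h] at this
  exact zero_ne_one this

lemma integrableOn_mul_pr {δ : ℝ} (hδ : 0 < δ)
    (hmom : IntegrableOn (fun x => x ^ ((1 : ℝ) + δ) * M.pr x) (Set.Ioi (0 : ℝ))) :
    IntegrableOn (fun x => x * M.pr x) (Set.Ioi (0 : ℝ)) := by
  have h1 := M.integrableOn_pr
  refine (h1.add hmom).mono' (aestronglyMeasurable_id.mul h1.aestronglyMeasurable) ?_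
  filter_upwards [ae_restrict_mem measurableSet_Ioi] with x hx
  have hx : 0 < x := hx
  have hp := M.hpr_nonneg x
  rw [Real.norm_eq_abs, abs_of_nonneg (mul_nonneg hx.le hp)]
  have h2 : x ≤ 1 + x ^ ((1 : ℝ) + δ) := by
    rcases le_total x 1 with h | h
    · have := Real.rpow_nonneg hx.le ((1 : ℝ) + δ); linarith
    · have := Real.rpow_le_rpow_of_exponent_le h (by linarith : (1 : ℝ) ≤ 1 + δ)
      rw [Real.rpow_one] at this; linarith
  have := mul_le_mul_of_nonneg_right h2 hp
  simp only [Pi.add_apply]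
  linarith

/-- Markov bound for the prior probability of exceeding the threshold `t`. -/
def tailBound (δ t : ℝ) (n : ℕ) : ℝ :=
  (M.τsq n / t) ^ (1 + δ) * ∫ x in Set.Ioi (0 : ℝ), x ^ (1 + δ) * M.pr x

/-- Scaled prior mean. -/
def meanBound (t : ℝ) (n : ℕ) : ℝ :=
  M.τsq n / t * ∫ x in Set.Ioi (0 : ℝ), x * M.pr x

lemma meanBound_nonneg {t : ℝ} (ht : 0 < t) (hτ : 0 < M.τsq n) : 0 ≤ M.meanBound t n := by
  have : 0 ≤ ∫ x in Set.Ioi (0 : ℝ), x * M.pr x := setIntegral_nonneg measurableSet_Ioi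
    fun x hx => mul_nonneg (le_of_lt hx) (M.hpr_nonneg x)
  unfold meanBound; positivity

lemma tailBound_nonneg {t δ : ℝ} (ht : 0 < t) (hτ : 0 < M.τsq n) : 0 ≤ M.tailBound δ t n := by
  have : 0 ≤ ∫ x in Set.Ioi (0 : ℝ), x ^ (1 + δ) * M.pr x := setIntegral_nonneg measurableSet_Ioi
    fun x hx => mul_nonneg (Real.rpow_nonneg (le_of_lt hx) _) (M.hpr_nonneg x)
  unfold tailBound; positivity

end Model

lemma exp_mul_le_chord {d w t : ℝ} (ht : 0 < t) (hw : 0 ≤ w) (hwt : w ≤ t) :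
    Real.exp (w * d) ≤ 1 + w / t * Real.exp (t * d) := by
  have h0 : 0 ≤ w / t := by positivity
  have h1 : w / t ≤ 1 := (div_le_one ht).mpr hwt
  have h := convexOn_exp.2 (Set.mem_univ (0 : ℝ)) (Set.mem_univ (t * d))
    (sub_nonneg.mpr h1) h0 (by ring)
  simp only [smul_eq_mul, mul_zero, zero_add, Real.exp_zero, mul_one] at h
  have e : w / t * (t * d) = w * d := by field_simp
  rw [e] at h
  linarith

variable {M : Model} {c : ℝ} {Y : Fin n → ℝ} {w R : (Fin n → ℝ) → ℝ}

lemma Model.IsMarginal.integral_cell_le (h : M.IsMarginal n c Y w R) {δ t : ℝ} (hδ : 0 < δ)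
    (ht : 0 < t) (hτ : 0 < M.τsq n)
    (hmom : IntegrableOn (fun x => x ^ ((1 : ℝ) + δ) * M.pr x) (Set.Ioi (0 : ℝ)))
    {Δ T : ℝ} (hΔ0 : 0 ≤ Δ) (hT : 0 ≤ T) (hΔ : 1 ≤ Δ * M.normFactor n c) {J : Finset (Fin n)}
    {g : (Fin n → ℝ) → ℝ} {d : Fin n → ℝ}
    (hg0 : ∀ l ∈ cell n (M.τsq n) t J, 0 ≤ g l)
    (hg : ∀ l ∈ cell n (M.τsq n) t J,
      ((M.b + sqnorm Y) / (M.b + R l)) ^ ((n + M.a) / 2) * g l ≤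
        T * Real.exp (∑ i ∈ Jᶜ, M.τsq n * l i * d i)) :
    ∫ l in cell n (M.τsq n) t J, w l * g l ≤
      Δ * T * M.tailBound δ t n ^ J.card *
        ∏ i, (1 + M.meanBound t n * Real.exp (t * d i)) := by
  let H : Fin n → ℝ → ℝ := fun i x => if i ∈ J then (M.τsq n / t) ^ (1 + δ) *
    (x ^ (1 + δ) * M.pr x) else M.pr x + M.τsq n / t * Real.exp (t * d i) * (x * M.pr x)
  have hm1 := M.integrableOn_mul_pr hδ hmom
  have hHi : ∀ i, IntegrableOn (H i) (Set.Ioi 0) := fun i => by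
    by_cases hi : i ∈ J
    · simp only [H, hi, if_true]; exact hmom.const_mul _
    · simp only [H, hi, if_false]; exact M.integrableOn_pr.add (hm1.const_mul _)
  have hH0 : ∀ i, ∀ x, 0 < x → 0 ≤ H i x := fun i x hx => by
    have := M.hpr_nonneg x
    by_cases hi : i ∈ J
    · simp only [H, hi, if_true]; positivity
    · simp only [H, hi, if_false]; positivity
  have hHint : ∀ i, ∫ x in Set.Ioi (0 : ℝ), H i x = if i ∈ J then M.tailBound δ t n else
      1 + M.meanBound t n * Real.exp (t * d i) := fun i => by
    by_cases hi : i ∈ J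
    · simp only [H, hi, if_true]; rw [integral_const_mul]; rfl
    · simp only [H, hi, if_false]
      rw [integral_add M.integrableOn_pr (hm1.const_mul _), integral_const_mul, M.hpr_int,
        Model.meanBound]
      ring
  have hprod : ∀ l ∈ cell n (M.τsq n) t J,
      (∏ i, M.pr (l i)) * Real.exp (∑ i ∈ Jᶜ, M.τsq n * l i * d i) ≤ ∏ i, H i (l i) := by
    intro l hl
    have hl' := mem_cell.mp hl
    have hpos := mem_orthant.mp hl'.1
    have e1 : Real.exp (∑ i ∈ Jᶜ, M.τsq n * l i * d i) =
        ∏ i, if i ∈ J then 1 else Real.exp (M.τsq n * l i * d i) := by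
      rw [Real.exp_sum, ← Finset.prod_mul_prod_compl J (fun i => if i ∈ J then (1 : ℝ) else _),
        Finset.prod_eq_one (s := J) fun i hi => by simp [hi], one_mul]
      exact Finset.prod_congr rfl fun i hi => by simp [Finset.mem_compl.mp hi]
    rw [e1, ← Finset.prod_mul_distrib]
    refine Finset.prod_le_prod (fun i _ => ?_) fun i _ => ?_
    · have := M.hpr_nonneg (l i)
      split_ifs <;> positivity
    · have hp := M.hpr_nonneg (l i)
      have hli := hpos i
      by_cases hi : i ∈ J
      · simp only [H, hi, if_true, mul_one]
        have h1 : 1 ≤ (M.τsq n / t) ^ (1 + δ) * l i ^ (1 + δ) := by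
          rw [← Real.mul_rpow (by positivity) (by positivity)]
          refine Real.one_le_rpow ?_ (by linarith)
          rw [div_mul_eq_mul_div, one_le_div ht]
          exact ((hl'.2 i).mpr hi).le
        rw [← mul_assoc]
        exact le_mul_of_one_le_left hp h1
      · simp only [H, hi, if_false]
        have h1 : M.τsq n * l i ≤ t := not_lt.mp fun h => hi ((hl'.2 i).mp h)
        have h2 := mul_le_mul_of_nonneg_left
          (exp_mul_le_chord (d := d i) ht (by positivity) h1) hp
        calc _ ≤ _ := h2
          _ = _ := by ring
  have hHprod : IntegrableOn (fun l => Δ * T * ∏ i, H i (l i)) (orthant n) :=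
    (integrableOn_orthant_prod hHi).const_mul _
  calc ∫ l in cell n (M.τsq n) t J, w l * g l
      ≤ ∫ l in cell n (M.τsq n) t J, Δ * T * ∏ i, H i (l i) := by
        refine integral_mono_of_nonneg ?_ (hHprod.mono_set (cell_subset J)) ?_
        · filter_upwards [ae_restrict_mem (measurableSet_cell J)] with l hl
          exact mul_nonneg (h.nonneg l hl.1) (hg0 l hl)
        · filter_upwards [ae_restrict_mem (measurableSet_cell J)] with l hl
          have hw := h.nonneg l hl.1
          have hg1 := hg0 l hl
          have hpr : 0 ≤ ∏ i, M.pr (l i) := Finset.prod_nonneg fun i _ => M.hpr_nonneg _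
          calc w l * g l ≤ (Δ * M.normFactor n c) * (w l * g l) :=
                le_mul_of_one_le_left (mul_nonneg hw hg1) hΔ
            _ = Δ * ((w l * M.normFactor n c) * g l) := by ring
            _ ≤ Δ * (((∏ i, M.pr (l i)) *
                  ((M.b + sqnorm Y) / (M.b + R l)) ^ ((n + M.a) / 2)) * g l) := by
                have := h.le_prior l hl.1
                gcongr
            _ = Δ * ((∏ i, M.pr (l i)) *
                  (((M.b + sqnorm Y) / (M.b + R l)) ^ ((n + M.a) / 2) * g l)) := by ring
            _ ≤ Δ * ((∏ i, M.pr (l i)) *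
                  (T * Real.exp (∑ i ∈ Jᶜ, M.τsq n * l i * d i))) := by
                have := hg l hl
                gcongr
            _ = Δ * T * ((∏ i, M.pr (l i)) *
                  Real.exp (∑ i ∈ Jᶜ, M.τsq n * l i * d i)) := by ring
            _ ≤ _ := mul_le_mul_of_nonneg_left (hprod l hl) (by positivity)
    _ ≤ ∫ l in orthant n, Δ * T * ∏ i, H i (l i) := by
        refine setIntegral_mono_set hHprod ?_ (cell_subset J).eventuallyLE
        filter_upwards [ae_restrict_mem (measurableSet_orthant n)] with l hl
        have : 0 ≤ ∏ i, H i (l i) := Finset.prod_nonneg fun i _ =>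
          hH0 i _ (mem_orthant.mp hl i)
        simp only [Pi.zero_apply]
        positivity
    _ = Δ * T * ∏ i, if i ∈ J then M.tailBound δ t n else
          1 + M.meanBound t n * Real.exp (t * d i) := by
        rw [integral_const_mul, integral_orthant_prod H]
        simp only [hHint]
    _ ≤ Δ * T * (M.tailBound δ t n ^ J.card *
          ∏ i, (1 + M.meanBound t n * Real.exp (t * d i))) := by
        have hm := M.meanBound_nonneg ht hτ
        have hρ := M.tailBound_nonneg (δ := δ) ht hτ
        refine mul_le_mul_of_nonneg_left ?_ (by positivity)
        have hone : ∀ i, 1 ≤ 1 + M.meanBound t n * Real.exp (t * d i) := fun i =>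
          le_add_of_nonneg_right (by positivity)
        rw [← Finset.prod_mul_prod_compl J, ← Finset.prod_mul_prod_compl J
          fun i => 1 + M.meanBound t n * Real.exp (t * d i)]
        have e1 : (∏ i ∈ J, if i ∈ J then M.tailBound δ t n else
            1 + M.meanBound t n * Real.exp (t * d i)) = M.tailBound δ t n ^ J.card := by
          rw [Finset.prod_congr rfl fun i hi => if_pos hi, Finset.prod_const]
        have e2 : (∏ i ∈ Jᶜ, if i ∈ J then M.tailBound δ t n else
            1 + M.meanBound t n * Real.exp (t * d i)) =
            ∏ i ∈ Jᶜ, (1 + M.meanBound t n * Real.exp (t * d i)) :=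
          Finset.prod_congr rfl fun i hi => if_neg (Finset.mem_compl.mp hi)
        rw [e1, e2]
        refine mul_le_mul_of_nonneg_left ?_ (by positivity)
        refine le_mul_of_one_le_left (Finset.prod_nonneg fun i _ => by linarith [hone i]) ?_
        exact Finset.prod_induction _ (1 ≤ ·) (fun a b ha hb => one_le_mul_of_one_le_of_one_le ha hb)
          le_rfl fun i _ => hone i
    _ = _ := by ring

end CellMass

section Posterior

variable {n : ℕ} {M : Model} {c : ℝ} {Y : Fin n → ℝ} {w R : (Fin n → ℝ) → ℝ}

lemma setIntegral_mul_exp_le_rpow {E : Type*} [MeasurableSpace E] {μ : Measure E} {C : Set E}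
    (hC : MeasurableSet C) {w f : E → ℝ} {θ S : ℝ} (hθ0 : 0 < θ) (hθ1 : θ ≤ 1) (hS : 0 < S)
    (hw : IntegrableOn w C μ) (hw0 : ∀ l ∈ C, 0 ≤ w l) (hw1 : ∫ l in C, w l ∂μ ≤ 1)
    (hf : IntegrableOn (fun l => w l * Real.exp (f l / θ)) C μ)
    (hfS : ∫ l in C, w l * Real.exp (f l / θ) ∂μ ≤ S) :
    ∫ l in C, w l * Real.exp (f l) ∂μ ≤ S ^ θ := by
  have hpt : ∀ l, Real.exp (f l) ≤ S ^ θ * (θ / S * Real.exp (f l / θ) + (1 - θ)) := fun l => by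
    have h1 := rpow_one_add_le_one_add_mul_self (s := Real.exp (f l / θ) / S - 1)
      (by have : 0 ≤ Real.exp (f l / θ) / S := by positivity
          linarith) hθ0.le hθ1
    have h2 : Real.exp (f l) = S ^ θ * (Real.exp (f l / θ) / S) ^ θ := by
      rw [← Real.mul_rpow hS.le (by positivity), mul_div_cancel₀ _ hS.ne', ← Real.exp_mul,
        div_mul_cancel₀ _ hθ0.ne']
    rw [h2]
    refine mul_le_mul_of_nonneg_left ?_ (by positivity)
    rw [add_sub_cancel] at h1
    refine h1.trans_eq ?_
    field_simp
    ring
  have hint : IntegrableOn (fun l => S ^ θ * (θ / S) * (w l * Real.exp (f l / θ)) +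
      S ^ θ * (1 - θ) * w l) C μ := (hf.const_mul _).add (hw.const_mul _)
  calc ∫ l in C, w l * Real.exp (f l) ∂μ ≤ ∫ l in C, (S ^ θ * (θ / S) *
        (w l * Real.exp (f l / θ)) + S ^ θ * (1 - θ) * w l) ∂μ := by
        refine integral_mono_of_nonneg ?_ hint ?_
        · filter_upwards [ae_restrict_mem hC] with l hl
          exact mul_nonneg (hw0 l hl) (Real.exp_pos _).le
        · filter_upwards [ae_restrict_mem hC] with l hl
          calc _ ≤ _ := mul_le_mul_of_nonneg_left (hpt l) (hw0 l hl)
            _ = _ := by ring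
    _ = S ^ θ * (θ / S) * (∫ l in C, w l * Real.exp (f l / θ) ∂μ) +
          S ^ θ * (1 - θ) * ∫ l in C, w l ∂μ := by
        rw [integral_add (hf.const_mul _) (hw.const_mul _), integral_const_mul, integral_const_mul]
    _ ≤ S ^ θ * (θ / S) * S + S ^ θ * (1 - θ) * 1 := by
        have : 0 ≤ 1 - θ := by linarith
        gcongr
    _ = S ^ θ := by field_simp; ring

namespace Model.IsMarginal

lemma integral_cell_le_one (h : M.IsMarginal n c Y w R) {τ t : ℝ} (J : Finset (Fin n)) :
    ∫ l in cell n τ t J, w l ≤ 1 := by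
  rw [← h.integral_eq_one]
  refine setIntegral_mono_set h.integrable ?_ (cell_subset J).eventuallyLE
  filter_upwards [ae_restrict_mem (measurableSet_orthant n)] with l hl using h.nonneg l hl

lemma ratio_nonneg (h : M.IsMarginal n c Y w R) {l : Fin n → ℝ} (hl : l ∈ orthant n) :
    0 ≤ (M.b + sqnorm Y) / (M.b + R l) := by
  have := M.hb
  have := sqnorm_nonneg Y
  have := h.resid_nonneg l hl
  positivity

lemma ratio_rpow_le (h : M.IsMarginal n c Y w R) (hτ : 0 < M.τsq n) {t ε : ℝ} (ht : 0 < t)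
    (hc : ∀ v : Fin n → ℝ, sqnorm (M.K n *ᵥ v) ≤ c ^ 2 * sqnorm v) (hε1 : ε < 1)
    (htc : t * c ^ 2 ≤ ε) (hn : 0 < n) (hna : n + M.a ≤ (1 + ε) * n) {J : Finset (Fin n)}
    (hq : (1 - ε) * (n * M.σ0sq) ≤ qf (M.K n) J Y) {l : Fin n → ℝ}
    (hl : l ∈ cell n (M.τsq n) t J) :
    ((M.b + sqnorm Y) / (M.b + R l)) ^ ((n + M.a) / 2) ≤
      Real.exp ((1 + ε) / (1 - ε) ^ 2 *
        (cellBound (M.K n) (M.τsq n) t c J Y l / (2 * M.σ0sq))) := by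
  set V := cellBound (M.K n) (M.τsq n) t c J Y l
  have hb := M.hb
  have hv := M.hσ0
  have ha := M.ha
  have hn' : (0 : ℝ) < n := by exact_mod_cast hn
  have hR0 := h.resid_nonneg l hl.1
  have hV : sqnorm Y - R l ≤ V := h.sub_resid_le hτ ht hc hl
  have hV0 : 0 ≤ V := cellBound_nonneg Y ht hτ hl.1
  have hε : 0 < 1 - ε := by linarith
  have hRq : (1 - ε) ^ 2 * (n * M.σ0sq) ≤ M.b + R l := by
    have h1 := h.qf_le_resid ht hc hl
    have h2 : (1 - ε) * ((1 - ε) * (n * M.σ0sq)) ≤ (1 - t * c ^ 2) * qf (M.K n) J Y :=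
      mul_le_mul (by linarith) hq (by positivity) (by linarith)
    linarith
  have hbR : 0 < M.b + R l := by linarith
  have h1 : (M.b + sqnorm Y) / (M.b + R l) ≤ Real.exp (V / ((1 - ε) ^ 2 * (n * M.σ0sq))) := by
    calc (M.b + sqnorm Y) / (M.b + R l) ≤ 1 + V / (M.b + R l) := by
          rw [div_le_iff₀ hbR, add_mul, div_mul_cancel₀ _ hbR.ne']; linarith
      _ ≤ 1 + V / ((1 - ε) ^ 2 * (n * M.σ0sq)) := by gcongr
      _ ≤ _ := by rw [add_comm]; exact Real.add_one_le_exp _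
  calc _ ≤ (Real.exp (V / ((1 - ε) ^ 2 * (n * M.σ0sq)))) ^ (((n : ℝ) + M.a) / 2) :=
        Real.rpow_le_rpow (h.ratio_nonneg hl.1) h1 (by positivity)
    _ = Real.exp (V / ((1 - ε) ^ 2 * (n * M.σ0sq)) * (((n : ℝ) + M.a) / 2)) := by
        rw [← Real.exp_mul]
    _ ≤ Real.exp (V / ((1 - ε) ^ 2 * (n * M.σ0sq)) * ((1 + ε) * n / 2)) := by gcongr
    _ = _ := by congr 1; field_simp

/-- Weighted sums of squares appearing in the exponential moment bound. -/
def _root_.RVM.mgfProd (K : Matrix (Fin n) (Fin n) ℝ) (p x : ℝ) (Y : Fin n → ℝ) : ℝ :=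
  ∏ i, (1 + p * Real.exp (x * (K *ᵥ Y) i ^ 2))

lemma _root_.RVM.one_le_mgfProd (K : Matrix (Fin n) (Fin n) ℝ) {p : ℝ} (hp : 0 ≤ p) (x : ℝ)
    (Y : Fin n → ℝ) : 1 ≤ mgfProd K p x Y :=
  Finset.prod_induction _ (1 ≤ ·) (fun _ _ ha hb => one_le_mul_of_one_le_of_one_le ha hb)
    le_rfl fun i _ => le_add_of_nonneg_right (by positivity)

lemma integrableOn_cell_exp (h : M.IsMarginal n c Y w R) {t : ℝ} (ht : 0 < t)
    (hc : ∀ v : Fin n → ℝ, sqnorm (M.K n *ᵥ v) ≤ c ^ 2 * sqnorm v) (J : Finset (Fin n))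
    {x : ℝ} (hx : 0 ≤ x) :
    IntegrableOn (fun l => w l * Real.exp (x * cellBound (M.K n) (M.τsq n) t c J Y l))
      (cell n (M.τsq n) t J) := by
  refine h.integrableOn_cell J _ t
    (B := Real.exp (x * ((1 + 4 * (t * c ^ 2)) * sqnorm Y)))
    (Real.continuous_exp.comp ((continuous_cellBound J Y).const_mul x)) fun l hl => ?_
  rw [abs_of_pos (Real.exp_pos _), Real.exp_le_exp]
  exact mul_le_mul_of_nonneg_left (cellBound_le Y ht hc hl) hx

lemma integrableOn_cell_bound (h : M.IsMarginal n c Y w R) (hτ : 0 < M.τsq n) {t : ℝ} (ht : 0 < t)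
    (hc : ∀ v : Fin n → ℝ, sqnorm (M.K n *ᵥ v) ≤ c ^ 2 * sqnorm v) (J : Finset (Fin n)) :
    IntegrableOn (fun l => w l * cellBound (M.K n) (M.τsq n) t c J Y l)
      (cell n (M.τsq n) t J) := by
  refine h.integrableOn_cell J _ t (B := (1 + 4 * (t * c ^ 2)) * sqnorm Y)
    (continuous_cellBound J Y) fun l hl => ?_
  rw [abs_of_nonneg (cellBound_nonneg Y ht hτ hl.1)]
  exact cellBound_le Y ht hc hl

lemma integral_small_cell_le (h : M.IsMarginal n c Y w R) (hτ : 0 < M.τsq n) {t ε δ : ℝ}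
    (ht : 0 < t) (hδ : 0 < δ)
    (hmom : IntegrableOn (fun x => x ^ ((1 : ℝ) + δ) * M.pr x) (Set.Ioi (0 : ℝ)))
    (hc : ∀ v : Fin n → ℝ, sqnorm (M.K n *ᵥ v) ≤ c ^ 2 * sqnorm v) (hε0 : 0 < ε) (hε1 : ε < 1)
    (htc : t * c ^ 2 ≤ ε) (hn : 0 < n) (hna : n + M.a ≤ (1 + ε) * n)
    {Δ ρ p : ℝ} (hΔ1 : 1 ≤ Δ) (hΔ : 1 ≤ Δ * M.normFactor n c)
    (hρ0 : 0 < ρ) (hρ : M.tailBound δ t n ≤ ρ) (hp : M.meanBound t n ≤ p) {J : Finset (Fin n)}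
    (hq : (1 - ε) * (n * M.σ0sq) ≤ qf (M.K n) J Y) {g θ A : ℝ}
    (hg : g = (1 + ε) / (1 - ε) ^ 2 + ε) (hθ0 : 0 < θ) (hθ : 2 * θ ≤ 1)
    (hA : A = g * (1 + 2 * ε)) :
    ∫ l in cell n (M.τsq n) t J, w l * Real.exp (θ * ε / (2 * M.σ0sq) *
        cellBound (M.K n) (M.τsq n) t c J Y l) ≤
      Δ * (ρ ^ θ) ^ J.card * (Real.exp (2 * θ * A / (2 * M.σ0sq) * pf (M.K n) J Y) +
        mgfProd (M.K n) p (t * (g / M.σ0sq)) Y) := by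
  have hv := M.hσ0
  have hε : 0 < 1 - ε := by linarith
  have hg0 : 0 < g := by rw [hg]; positivity
  have hmb := M.meanBound_nonneg ht hτ
  have hp0 : 0 ≤ p := hmb.trans hp
  have hρt := M.tailBound_nonneg (δ := δ) ht hτ
  set B := mgfProd (M.K n) p (t * (g / M.σ0sq)) Y with hB
  have hB1 : 1 ≤ B := one_le_mgfProd _ hp0 _ _
  have hp_nn := pf_nonneg (M.K n) J Y
  set P := pf (M.K n) J Y with hP
  have hS : ∫ l in cell n (M.τsq n) t J, w l * Real.exp (θ * ε / (2 * M.σ0sq) *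
        cellBound (M.K n) (M.τsq n) t c J Y l / θ) ≤
      Δ * Real.exp (A / (2 * M.σ0sq) * P) * ρ ^ J.card * B := by
    have h1 := h.integral_cell_le (J := J) (Δ := Δ) (T := Real.exp (A / (2 * M.σ0sq) * P))
      (g := fun l => Real.exp (θ * ε / (2 * M.σ0sq) *
        cellBound (M.K n) (M.τsq n) t c J Y l / θ))
      (d := fun i => g / M.σ0sq * (M.K n *ᵥ Y) i ^ 2) hδ ht hτ hmom (by linarith)
      (Real.exp_pos _).le hΔ (fun l _ => (Real.exp_pos _).le) ?_
    · refine h1.trans ?_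
      have h2 : ∏ i, (1 + M.meanBound t n * Real.exp (t * (g / M.σ0sq * (M.K n *ᵥ Y) i ^ 2))) ≤
          B := by
        rw [hB, mgfProd]
        refine Finset.prod_le_prod (fun i _ => by positivity) fun i _ => ?_
        rw [mul_assoc t]
        gcongr
      gcongr
    · intro l hl
      have h2 := h.ratio_rpow_le hτ ht hc hε1 htc hn hna hq hl
      refine (mul_le_mul_of_nonneg_right h2 (Real.exp_pos _).le).trans ?_
      rw [← Real.exp_add, ← Real.exp_add, Real.exp_le_exp]
      have e1 : (1 + ε) / (1 - ε) ^ 2 *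
          (cellBound (M.K n) (M.τsq n) t c J Y l / (2 * M.σ0sq)) +
          θ * ε / (2 * M.σ0sq) * cellBound (M.K n) (M.τsq n) t c J Y l / θ =
          g / (2 * M.σ0sq) * cellBound (M.K n) (M.τsq n) t c J Y l := by
        rw [hg]; field_simp
      have e2 : ∑ i ∈ Jᶜ, M.τsq n * l i * (g / M.σ0sq * (M.K n *ᵥ Y) i ^ 2) =
          g / (2 * M.σ0sq) * (2 * ∑ i ∈ Jᶜ, M.τsq n * l i * (M.K n *ᵥ Y) i ^ 2) := by
        rw [Finset.mul_sum, Finset.mul_sum]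
        refine Finset.sum_congr rfl fun i _ => ?_
        field_simp
      rw [e1, e2, cellBound, mul_add, hA]
      have h3 : (1 + 2 * (t * c ^ 2)) * P ≤ (1 + 2 * ε) * P := by gcongr
      have h4 := mul_le_mul_of_nonneg_left h3 (by positivity : 0 ≤ g / (2 * M.σ0sq))
      have e3 : g / (2 * M.σ0sq) * ((1 + 2 * ε) * P) =
          g * (1 + 2 * ε) / (2 * M.σ0sq) * P := by ring
      linarith
  have hSpos : 0 < Δ * Real.exp (A / (2 * M.σ0sq) * P) * ρ ^ J.card * B := by positivity
  have hη : (0 : ℝ) ≤ θ * ε / (2 * M.σ0sq) / θ := by positivity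
  have hint : IntegrableOn (fun l => w l * Real.exp (θ * ε / (2 * M.σ0sq) *
        cellBound (M.K n) (M.τsq n) t c J Y l / θ)) (cell n (M.τsq n) t J) := by
    have := h.integrableOn_cell_exp ht hc J hη
    simpa only [div_mul_eq_mul_div] using this
  refine (setIntegral_mul_exp_le_rpow (measurableSet_cell J) hθ0 (by linarith) hSpos
    (h.integrable.mono_set (cell_subset J)) (fun l hl => h.nonneg l hl.1)
    (h.integral_cell_le_one J) hint hS).trans ?_
  have hexp0 := Real.exp_pos (A / (2 * M.σ0sq) * P)
  rw [Real.mul_rpow (by positivity) (by positivity), Real.mul_rpow (by positivity) (by positivity),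
    Real.mul_rpow (by positivity) (by positivity)]
  have e1 : (ρ ^ J.card) ^ θ = (ρ ^ θ) ^ J.card := by
    rw [← Real.rpow_natCast, ← Real.rpow_natCast, ← Real.rpow_mul hρ0.le, ← Real.rpow_mul hρ0.le,
      mul_comm]
  have e2 : Δ ^ θ ≤ Δ := by
    calc Δ ^ θ ≤ Δ ^ (1 : ℝ) := Real.rpow_le_rpow_of_exponent_le hΔ1 (by linarith)
      _ = Δ := Real.rpow_one _
  have e3 : Real.exp (A / (2 * M.σ0sq) * P) ^ θ * B ^ θ ≤
      Real.exp (2 * θ * A / (2 * M.σ0sq) * P) + B := by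
    have h1 : Real.exp (2 * θ * A / (2 * M.σ0sq) * P) =
        (Real.exp (A / (2 * M.σ0sq) * P) ^ θ) ^ 2 := by
      rw [← Real.exp_mul, ← Real.exp_nat_mul]; congr 1; push_cast; ring
    have h2 : (B ^ θ) ^ 2 ≤ B := by
      rw [← Real.rpow_natCast, ← Real.rpow_mul (by positivity)]
      calc B ^ (θ * (2 : ℕ)) ≤ B ^ (1 : ℝ) :=
            Real.rpow_le_rpow_of_exponent_le hB1 (by push_cast; linarith)
        _ = B := Real.rpow_one _
    rw [h1]
    nlinarith [sq_nonneg (Real.exp (A / (2 * M.σ0sq) * P) ^ θ - B ^ θ),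
      sq_nonneg (Real.exp (A / (2 * M.σ0sq) * P) ^ θ),  sq_nonneg (B ^ θ)]
  rw [e1]
  calc _ = Δ ^ θ * (ρ ^ θ) ^ J.card * (Real.exp (A / (2 * M.σ0sq) * P) ^ θ * B ^ θ) := by ring
    _ ≤ _ := by gcongr

end Model.IsMarginal

end Posterior

section Deterministic

variable {n : ℕ} {M : Model} {c : ℝ} {Y : Fin n → ℝ} {w R : (Fin n → ℝ) → ℝ}

lemma exp_setIntegral_le {E : Type*} [MeasurableSpace E] {μ : Measure E} {C : Set E}
    (hC : MeasurableSet C) {w f : E → ℝ} (hw : IntegrableOn w C μ) (hw0 : ∀ l ∈ C, 0 ≤ w l)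
    (hw1 : ∫ l in C, w l ∂μ = 1) (hf : IntegrableOn (fun l => w l * f l) C μ)
    (hef : IntegrableOn (fun l => w l * Real.exp (f l)) C μ) :
    Real.exp (∫ l in C, w l * f l ∂μ) ≤ ∫ l in C, w l * Real.exp (f l) ∂μ := by
  set a := ∫ l in C, w l * f l ∂μ with ha
  have hi : IntegrableOn (fun l => Real.exp a * (w l * f l) + Real.exp a * (1 - a) * w l) C μ :=
    (hf.const_mul _).add (hw.const_mul _)
  calc Real.exp a = ∫ l in C, (Real.exp a * (w l * f l) + Real.exp a * (1 - a) * w l) ∂μ := by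
        rw [integral_add (hf.const_mul _) (hw.const_mul _), integral_const_mul,
          integral_const_mul, hw1, ← ha]
        ring
    _ ≤ _ := by
        refine setIntegral_mono_on hi hef hC fun l hl => ?_
        have h1 : Real.exp a * (f l - a + 1) ≤ Real.exp (f l) := by
          calc _ ≤ Real.exp a * Real.exp (f l - a) :=
                mul_le_mul_of_nonneg_left (Real.add_one_le_exp _) (Real.exp_pos _).le
            _ = _ := by rw [← Real.exp_add]; congr 1; ring
        calc _ = w l * (Real.exp a * (f l - a + 1)) := by ring
          _ ≤ _ := mul_le_mul_of_nonneg_left h1 (hw0 l hl)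

lemma Model.sqnorm_postMean_le (hτ : 0 < M.τsq n)
    (hc : ∀ v : Fin n → ℝ, sqnorm (M.K n *ᵥ v) ≤ c ^ 2 * sqnorm v) (Y : Fin n → ℝ) :
    sqnorm (M.K n *ᵥ M.postMean n Y) ≤ sqnorm Y := by
  rcases M.exists_isMarginal hτ hc Y with h | ⟨w, R, h⟩
  · rw [h, mulVec_zero]
    simpa [sqnorm] using sqnorm_nonneg Y
  · have := h.sqnorm_le (fun _ => sqnorm Y) (h.integrable.mul_const _)
      fun l hl => by linarith [h.resid_nonneg l hl]
    rwa [integral_mul_const, h.integral_eq_one, one_mul] at this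

/-- Dominating function for the exponential of the fitted sum of squares. -/
def envelope (K : Matrix (Fin n) (Fin n) ℝ) (Δ r α v p x : ℝ) (Y : Fin n → ℝ) : ℝ :=
  1 + Δ * ∑ J : Finset (Fin n), r ^ J.card * (Real.exp (α / (2 * v) * pf K J Y) + mgfProd K p x Y)

lemma one_le_envelope (K : Matrix (Fin n) (Fin n) ℝ) {Δ r α v p x : ℝ} (hΔ : 0 ≤ Δ) (hr : 0 ≤ r)
    (hp : 0 ≤ p) (Y : Fin n → ℝ) : 1 ≤ envelope K Δ r α v p x Y := by
  refine le_add_of_nonneg_right (mul_nonneg hΔ (Finset.sum_nonneg fun J _ => ?_))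
  have := one_le_mgfProd K hp x Y
  positivity

namespace Model.IsMarginal

lemma integral_cell_le_of_ratio (h : M.IsMarginal n c Y w R) {δ t : ℝ} (hδ : 0 < δ)
    (ht : 0 < t) (hτ : 0 < M.τsq n)
    (hmom : IntegrableOn (fun x => x ^ ((1 : ℝ) + δ) * M.pr x) (Set.Ioi (0 : ℝ)))
    {Δ T ρ p : ℝ} (hΔ0 : 0 ≤ Δ) (hΔ : 1 ≤ Δ * M.normFactor n c)
    (hρ : M.tailBound δ t n ≤ ρ) (hp : M.meanBound t n ≤ p) {J : Finset (Fin n)}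
    (hT : 1 ≤ T) (hRT : ∀ l ∈ cell n (M.τsq n) t J, M.b + sqnorm Y ≤ T * (M.b + R l))
    {s : ℝ} (hs : (n + M.a) / 2 ≤ s) :
    ∫ l in cell n (M.τsq n) t J, w l ≤ Δ * (1 + p) ^ n * (ρ ^ J.card * T ^ s) := by
  have hb := M.hb
  have ha := M.ha
  have hm := M.meanBound_nonneg ht hτ
  have hρt := M.tailBound_nonneg (δ := δ) ht hτ
  have h1 := h.integral_cell_le (J := J) hδ ht hτ hmom (T := T ^ s) (g := fun _ => 1)
    (d := fun _ => 0) hΔ0 (by positivity) hΔ (fun _ _ => zero_le_one) fun l hl => by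
      have hR := h.resid_nonneg l hl.1
      have h2 : (M.b + sqnorm Y) / (M.b + R l) ≤ T := by
        rw [div_le_iff₀ (by linarith)]; exact hRT l hl
      simp only [mul_zero, Finset.sum_const_zero, Real.exp_zero, mul_one]
      calc _ ≤ T ^ (((n : ℝ) + M.a) / 2) :=
            Real.rpow_le_rpow (h.ratio_nonneg hl.1) h2 (by positivity)
        _ ≤ _ := Real.rpow_le_rpow_of_exponent_le hT hs
  simp only [mul_one, mul_zero, Real.exp_zero, Finset.prod_const, Finset.card_univ,
    Fintype.card_fin] at h1
  have hρ0 : 0 ≤ ρ := hρt.trans hρ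
  calc _ ≤ Δ * T ^ s * M.tailBound δ t n ^ J.card * (1 + M.meanBound t n) ^ n := h1
    _ ≤ Δ * T ^ s * ρ ^ J.card * (1 + p) ^ n := by gcongr
    _ = _ := by ring

lemma exp_sqnorm_postMean_le (h : M.IsMarginal n c Y w R) (hτ : 0 < M.τsq n) {t η κ W B : ℝ}
    (ht : 0 < t) (hc : ∀ v : Fin n → ℝ, sqnorm (M.K n *ᵥ v) ≤ c ^ 2 * sqnorm v) (hη : 0 ≤ η)
    {Φ : Finset (Fin n) → ℝ} (hΦ : ∀ J, 0 ≤ Φ J)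
    (hsmall : ∀ J : Finset (Fin n), (J.card : ℝ) ≤ κ → ∫ l in cell n (M.τsq n) t J,
      w l * Real.exp (η * cellBound (M.K n) (M.τsq n) t c J Y l) ≤ Φ J)
    (hlarge : ∀ J : Finset (Fin n), κ < J.card → ∫ l in cell n (M.τsq n) t J, w l ≤ W)
    (hB : sqnorm Y * (2 ^ n * W) ≤ B) (hW : 0 ≤ W) :
    Real.exp (η * (sqnorm (M.K n *ᵥ M.postMean n Y) - B)) ≤ 1 + ∑ J, Φ J := by
  classical
  let F : Finset (Fin n) → (Fin n → ℝ) → ℝ := fun J l =>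
    if (J.card : ℝ) ≤ κ then cellBound (M.K n) (M.τsq n) t c J Y l else 0
  let G : Finset (Fin n) → ℝ := fun J => if (J.card : ℝ) ≤ κ then 0 else 1
  have hw : ∀ J, IntegrableOn w (cell n (M.τsq n) t J) := fun J =>
    h.integrable.mono_set (cell_subset J)
  have hF : ∀ J, IntegrableOn (fun l => w l * F J l) (cell n (M.τsq n) t J) := fun J => by
    by_cases hJ : (J.card : ℝ) ≤ κ
    · simpa only [F, hJ, if_true] using h.integrableOn_cell_bound hτ ht hc J
    · simp only [F, hJ, if_false, mul_zero]; exact integrableOn_zero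
  have hE : ∀ J, IntegrableOn (fun l => w l * Real.exp (η * F J l)) (cell n (M.τsq n) t J) :=
    fun J => by
      by_cases hJ : (J.card : ℝ) ≤ κ
      · simpa only [F, hJ, if_true] using h.integrableOn_cell_exp ht hc J hη
      · simpa only [F, hJ, if_false, mul_zero, Real.exp_zero, mul_one] using hw J
  have hG : ∀ J, IntegrableOn (fun l => w l * G J) (cell n (M.τsq n) t J) := fun J =>
    (hw J).mul_const _
  have hFo := integrableOn_of_cells hF
  have hEo := integrableOn_of_cells hE
  have hGo := integrableOn_of_cells hG
  have hY := sqnorm_nonneg Y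
  have h1 : sqnorm (M.K n *ᵥ M.postMean n Y) ≤
      ∫ l in orthant n, w l * (F (active (M.τsq n) t l) l + sqnorm Y * G (active (M.τsq n) t l)) := by
    refine h.sqnorm_le _ ?_ fun l hl => ?_
    · refine (hFo.add (hGo.mul_const (sqnorm Y))).congr (ae_of_all _ fun l => ?_)
      simp only [Pi.add_apply]; ring
    · by_cases hJ : ((active (M.τsq n) t l).card : ℝ) ≤ κ
      · simp only [F, G, hJ, if_true, mul_zero, add_zero]
        exact h.sub_resid_le hτ ht hc ⟨hl, rfl⟩
      · simp only [F, G, hJ, if_false, mul_one, zero_add]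
        linarith [h.resid_nonneg l hl]
  have h2 : ∫ l in orthant n, w l * (F (active (M.τsq n) t l) l +
      sqnorm Y * G (active (M.τsq n) t l)) = (∫ l in orthant n, w l * F (active (M.τsq n) t l) l) +
      (∫ l in orthant n, w l * G (active (M.τsq n) t l)) * sqnorm Y := by
    rw [← integral_mul_const, ← integral_add hFo (hGo.mul_const _)]
    refine integral_congr_ae (ae_of_all _ fun l => ?_)
    ring
  have h3 : ∫ l in orthant n, w l * G (active (M.τsq n) t l) ≤ 2 ^ n * W := by
    rw [integral_eq_sum_cells (F := fun J l => w l * G J) hG]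
    calc _ ≤ ∑ _J : Finset (Fin n), W := Finset.sum_le_sum fun J _ => by
            by_cases hJ : (J.card : ℝ) ≤ κ
            · simpa [G, hJ] using hW
            · simpa [G, hJ] using hlarge J (not_le.mp hJ)
      _ = _ := by simp [Finset.card_univ]
  have h4 : Real.exp (∫ l in orthant n, w l * (η * F (active (M.τsq n) t l) l)) ≤
      ∫ l in orthant n, w l * Real.exp (η * F (active (M.τsq n) t l) l) := by
    refine exp_setIntegral_le (measurableSet_orthant n) h.integrable h.nonneg h.integral_eq_one
      ?_ hEo
    refine (hFo.const_mul η).congr (ae_of_all _ fun l => ?_)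
    simp only []; ring
  have h5 : ∫ l in orthant n, w l * (η * F (active (M.τsq n) t l) l) =
      η * ∫ l in orthant n, w l * F (active (M.τsq n) t l) l := by
    rw [← integral_const_mul]
    exact integral_congr_ae (ae_of_all _ fun l => by ring)
  have h6 : ∫ l in orthant n, w l * Real.exp (η * F (active (M.τsq n) t l) l) ≤
      1 + ∑ J, Φ J := by
    rw [integral_eq_sum_cells (F := fun J l => w l * Real.exp (η * F J l)) hE]
    have h7 : ∑ J, ∫ l in cell n (M.τsq n) t J, w l = 1 := by
      rw [← h.integral_eq_one, ← integral_eq_sum_cells (F := fun _ => w) hw]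
    rw [← h7, ← Finset.sum_add_distrib]
    refine Finset.sum_le_sum fun J _ => ?_
    have h8 : 0 ≤ ∫ l in cell n (M.τsq n) t J, w l :=
      setIntegral_nonneg (measurableSet_cell J) fun l hl => h.nonneg l hl.1
    by_cases hJ : (J.card : ℝ) ≤ κ
    · simp only [F, hJ, if_true]
      linarith [hsmall J hJ]
    · simp only [F, hJ, if_false, mul_zero, Real.exp_zero, mul_one]
      linarith [hΦ J]
  refine le_trans (Real.exp_le_exp.mpr ?_) (h4.trans h6)
  rw [h5]
  refine mul_le_mul_of_nonneg_left ?_ hη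
  have := mul_le_mul_of_nonneg_right h3 hY
  linarith

end Model.IsMarginal

end Deterministic

lemma Model.exp_sqnorm_postMean_le_envelope {n : ℕ} {M : Model} {c : ℝ} {Y : Fin n → ℝ}
    (hτ : 0 < M.τsq n) {t ε δ : ℝ} (ht : 0 < t) (hδ : 0 < δ)
    (hmom : IntegrableOn (fun x => x ^ ((1 : ℝ) + δ) * M.pr x) (Set.Ioi (0 : ℝ)))
    (hc : ∀ v : Fin n → ℝ, sqnorm (M.K n *ᵥ v) ≤ c ^ 2 * sqnorm v) (hε0 : 0 < ε)
    (hε1 : ε ≤ 1 / 4) (htc : t * c ^ 2 ≤ ε) (hn : 0 < n) (hna : n + M.a ≤ (1 + ε) * n)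
    {Δ ρ p : ℝ} (hΔ1 : 1 ≤ Δ) (hΔ : 1 ≤ Δ * M.normFactor n c)
    (hρ0 : 0 < ρ) (hρ1 : ρ ≤ 1) (hρ : M.tailBound δ t n ≤ ρ) (hp : M.meanBound t n ≤ p)
    {g θ A : ℝ} (hg : g = (1 + ε) / (1 - ε) ^ 2 + ε) (hθ0 : 0 < θ) (hθ : 2 * θ ≤ 1)
    (hA : A = g * (1 + 2 * ε)) {κ c' D B : ℝ} (hc' : 0 < c') (hc'1 : c' ≤ 1)
    (hD : D = 5 / ((1 - ε) * c')) (hbn : M.b ≤ n * M.σ0sq)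
    (hE1 : ∀ J : Finset (Fin n), (J.card : ℝ) ≤ κ * n →
      (1 - ε) * (n * M.σ0sq) ≤ qf (M.K n) J Y)
    (hE2 : ∀ J : Finset (Fin n), (J.card : ℝ) ≤ 3 / 4 * n → c' * (n * M.σ0sq) ≤ qf (M.K n) J Y)
    (hE3 : sqnorm Y ≤ 4 * (n * M.σ0sq))
    (hB : 4 * (n * M.σ0sq) * (2 ^ n * (Δ * (1 + p) ^ n * (ρ ^ (κ * n) * D ^ (5 / 8 * (n : ℝ)) +
      ρ ^ (3 / 4 * (n : ℝ)) * (5 * (n * M.σ0sq) / M.b) ^ (5 / 8 * (n : ℝ))))) ≤ B) :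
    Real.exp (θ * ε / (2 * M.σ0sq) * (sqnorm (M.K n *ᵥ M.postMean n Y) - B)) ≤
      envelope (M.K n) Δ (ρ ^ θ) (2 * θ * A) M.σ0sq p (t * (g / M.σ0sq)) Y := by
  have hv := M.hσ0
  have hb := M.hb
  have hn' : (0 : ℝ) < n := by exact_mod_cast hn
  have hp0 : 0 ≤ p := (M.meanBound_nonneg ht hτ).trans hp
  have hε : 0 < 1 - ε := by linarith
  have hD0 : 0 < D := by rw [hD]; positivity
  have hD1 : 1 ≤ D := by
    rw [hD, le_div_iff₀ (by positivity)]
    nlinarith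
  have hB0 : 0 ≤ B := le_trans (by positivity) hB
  rcases M.exists_isMarginal hτ hc Y with h | ⟨w, R, h⟩
  · rw [h, mulVec_zero]
    refine le_trans ?_ (one_le_envelope _ (by linarith) (by positivity) hp0 Y)
    rw [Real.exp_le_one_iff]
    have : sqnorm (0 : Fin n → ℝ) = 0 := by simp [sqnorm]
    rw [this]
    have : 0 ≤ θ * ε / (2 * M.σ0sq) := by positivity
    nlinarith
  set W := Δ * (1 + p) ^ n * (ρ ^ (κ * n) * D ^ (5 / 8 * (n : ℝ)) +
      ρ ^ (3 / 4 * (n : ℝ)) * (5 * (n * M.σ0sq) / M.b) ^ (5 / 8 * (n : ℝ))) with hW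
  have hW0 : 0 ≤ W := by positivity
  have hs : (n + M.a) / 2 ≤ 5 / 8 * (n : ℝ) := by nlinarith
  have hpow : ∀ {J : Finset (Fin n)} {x : ℝ}, x < J.card → ρ ^ J.card ≤ ρ ^ x := fun {J x} hx => by
    rw [← Real.rpow_natCast]
    exact Real.rpow_le_rpow_of_exponent_ge hρ0 hρ1 hx.le
  have hfin := h.exp_sqnorm_postMean_le hτ (κ := κ * n) (W := W) (B := B) ht hc
    (η := θ * ε / (2 * M.σ0sq)) (by positivity)
    (Φ := fun J => Δ * (ρ ^ θ) ^ J.card * (Real.exp (2 * θ * A / (2 * M.σ0sq) * pf (M.K n) J Y) +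
        mgfProd (M.K n) p (t * (g / M.σ0sq)) Y))
    (fun J => by
      have := one_le_mgfProd (M.K n) hp0 (t * (g / M.σ0sq)) Y
      positivity)
    (fun J hJ => h.integral_small_cell_le hτ ht hδ hmom hc hε0 (by linarith) htc hn hna hΔ1 hΔ hρ0
      hρ hp (hE1 J hJ) hg hθ0 hθ hA)
    (fun J hJ => by
      by_cases hJ2 : (J.card : ℝ) ≤ 3 / 4 * n
      · calc _ ≤ Δ * (1 + p) ^ n * (ρ ^ J.card * D ^ (5 / 8 * (n : ℝ))) := by
              refine h.integral_cell_le_of_ratio hδ ht hτ hmom (by linarith) hΔ hρ hp hD1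
                (fun l hl => ?_) hs
              have h1 := h.qf_le_resid ht hc hl
              have h2 : (1 - ε) * (c' * (n * M.σ0sq)) ≤ (1 - t * c ^ 2) * qf (M.K n) J Y :=
                mul_le_mul (by linarith) (hE2 J hJ2) (by positivity) (by linarith)
              calc M.b + sqnorm Y ≤ 5 * (n * M.σ0sq) := by linarith
                _ = D * ((1 - ε) * (c' * (n * M.σ0sq))) := by rw [hD]; field_simp
                _ ≤ _ := mul_le_mul_of_nonneg_left (by linarith) hD0.le
          _ ≤ _ := by
              rw [hW]
              refine mul_le_mul_of_nonneg_left ?_ (by positivity)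
              refine le_trans ?_ (le_add_of_nonneg_right (by positivity))
              exact mul_le_mul_of_nonneg_right (hpow hJ) (by positivity)
      · calc _ ≤ Δ * (1 + p) ^ n * (ρ ^ J.card *
                (5 * (n * M.σ0sq) / M.b) ^ (5 / 8 * (n : ℝ))) := by
              refine h.integral_cell_le_of_ratio hδ ht hτ hmom (by linarith) hΔ hρ hp ?_
                (fun l hl => ?_) hs
              · rw [le_div_iff₀ hb]; nlinarith
              · have h1 := h.resid_nonneg l hl.1
                calc M.b + sqnorm Y ≤ 5 * (n * M.σ0sq) := by linarith
                  _ = (5 * (n * M.σ0sq) / M.b) * M.b := by field_simp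
                  _ ≤ _ := mul_le_mul_of_nonneg_left (by linarith) (by positivity)
          _ ≤ _ := by
              rw [hW]
              refine mul_le_mul_of_nonneg_left ?_ (by positivity)
              refine le_trans ?_ (le_add_of_nonneg_left (by positivity))
              exact mul_le_mul_of_nonneg_right (hpow (not_le.mp hJ2)) (by positivity))
    (le_trans (mul_le_mul_of_nonneg_right hE3 (by positivity)) hB) hW0
  refine hfin.trans_eq ?_
  rw [envelope, Finset.mul_sum]
  congr 1
  exact Finset.sum_congr rfl fun J _ => by ring

section Gaussian

variable {n : ℕ}

/-- Density of the centred Gaussian distribution `N(0, v I)`. -/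
def gauss (v : ℝ) (Y : Fin n → ℝ) : ℝ :=
  (2 * Real.pi * v) ^ (-(n : ℝ) / 2) * Real.exp (-sqnorm Y / (2 * v))

lemma gauss_pos {v : ℝ} (hv : 0 < v) (Y : Fin n → ℝ) : 0 < gauss v Y := by
  unfold gauss; positivity

lemma rpow_neg_half_eq {x : ℝ} (hx : 0 < x) (n : ℕ) : x ^ (-(n : ℝ) / 2) = (√x ^ n)⁻¹ := by
  rw [Real.sqrt_eq_rpow, ← Real.rpow_natCast, ← Real.rpow_mul hx.le, ← Real.rpow_neg hx.le]
  congr 1; ring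

lemma integrable_gauss_pf_qf (K : Matrix (Fin n) (Fin n) ℝ) (J : Finset (Fin n)) {v x y : ℝ}
    (hv : 0 < v) (hx : 0 < x) (hy : 0 < y) :
    Integrable (fun Y => (2 * Real.pi * v) ^ (-(n : ℝ) / 2) *
      Real.exp (-(x * pf K J Y + y * qf K J Y) / (2 * v))) ∧
    ∫ Y, (2 * Real.pi * v) ^ (-(n : ℝ) / 2) *
      Real.exp (-(x * pf K J Y + y * qf K J Y) / (2 * v)) =
      (√x)⁻¹ ^ J.card * (√y)⁻¹ ^ (n - J.card) := by
  have h := integrable_exp_neg_sq_adapted K J (x := x / (2 * v)) (y := y / (2 * v))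
    (by positivity) (by positivity)
  have he : ∀ Y, -(x / (2 * v) * pf K J Y + y / (2 * v) * qf K J Y) =
      -(x * pf K J Y + y * qf K J Y) / (2 * v) := fun Y => by ring
  simp only [he] at h
  refine ⟨h.1.const_mul _, ?_⟩
  rw [integral_const_mul, h.2, rpow_neg_half_eq (by positivity)]
  have hc : J.card ≤ n := by simpa using Finset.card_le_univ J
  have hs : ∀ z : ℝ, 0 < z → √(Real.pi / (z / (2 * v))) = √(2 * Real.pi * v) * (√z)⁻¹ :=
    fun z hz => by
      rw [← Real.sqrt_inv, ← Real.sqrt_mul (by positivity)]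
      congr 1; field_simp
  rw [hs x hx, hs y hy, mul_pow, mul_pow]
  have hsplit : √(2 * Real.pi * v) ^ n =
      √(2 * Real.pi * v) ^ J.card * √(2 * Real.pi * v) ^ (n - J.card) := by
    rw [← pow_add, Nat.add_sub_cancel' hc]
  have hne : √(2 * Real.pi * v) ≠ 0 := (Real.sqrt_pos.mpr (by positivity)).ne'
  rw [hsplit]
  field_simp

lemma sum_pow_card (x : ℝ) : ∑ J : Finset (Fin n), x ^ J.card = (1 + x) ^ n := by
  have := Fintype.sum_pow_mul_eq_add_pow (Fin n) x 1
  simpa [add_comm] using this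

lemma mgfProd_le {K : Matrix (Fin n) (Fin n) ℝ} (hK : Kᵀ = K) {c p x y : ℝ}
    (hc : ∀ v : Fin n → ℝ, sqnorm (K *ᵥ v) ≤ c ^ 2 * sqnorm v) (hp : 0 ≤ p) (hx : 0 ≤ x)
    (hxy : x * c ^ 2 ≤ y) (Y : Fin n → ℝ) :
    mgfProd K p x Y ≤ ∑ I : Finset (Fin n), p ^ I.card * Real.exp (y * pf K I Y) := by
  rw [mgfProd, Finset.prod_one_add, Finset.powerset_univ]
  refine Finset.sum_le_sum fun I _ => ?_
  rw [Finset.prod_mul_distrib, Finset.prod_const, ← Real.exp_sum, ← Finset.mul_sum]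
  refine mul_le_mul_of_nonneg_left (Real.exp_le_exp.mpr ?_) (by positivity)
  calc x * ∑ i ∈ I, (K *ᵥ Y) i ^ 2 ≤ x * (c ^ 2 * pf K I Y) :=
        mul_le_mul_of_nonneg_left (sqnorm_sum_mem_le _ I Y hK hc) hx
    _ = x * c ^ 2 * pf K I Y := by ring
    _ ≤ _ := mul_le_mul_of_nonneg_right hxy (pf_nonneg K I Y)

lemma integrable_gauss_exp_pf (K : Matrix (Fin n) (Fin n) ℝ) (J : Finset (Fin n)) {v α : ℝ}
    (hv : 0 < v) (hα : α < 1) :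
    Integrable (fun Y => gauss v Y * Real.exp (α / (2 * v) * pf K J Y)) ∧
    ∫ Y, gauss v Y * Real.exp (α / (2 * v) * pf K J Y) = (√(1 - α))⁻¹ ^ J.card := by
  have h := integrable_gauss_pf_qf K J hv (sub_pos.mpr hα) one_pos
  have he : ∀ Y, (2 * Real.pi * v) ^ (-(n : ℝ) / 2) *
      Real.exp (-((1 - α) * pf K J Y + 1 * qf K J Y) / (2 * v)) =
      gauss v Y * Real.exp (α / (2 * v) * pf K J Y) := fun Y => by
    rw [gauss, mul_assoc (_ ^ _), ← Real.exp_add, ← pf_add_qf K J Y]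
    congr 2
    field_simp
    ring
  simp only [he] at h
  simpa using h

lemma integrable_gauss {v : ℝ} (hv : 0 < v) : Integrable (fun Y : Fin n → ℝ => gauss v Y) ∧
    ∫ Y : Fin n → ℝ, gauss v Y = 1 := by
  simpa using integrable_gauss_exp_pf (0 : Matrix (Fin n) (Fin n) ℝ) ∅ hv zero_lt_one

lemma exists_envelope_le {K : Matrix (Fin n) (Fin n) ℝ} (hK : Kᵀ = K) {c Δ r α v p x : ℝ}
    (hc : ∀ v : Fin n → ℝ, sqnorm (K *ᵥ v) ≤ c ^ 2 * sqnorm v) (hp : 0 ≤ p) (hx : 0 ≤ x)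
    (hxy : x * c ^ 2 ≤ α / (2 * v)) (hΔ : 1 ≤ Δ) (hr : 0 ≤ r) (hv : 0 < v) (hα0 : 0 ≤ α)
    (hα : α < 1) :
    ∃ Ψ : (Fin n → ℝ) → ℝ, (∀ Y, envelope K Δ r α v p x Y ≤ Ψ Y) ∧
      Integrable (fun Y => gauss v Y * Ψ Y) ∧
      ∫ Y, gauss v Y * Ψ Y ≤ 3 * (Δ * Real.exp ((√(1 - α))⁻¹ * (n * r + n * p))) := by
  let e : Finset (Fin n) → (Fin n → ℝ) → ℝ := fun J Y => Real.exp (α / (2 * v) * pf K J Y)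
  set s := (√(1 - α))⁻¹ with hs
  have hs1 : 1 ≤ s := by
    rw [hs, one_le_inv₀ (Real.sqrt_pos.mpr (by linarith)), Real.sqrt_le_iff]
    constructor <;> linarith
  have he : ∀ J, Integrable (fun Y => gauss v Y * e J Y) := fun J =>
    (integrable_gauss_exp_pf K J hv hα).1
  have hei : ∀ J, ∫ Y, gauss v Y * e J Y = s ^ J.card := fun J =>
    (integrable_gauss_exp_pf K J hv hα).2
  have hg := integrable_gauss (n := n) hv
  let Ψ : (Fin n → ℝ) → ℝ := fun Y => 1 + Δ * ((∑ J : Finset (Fin n), r ^ J.card * e J Y) +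
    (1 + r) ^ n * ∑ I : Finset (Fin n), p ^ I.card * e I Y)
  have hsum : ∀ u : ℝ, Integrable (fun Y => ∑ J : Finset (Fin n), u ^ J.card *
      (gauss v Y * e J Y)) := fun u =>
    integrable_finsetSum _ fun J _ => (he J).const_mul _
  have hsumi : ∀ u : ℝ, ∫ Y, ∑ J : Finset (Fin n), u ^ J.card * (gauss v Y * e J Y) =
      (1 + u * s) ^ n := fun u => by
    rw [integral_finsetSum _ fun J _ => (he J).const_mul _, ← sum_pow_card]
    refine Finset.sum_congr rfl fun J _ => ?_
    rw [integral_const_mul, hei, mul_pow]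
  have hΨ : (fun Y => gauss v Y * Ψ Y) = fun Y => gauss v Y +
      (Δ * (∑ J : Finset (Fin n), r ^ J.card * (gauss v Y * e J Y)) +
      Δ * (1 + r) ^ n * ∑ J : Finset (Fin n), p ^ J.card * (gauss v Y * e J Y)) := by
    funext Y
    simp only [Ψ]
    have : ∀ u : ℝ, ∑ J : Finset (Fin n), u ^ J.card * (gauss v Y * e J Y) =
        gauss v Y * ∑ J : Finset (Fin n), u ^ J.card * e J Y := fun u => by
      rw [Finset.mul_sum]
      exact Finset.sum_congr rfl fun J _ => by ring
    rw [this, this]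
    ring
  have hi1 := (hsum r).const_mul Δ
  have hi2 := (hsum p).const_mul (Δ * (1 + r) ^ n)
  have hi12 : Integrable fun Y => Δ * (∑ J : Finset (Fin n), r ^ J.card * (gauss v Y * e J Y)) +
      Δ * (1 + r) ^ n * ∑ J : Finset (Fin n), p ^ J.card * (gauss v Y * e J Y) := hi1.add hi2
  refine ⟨Ψ, fun Y => ?_, ?_, ?_⟩
  · simp only [envelope, Ψ, mul_add, Finset.sum_add_distrib, ← Finset.sum_mul, sum_pow_card]
    have h1 := mgfProd_le hK hc hp hx hxy Y
    rw [← mul_assoc Δ ((1 + r) ^ n)]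
    have h2 := mul_le_mul_of_nonneg_left h1 (show 0 ≤ Δ * (1 + r) ^ n by positivity)
    simp only [e]
    linarith
  · rw [hΨ]; exact hg.1.add hi12
  · rw [hΨ, integral_add hg.1 hi12, integral_add hi1 hi2, integral_const_mul,
      integral_const_mul, hsumi, hsumi, hg.2]
    have hpow : ∀ u : ℝ, 0 ≤ u → (1 + u) ^ n ≤ Real.exp (n * u) := fun u hu => by
      rw [mul_comm, Real.exp_mul, Real.rpow_natCast]
      exact pow_le_pow_left₀ (by linarith) (by linarith [Real.add_one_le_exp u]) _
    have h1 := hpow (r * s) (by positivity)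
    have h2 := hpow (p * s) (by positivity)
    have h3 : (1 + r) ^ n ≤ Real.exp (n * (r * s)) := le_trans
      (pow_le_pow_left₀ (by linarith) (by nlinarith) _) h1
    have h5 : Real.exp (s * (n * r + n * p)) =
        Real.exp (n * (r * s)) * Real.exp (n * (p * s)) := by
      rw [← Real.exp_add]; congr 1; ring
    have h6 : 1 ≤ Real.exp (n * (p * s)) := Real.one_le_exp (by positivity)
    have h7 : 1 ≤ Real.exp (n * (r * s)) := Real.one_le_exp (by positivity)
    rw [h5]
    have h8 : (1 + r * s) ^ n ≤ Real.exp (n * (r * s)) * Real.exp (n * (p * s)) :=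
      h1.trans (le_mul_of_one_le_right (by positivity) h6)
    have h9 : (1 + r) ^ n * (1 + p * s) ^ n ≤
        Real.exp (n * (r * s)) * Real.exp (n * (p * s)) :=
      mul_le_mul h3 h2 (by positivity) (by positivity)
    have h10 : 1 ≤ Δ * (Real.exp (n * (r * s)) * Real.exp (n * (p * s))) :=
      one_le_mul_of_one_le_of_one_le hΔ (one_le_mul_of_one_le_of_one_le h7 h6)
    have h11 := mul_le_mul_of_nonneg_left h8 (show 0 ≤ Δ by linarith)
    have h12 := mul_le_mul_of_nonneg_left h9 (show 0 ≤ Δ by linarith)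
    linarith

end Gaussian

section BadEvents

variable {n : ℕ} {M : Model}

lemma sqnorm_sub_ge {ξ : ℝ} (hξ : 0 < ξ) (Y m : Fin n → ℝ) :
    (1 - ξ) * sqnorm Y - sqnorm m / ξ ≤ sqnorm (Y - m) := by
  have h := sqnorm_nonneg (ξ • Y - m)
  have h1 : sqnorm (ξ • Y - m) = ξ ^ 2 * sqnorm Y - 2 * (ξ * (Y ⬝ᵥ m)) + sqnorm m := by
    rw [sqnorm_sub, smul_dotProduct, smul_eq_mul]
    simp only [sqnorm, smul_dotProduct, dotProduct_smul, smul_eq_mul]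
    ring
  rw [h1] at h
  have h2 : 0 ≤ ξ * sqnorm Y - 2 * (Y ⬝ᵥ m) + sqnorm m / ξ := by
    have : ξ * sqnorm Y - 2 * (Y ⬝ᵥ m) + sqnorm m / ξ =
        (ξ ^ 2 * sqnorm Y - 2 * (ξ * (Y ⬝ᵥ m)) + sqnorm m) / ξ := by field_simp
    rw [this]; positivity
  have hm : 0 ≤ sqnorm m := sqnorm_nonneg m
  rw [sqnorm_sub]
  linarith

lemma sqnorm_mul_trueDens_le {ξ : ℝ} (hξ : 0 < ξ) (Y : Fin n → ℝ) :
    sqnorm Y * M.trueDens n Y ≤ 2 * M.σ0sq / ξ *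
      Real.exp (sqnorm (M.K n *ᵥ M.β0 n) / (2 * M.σ0sq * ξ)) *
      ((2 * Real.pi * M.σ0sq) ^ (-(n : ℝ) / 2) *
        Real.exp (-((1 - 2 * ξ) * sqnorm Y) / (2 * M.σ0sq))) := by
  have hv := M.hσ0
  set m := M.K n *ᵥ M.β0 n
  set v := M.σ0sq
  have hY := sqnorm_nonneg Y
  have h1 : sqnorm Y ≤ 2 * v / ξ * Real.exp (ξ * sqnorm Y / (2 * v)) := by
    have := Real.add_one_le_exp (ξ * sqnorm Y / (2 * v))
    calc sqnorm Y = 2 * v / ξ * (ξ * sqnorm Y / (2 * v)) := by field_simp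
      _ ≤ _ := mul_le_mul_of_nonneg_left (by linarith) (by positivity)
  have h2 : Real.exp (-sqnorm (Y - m) / (2 * v)) ≤
      Real.exp (sqnorm m / (2 * v * ξ)) * Real.exp (-((1 - ξ) * sqnorm Y) / (2 * v)) := by
    rw [← Real.exp_add, Real.exp_le_exp]
    have h3 := sqnorm_sub_ge hξ Y m
    have : sqnorm m / (2 * v * ξ) + -((1 - ξ) * sqnorm Y) / (2 * v) =
        (-((1 - ξ) * sqnorm Y - sqnorm m / ξ)) / (2 * v) := by field_simp; ring
    rw [this]
    gcongr
  have h4 : Real.exp (-((1 - 2 * ξ) * sqnorm Y) / (2 * v)) =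
      Real.exp (ξ * sqnorm Y / (2 * v)) * Real.exp (-((1 - ξ) * sqnorm Y) / (2 * v)) := by
    rw [← Real.exp_add]; congr 1; ring
  unfold Model.trueDens
  rw [h4]
  calc _ ≤ (2 * v / ξ * Real.exp (ξ * sqnorm Y / (2 * v))) *
      ((2 * Real.pi * v) ^ (-(n : ℝ) / 2) * (Real.exp (sqnorm m / (2 * v * ξ)) *
        Real.exp (-((1 - ξ) * sqnorm Y) / (2 * v)))) := by gcongr
    _ = _ := by ring

lemma exists_bound_qf_small {ξ r κ c ω : ℝ} (hξ : 0 < ξ) (hξ1 : 2 * ξ < 1) (hr : 0 < r)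
    (hr1 : r ≤ 1) (hω : 0 < ω) :
    ∃ H : (Fin n → ℝ) → ℝ, Integrable H ∧ (∀ Y, 0 ≤ H Y) ∧
      (∀ Y, (∃ J : Finset (Fin n), (J.card : ℝ) ≤ κ * n ∧ qf (M.K n) J Y < c * (n * M.σ0sq)) →
        sqnorm Y * M.trueDens n Y ≤ H Y) ∧
      ∫ Y, H Y ≤ 2 * M.σ0sq / ξ * Real.exp (sqnorm (M.K n *ᵥ M.β0 n) / (2 * M.σ0sq * ξ)) *
        (r ^ (-κ) * Real.exp (ω * c / 2) *
          (r * (√(1 - 2 * ξ))⁻¹ + (√(1 - 2 * ξ + ω))⁻¹)) ^ n := by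
  classical
  have hv := M.hσ0
  set m := M.K n *ᵥ M.β0 n
  set v := M.σ0sq
  set C := 2 * v / ξ * Real.exp (sqnorm m / (2 * v * ξ)) with hC
  have hC0 : 0 ≤ C := by positivity
  let G : Finset (Fin n) → (Fin n → ℝ) → ℝ := fun J Y => (2 * Real.pi * v) ^ (-(n : ℝ) / 2) *
      Real.exp (-((1 - 2 * ξ) * pf (M.K n) J Y + (1 - 2 * ξ + ω) * qf (M.K n) J Y) / (2 * v))
  have hG0 : ∀ J Y, 0 ≤ G J Y := fun J Y => by positivity
  have hGi := fun J : Finset (Fin n) => integrable_gauss_pf_qf (M.K n) J hv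
    (x := 1 - 2 * ξ) (y := 1 - 2 * ξ + ω) (by linarith) (by linarith)
  set D := C * (r ^ (-κ) * Real.exp (ω * c / 2)) ^ n with hD
  have hD0 : 0 ≤ D := by positivity
  refine ⟨fun Y => D * ∑ J : Finset (Fin n), r ^ J.card * G J Y,
    (integrable_finsetSum _ fun J _ => (hGi J).1.const_mul _).const_mul _,
    fun Y => mul_nonneg hD0 (Finset.sum_nonneg fun J _ => mul_nonneg (by positivity) (hG0 J Y)),
    fun Y => ?_, ?_⟩
  · rintro ⟨J, hJ, hq⟩
    refine (sqnorm_mul_trueDens_le hξ Y).trans ?_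
    have h1 : r ^ J.card * G J Y ≤ ∑ J : Finset (Fin n), r ^ J.card * G J Y :=
      Finset.single_le_sum (f := fun J => r ^ J.card * G J Y)
        (fun J _ => mul_nonneg (by positivity) (hG0 J Y)) (Finset.mem_univ J)
    refine le_trans ?_ (mul_le_mul_of_nonneg_left h1 hD0)
    rw [hD, mul_assoc C]
    refine mul_le_mul_of_nonneg_left ?_ hC0
    have h2 : 1 ≤ (r ^ (-κ)) ^ n * r ^ J.card := by
      rw [← Real.rpow_natCast, ← Real.rpow_natCast, ← Real.rpow_mul hr.le, ← Real.rpow_add hr]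
      exact Real.one_le_rpow_of_pos_of_le_one_of_nonpos hr hr1 (by linarith)
    have h3 : Real.exp (-((1 - 2 * ξ) * sqnorm Y) / (2 * v)) ≤ Real.exp (ω * c / 2) ^ n *
        Real.exp (-((1 - 2 * ξ) * pf (M.K n) J Y + (1 - 2 * ξ + ω) * qf (M.K n) J Y) / (2 * v)) := by
      rw [← Real.exp_nat_mul, ← Real.exp_add, Real.exp_le_exp, ← pf_add_qf (M.K n) J Y]
      have : (n : ℝ) * (ω * c / 2) = ω * (c * (n * v)) / (2 * v) := by field_simp
      rw [this, ← add_div]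
      gcongr
      nlinarith [mul_lt_mul_of_pos_left hq hω]
    calc _ ≤ 1 * ((2 * Real.pi * v) ^ (-(n : ℝ) / 2) * (Real.exp (ω * c / 2) ^ n *
          Real.exp (-((1 - 2 * ξ) * pf (M.K n) J Y + (1 - 2 * ξ + ω) * qf (M.K n) J Y) /
            (2 * v)))) := by rw [one_mul]; gcongr
      _ ≤ ((r ^ (-κ)) ^ n * r ^ J.card) * ((2 * Real.pi * v) ^ (-(n : ℝ) / 2) *
          (Real.exp (ω * c / 2) ^ n *
          Real.exp (-((1 - 2 * ξ) * pf (M.K n) J Y + (1 - 2 * ξ + ω) * qf (M.K n) J Y) /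
            (2 * v)))) := by gcongr
      _ = _ := by simp only [G, mul_pow]; ring
  · rw [integral_const_mul, integral_finsetSum _ fun J _ => (hGi J).1.const_mul _]
    simp only [integral_const_mul, (hGi _).2]
    have h4 := Fintype.sum_pow_mul_eq_add_pow (Fin n) (r * (√(1 - 2 * ξ))⁻¹)
      (√(1 - 2 * ξ + ω))⁻¹
    rw [Fintype.card_fin] at h4
    rw [mul_pow (r ^ (-κ) * Real.exp (ω * c / 2)), ← h4, hD, mul_assoc C]
    refine (congrArg _ (congrArg _ (Finset.sum_congr rfl fun J _ => ?_))).le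
    ring

lemma exists_bound_sqnorm_large {ξ : ℝ} (hξ : 0 < ξ) (hξ1 : 2 * ξ < 1 / 2) :
    ∃ H : (Fin n → ℝ) → ℝ, Integrable H ∧ (∀ Y, 0 ≤ H Y) ∧
      (∀ Y, 4 * (n * M.σ0sq) < sqnorm Y → sqnorm Y * M.trueDens n Y ≤ H Y) ∧
      ∫ Y, H Y ≤ 2 * M.σ0sq / ξ * Real.exp (sqnorm (M.K n *ᵥ M.β0 n) / (2 * M.σ0sq * ξ)) *
        (Real.exp (-1) * (√(1 / 2 - 2 * ξ))⁻¹) ^ n := by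
  have hv := M.hσ0
  set m := M.K n *ᵥ M.β0 n
  set v := M.σ0sq
  set C := 2 * v / ξ * Real.exp (sqnorm m / (2 * v * ξ)) with hC
  have hC0 : 0 ≤ C := by positivity
  have hGi := integrable_gauss_pf_qf (M.K n) ∅ hv
    (x := 1 / 2 - 2 * ξ) (y := 1 / 2 - 2 * ξ) (by linarith) (by linarith)
  simp only [← mul_add, pf_add_qf] at hGi
  refine ⟨fun Y => C * Real.exp (-1) ^ n * ((2 * Real.pi * v) ^ (-(n : ℝ) / 2) *
      Real.exp (-((1 / 2 - 2 * ξ) * sqnorm Y) / (2 * v))),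
    hGi.1.const_mul _, fun Y => by positivity, fun Y hY => ?_, ?_⟩
  · refine (sqnorm_mul_trueDens_le hξ Y).trans ?_
    change C * _ ≤ C * Real.exp (-1) ^ n * _
    rw [mul_assoc C]
    refine mul_le_mul_of_nonneg_left ?_ hC0
    rw [mul_left_comm]
    refine mul_le_mul_of_nonneg_left ?_ (by positivity)
    rw [← Real.exp_nat_mul, ← Real.exp_add, Real.exp_le_exp]
    have : (n : ℝ) * (-1) = (-(2 * (n * v))) / (2 * v) := by field_simp
    rw [this, ← add_div]
    gcongr
    linarith
  · rw [integral_const_mul, hGi.2]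
    simp [mul_pow, mul_assoc, C]

end BadEvents

section Risk

variable {n : ℕ} {M : Model}

lemma trueDens_eq_gauss (Y : Fin n → ℝ) :
    M.trueDens n Y = gauss M.σ0sq (Y - M.K n *ᵥ M.β0 n) := rfl

lemma integrable_gauss_mul_dotProduct {v : ℝ} (hv : 0 < v) (m : Fin n → ℝ) :
    Integrable (fun Y : Fin n → ℝ => gauss v Y * (m ⬝ᵥ Y)) ∧
      ∫ Y : Fin n → ℝ, gauss v Y * (m ⬝ᵥ Y) = 0 := by
  constructor
  · have h1 := (integrable_gauss_pf_qf (0 : Matrix (Fin n) (Fin n) ℝ) ∅ hv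
      (one_half_pos (α := ℝ)) (one_half_pos (α := ℝ))).1
    simp only [← mul_add, pf_add_qf] at h1
    have h2 := ((integrable_gauss (n := n) hv).1.mul_const (sqnorm m)).add (h1.const_mul (4 * v))
    refine h2.mono' ?_ (ae_of_all _ fun Y => ?_)
    · refine Continuous.aestronglyMeasurable ?_
      unfold gauss sqnorm
      fun_prop
    · have hg := gauss_pos hv Y
      have h3 : |m ⬝ᵥ Y| ≤ sqnorm m + sqnorm Y := by
        have ha := sqnorm_nonneg (m - Y)
        have hb := sqnorm_nonneg (m + Y)
        rw [sqnorm_sub] at ha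
        rw [sqnorm_add] at hb
        have := sqnorm_nonneg m
        have := sqnorm_nonneg Y
        rw [abs_le]
        constructor <;> linarith
      have h4 : gauss v Y * sqnorm Y ≤ 4 * v * ((2 * Real.pi * v) ^ (-(n : ℝ) / 2) *
          Real.exp (-(1 / 2 * sqnorm Y) / (2 * v))) := by
        have h5 : sqnorm Y ≤ 4 * v * Real.exp (sqnorm Y / (4 * v)) := by
          have := Real.add_one_le_exp (sqnorm Y / (4 * v))
          calc sqnorm Y = 4 * v * (sqnorm Y / (4 * v)) := by field_simp
            _ ≤ _ := mul_le_mul_of_nonneg_left (by linarith) (by positivity)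
        have h6 : Real.exp (-(1 / 2 * sqnorm Y) / (2 * v)) =
            Real.exp (-sqnorm Y / (2 * v)) * Real.exp (sqnorm Y / (4 * v)) := by
          rw [← Real.exp_add]; congr 1; field_simp; ring
        calc _ ≤ gauss v Y * (4 * v * Real.exp (sqnorm Y / (4 * v))) :=
              mul_le_mul_of_nonneg_left h5 hg.le
          _ = _ := by rw [h6, gauss]; ring
      rw [Real.norm_eq_abs, abs_mul, abs_of_pos hg]
      simp only [Pi.add_apply]
      calc _ ≤ gauss v Y * (sqnorm m + sqnorm Y) := mul_le_mul_of_nonneg_left h3 hg.le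
        _ ≤ _ := by rw [mul_add]; linarith
  · have h := integral_neg_eq_self (fun Y : Fin n → ℝ => gauss v Y * (m ⬝ᵥ Y)) volume
    have h1 : ∀ Y : Fin n → ℝ, gauss v (-Y) * (m ⬝ᵥ (-Y)) = -(gauss v Y * (m ⬝ᵥ Y)) :=
      fun Y => by simp [gauss, sqnorm]
    simp only [h1] at h
    rw [integral_neg] at h
    linarith

/-- Log-likelihood ratio of the true distribution with respect to the centred Gaussian. -/
def Model.logRatio (M : Model) (n : ℕ) (Y : Fin n → ℝ) : ℝ :=
  (2 * ((M.K n *ᵥ M.β0 n) ⬝ᵥ Y) - sqnorm (M.K n *ᵥ M.β0 n)) / (2 * M.σ0sq)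

lemma trueDens_eq_mul_exp (Y : Fin n → ℝ) :
    M.trueDens n Y = gauss M.σ0sq Y * Real.exp (M.logRatio n Y) := by
  unfold Model.trueDens gauss Model.logRatio
  rw [mul_assoc (_ ^ _), ← Real.exp_add, sqnorm_sub, dotProduct_comm Y]
  congr 2
  ring

lemma integrable_trueDens : Integrable (M.trueDens n) ∧ ∫ Y, M.trueDens n Y = 1 := by
  have h := integrable_gauss (n := n) M.hσ0
  exact ⟨h.1.comp_sub_right (M.K n *ᵥ M.β0 n),
    (integral_sub_right_eq_self _ (M.K n *ᵥ M.β0 n)).trans h.2⟩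

lemma integrable_trueDens_mul_logRatio :
    Integrable (fun Y => M.trueDens n Y * M.logRatio n Y) ∧
      ∫ Y, M.trueDens n Y * M.logRatio n Y = sqnorm (M.K n *ᵥ M.β0 n) / (2 * M.σ0sq) := by
  have hv := M.hσ0
  set m := M.K n *ᵥ M.β0 n with hm
  let F : (Fin n → ℝ) → ℝ := fun Z => M.σ0sq⁻¹ * (gauss M.σ0sq Z * (m ⬝ᵥ Z)) +
    sqnorm m / (2 * M.σ0sq) * gauss M.σ0sq Z
  have h1 := integrable_gauss (n := n) hv
  have h2 := integrable_gauss_mul_dotProduct hv m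
  have hF : Integrable F := (h2.1.const_mul _).add (h1.1.const_mul _)
  have hFi : ∫ Z, F Z = sqnorm m / (2 * M.σ0sq) := by
    rw [integral_add (h2.1.const_mul _) (h1.1.const_mul _), integral_const_mul,
      integral_const_mul, h1.2, h2.2]
    ring
  have he : (fun Y => M.trueDens n Y * M.logRatio n Y) = fun Y => F (Y - m) := by
    funext Y
    simp only [F, Model.logRatio, trueDens_eq_gauss, ← hm, dotProduct_sub]
    rw [show m ⬝ᵥ m = sqnorm m from rfl]
    field_simp
    ring
  rw [he]
  exact ⟨hF.comp_sub_right m, (integral_sub_right_eq_self F m).trans hFi⟩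

lemma Model.E0_le {η B L : ℝ} (hη : 0 < η) (hB : 0 ≤ B) {Ψ H : (Fin n → ℝ) → ℝ}
    (hΨ1 : ∀ Y, 1 ≤ Ψ Y) (hΨ : Integrable fun Y => gauss M.σ0sq Y * Ψ Y) (hH0 : ∀ Y, 0 ≤ H Y)
    (hH : Integrable H)
    (h : ∀ Y, Real.exp (η * (sqnorm (M.K n *ᵥ M.postMean n Y) - B)) ≤ Ψ Y ∨
      sqnorm (M.K n *ᵥ M.postMean n Y) * M.trueDens n Y ≤ H Y) :
    M.E0 n (fun Y => sqnorm (M.K n *ᵥ M.postMean n Y - M.K n *ᵥ M.β0 n)) ≤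
      2 * (B + (L + sqnorm (M.K n *ᵥ M.β0 n) / (2 * M.σ0sq) +
        Real.exp (-L) * ∫ Y, gauss M.σ0sq Y * Ψ Y) / η + ∫ Y, H Y) +
        2 * sqnorm (M.K n *ᵥ M.β0 n) := by
  have hv := M.hσ0
  set m := M.K n *ᵥ M.β0 n with hm
  have hf := integrable_trueDens (M := M) (n := n)
  have hlr := integrable_trueDens_mul_logRatio (M := M) (n := n)
  have hf0 : ∀ Y, 0 < M.trueDens n Y := fun Y => by
    rw [trueDens_eq_gauss]; exact gauss_pos hv _
  have hdv : ∀ x : ℝ, ∀ Z : Fin n → ℝ, Real.exp x ≤ Ψ Z →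
      M.trueDens n Z * x ≤ L * M.trueDens n Z + M.trueDens n Z * M.logRatio n Z +
        Real.exp (-L) * (gauss M.σ0sq Z * Ψ Z) := fun x Z hx => by
    have hg := gauss_pos hv Z
    have h1 : gauss M.σ0sq Z * Real.exp (x - L) = M.trueDens n Z *
        Real.exp (x - L - M.logRatio n Z) := by
      rw [trueDens_eq_mul_exp, mul_assoc, ← Real.exp_add]; congr 2; ring
    have h2 := mul_le_mul_of_nonneg_left (Real.add_one_le_exp (x - L - M.logRatio n Z)) (hf0 Z).le
    have h3 : gauss M.σ0sq Z * Real.exp (x - L) ≤ Real.exp (-L) * (gauss M.σ0sq Z * Ψ Z) := by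
      rw [sub_eq_add_neg, Real.exp_add]
      calc _ = (Real.exp (-L) * gauss M.σ0sq Z) * Real.exp x := by ring
        _ ≤ (Real.exp (-L) * gauss M.σ0sq Z) * Ψ Z := mul_le_mul_of_nonneg_left hx (by positivity)
        _ = _ := by ring
    have := hf0 Z
    rw [← h1] at h2
    linarith
  let T : (Fin n → ℝ) → ℝ := fun Z => L * M.trueDens n Z + M.trueDens n Z * M.logRatio n Z +
        Real.exp (-L) * (gauss M.σ0sq Z * Ψ Z)
  have hT : Integrable T := ((hf.1.const_mul L).add hlr.1).add (hΨ.const_mul _)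
  have hTi : ∫ Z, T Z = L + sqnorm m / (2 * M.σ0sq) +
      Real.exp (-L) * ∫ Y, gauss M.σ0sq Y * Ψ Y := by
    have e1 : ∫ Z, T Z = (∫ Z, (L * M.trueDens n Z + M.trueDens n Z * M.logRatio n Z)) +
        ∫ Z, Real.exp (-L) * (gauss M.σ0sq Z * Ψ Z) :=
      integral_add ((hf.1.const_mul L).add hlr.1) (hΨ.const_mul _)
    rw [e1, integral_add (hf.1.const_mul L) hlr.1, integral_const_mul, integral_const_mul, hf.2,
      hlr.2, mul_one]
  let U : (Fin n → ℝ) → ℝ := fun Z => 2 * (B * M.trueDens n Z + T Z / η + H Z) +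
    2 * sqnorm m * M.trueDens n Z
  have hU0 : Integrable fun Z => B * M.trueDens n Z + T Z / η :=
    (hf.1.const_mul B).add (hT.div_const η)
  have hU1 : Integrable fun Z => B * M.trueDens n Z + T Z / η + H Z := hU0.add hH
  have hU : Integrable U := (hU1.const_mul 2).add (hf.1.const_mul _)
  have hUi : ∫ Z, U Z = 2 * (B + (L + sqnorm m / (2 * M.σ0sq) +
      Real.exp (-L) * ∫ Y, gauss M.σ0sq Y * Ψ Y) / η + ∫ Y, H Y) + 2 * sqnorm m := by
    have e1 : ∫ Z, U Z = (∫ Z, 2 * (B * M.trueDens n Z + T Z / η + H Z)) +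
        ∫ Z, 2 * sqnorm m * M.trueDens n Z := integral_add (hU1.const_mul 2) (hf.1.const_mul _)
    rw [e1, integral_const_mul, integral_add hU0 hH, integral_add (hf.1.const_mul B)
      (hT.div_const η), integral_const_mul, integral_const_mul, integral_div, hTi, hf.2, mul_one,
      mul_one]
  rw [← hUi]
  refine integral_mono_of_nonneg (ae_of_all _ fun Y => mul_nonneg (sqnorm_nonneg _) (hf0 Y).le) hU
    (ae_of_all _ fun Y => ?_)
  set S := sqnorm (M.K n *ᵥ M.postMean n Y) with hS
  have h1 : sqnorm (M.K n *ᵥ M.postMean n Y - m) ≤ 2 * S + 2 * sqnorm m := by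
    have h2 := sqnorm_nonneg (M.K n *ᵥ M.postMean n Y + m)
    rw [sqnorm_add] at h2
    rw [sqnorm_sub]
    linarith
  have h3 : S * M.trueDens n Y ≤ B * M.trueDens n Y + T Y / η + H Y := by
    rcases h Y with h4 | h4
    · have h5 : M.trueDens n Y * (η * (S - B)) ≤ T Y := hdv _ Y h4
      have h6 : M.trueDens n Y * (S - B) ≤ T Y / η := by
        rw [le_div_iff₀ hη]; linarith
      have := hH0 Y
      linarith
    · have h5 : M.trueDens n Y * 0 ≤ T Y := hdv 0 Y (by simpa using hΨ1 Y)
      have h6 : 0 ≤ T Y / η := div_nonneg (by linarith) hη.le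
      have := mul_nonneg hB (hf0 Y).le
      linarith
  calc _ ≤ (2 * S + 2 * sqnorm m) * M.trueDens n Y :=
        mul_le_mul_of_nonneg_right h1 (hf0 Y).le
    _ ≤ U Y := by simp only [U]; linarith

end Risk

lemma Model.E0_le_of_bounds {n : ℕ} {M : Model} {c : ℝ}
    (hτ : 0 < M.τsq n) {t ε δ : ℝ} (ht : 0 < t) (hδ : 0 < δ)
    (hmom : IntegrableOn (fun x => x ^ ((1 : ℝ) + δ) * M.pr x) (Set.Ioi (0 : ℝ)))
    (hc : ∀ v : Fin n → ℝ, sqnorm (M.K n *ᵥ v) ≤ c ^ 2 * sqnorm v) (hε0 : 0 < ε)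
    (hε1 : ε ≤ 1 / 4) (htc : t * c ^ 2 ≤ ε) (hn : 0 < n) (hna : n + M.a ≤ (1 + ε) * n)
    {Δ ρ p : ℝ} (hΔ1 : 1 ≤ Δ) (hΔ : 1 ≤ Δ * M.normFactor n c)
    (hρ0 : 0 < ρ) (hρ1 : ρ ≤ 1) (hρ : M.tailBound δ t n ≤ ρ) (hp : M.meanBound t n ≤ p)
    {g θ A : ℝ} (hg : g = (1 + ε) / (1 - ε) ^ 2 + ε) (hεθ : ε ≤ θ) (hθ : 2 * θ ≤ 1)
    (hA : A = g * (1 + 2 * ε)) (hα : 2 * θ * A < 1)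
    {κ c' D B : ℝ} (hc' : 0 < c') (hc'1 : c' ≤ 1)
    (hD : D = 5 / ((1 - ε) * c')) (hbn : M.b ≤ n * M.σ0sq)
    (hE1 : ∃ H : (Fin n → ℝ) → ℝ, Integrable H ∧ (∀ Y, 0 ≤ H Y) ∧
      (∀ Y, (∃ J : Finset (Fin n), (J.card : ℝ) ≤ κ * n ∧
        qf (M.K n) J Y < (1 - ε) * (n * M.σ0sq)) → sqnorm Y * M.trueDens n Y ≤ H Y) ∧
      ∫ Y, H Y ≤ 1)
    (hE2 : ∃ H : (Fin n → ℝ) → ℝ, Integrable H ∧ (∀ Y, 0 ≤ H Y) ∧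
      (∀ Y, (∃ J : Finset (Fin n), (J.card : ℝ) ≤ 3 / 4 * n ∧
        qf (M.K n) J Y < c' * (n * M.σ0sq)) → sqnorm Y * M.trueDens n Y ≤ H Y) ∧
      ∫ Y, H Y ≤ 1)
    (hE3 : ∃ H : (Fin n → ℝ) → ℝ, Integrable H ∧ (∀ Y, 0 ≤ H Y) ∧
      (∀ Y, 4 * (n * M.σ0sq) < sqnorm Y → sqnorm Y * M.trueDens n Y ≤ H Y) ∧ ∫ Y, H Y ≤ 1)
    (hB : 4 * (n * M.σ0sq) * (2 ^ n * (Δ * (1 + p) ^ n * (ρ ^ (κ * n) * D ^ (5 / 8 * (n : ℝ)) +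
      ρ ^ (3 / 4 * (n : ℝ)) * (5 * (n * M.σ0sq) / M.b) ^ (5 / 8 * (n : ℝ))))) ≤ B) (L : ℝ) :
    M.E0 n (fun Y => sqnorm (M.K n *ᵥ M.postMean n Y - M.K n *ᵥ M.β0 n)) ≤
      2 * (B + (L + sqnorm (M.K n *ᵥ M.β0 n) / (2 * M.σ0sq) +
        Real.exp (-L) * (3 * (Δ * Real.exp ((√(1 - 2 * θ * A))⁻¹ * (n * ρ ^ θ + n * p))))) /
        (θ * ε / (2 * M.σ0sq)) + 3) + 2 * sqnorm (M.K n *ᵥ M.β0 n) := by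
  have hv := M.hσ0
  have hb := M.hb
  have hθ0 : 0 < θ := hε0.trans_le hεθ
  have hε : 0 < 1 - ε := by linarith
  have hg0 : 0 < g := by rw [hg]; positivity
  have hA0 : 0 < A := by rw [hA]; positivity
  have hp0 : 0 ≤ p := (M.meanBound_nonneg ht hτ).trans hp
  have hD0 : 0 < D := by rw [hD]; positivity
  have hB0 : 0 ≤ B := le_trans (by positivity) hB
  have hη : 0 < θ * ε / (2 * M.σ0sq) := by positivity
  obtain ⟨H1, hH1i, hH10, hH1, hH1b⟩ := hE1
  obtain ⟨H2, hH2i, hH20, hH2, hH2b⟩ := hE2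
  obtain ⟨H3, hH3i, hH30, hH3, hH3b⟩ := hE3
  have hxy : t * (g / M.σ0sq) * c ^ 2 ≤ 2 * θ * A / (2 * M.σ0sq) := by
    have h1 : t * c ^ 2 * g ≤ θ * A := by
      calc _ ≤ ε * g := mul_le_mul_of_nonneg_right htc hg0.le
        _ ≤ θ * g := mul_le_mul_of_nonneg_right hεθ hg0.le
        _ ≤ _ := by
          rw [hA]
          refine mul_le_mul_of_nonneg_left ?_ hθ0.le
          nlinarith
    calc _ = t * c ^ 2 * g / M.σ0sq := by ring
      _ ≤ θ * A / M.σ0sq := by gcongr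
      _ = _ := by field_simp
  obtain ⟨Ψ, hΨe, hΨi, hΨb⟩ := exists_envelope_le (transpose_eq_self (M.hK n)) hc hp0
    (x := t * (g / M.σ0sq)) (by positivity) hxy hΔ1 (r := ρ ^ θ) (by positivity) hv
    (by positivity) hα
  have hmain := M.E0_le (L := L) hη hB0 (Ψ := Ψ) (H := fun Y => H1 Y + H2 Y + H3 Y)
    (fun Y => (one_le_envelope _ (by linarith) (by positivity) hp0 Y).trans (hΨe Y)) hΨi
    (fun Y => add_nonneg (add_nonneg (hH10 Y) (hH20 Y)) (hH30 Y)) ((hH1i.add hH2i).add hH3i)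
    fun Y => by
      have hbad : sqnorm Y * M.trueDens n Y ≤ H1 Y + H2 Y + H3 Y →
          sqnorm (M.K n *ᵥ M.postMean n Y) * M.trueDens n Y ≤ H1 Y + H2 Y + H3 Y := fun h =>
        (mul_le_mul_of_nonneg_right (M.sqnorm_postMean_le hτ hc Y)
          (by rw [trueDens_eq_gauss]; exact (gauss_pos hv _).le)).trans h
      have h10 := hH10 Y
      have h20 := hH20 Y
      have h30 := hH30 Y
      by_cases h1 : ∃ J : Finset (Fin n), (J.card : ℝ) ≤ κ * n ∧
        qf (M.K n) J Y < (1 - ε) * (n * M.σ0sq)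
      · right; exact hbad (by linarith [hH1 Y h1])
      by_cases h2 : ∃ J : Finset (Fin n), (J.card : ℝ) ≤ 3 / 4 * n ∧
        qf (M.K n) J Y < c' * (n * M.σ0sq)
      · right; exact hbad (by linarith [hH2 Y h2])
      by_cases h3 : 4 * (n * M.σ0sq) < sqnorm Y
      · right; exact hbad (by linarith [hH3 Y h3])
      push Not at h1 h2 h3
      left
      exact (M.exp_sqnorm_postMean_le_envelope hτ ht hδ hmom hc hε0 hε1 htc hn hna hΔ1 hΔ hρ0 hρ1
        hρ hp hg hθ0 hθ hA hc' hc'1 hD hbn h1 h2 h3 hB).trans (hΨe Y)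
  refine hmain.trans ?_
  have hHi : ∫ Y, (H1 Y + H2 Y + H3 Y) ≤ 3 := by
    have e1 : ∫ Y, (H1 Y + H2 Y + H3 Y) = (∫ Y, (H1 Y + H2 Y)) + ∫ Y, H3 Y :=
      integral_add (hH1i.add hH2i) hH3i
    rw [e1, integral_add hH1i hH2i]
    linarith
  gcongr

lemma eventually_nhdsGT_of_tendsto {f : ℝ → ℝ} (hf : ContinuousAt f 0) {a : ℝ}
    (h : f 0 < a) : ∀ᶠ x in nhdsWithin 0 (Set.Ioi 0), 0 < x ∧ f x < a :=
  (eventually_mem_nhdsWithin).and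
    ((hf.eventually (gt_mem_nhds h)).filter_mono nhdsWithin_le_nhds)

lemma exists_moment_params {θ : ℝ} (hθ0 : 0 < θ) (hθ : 2 * θ < 1) :
    ∃ ε : ℝ, 0 < ε ∧ ε ≤ 1 / 4 ∧ ε ≤ θ ∧
      2 * θ * (((1 + ε) / (1 - ε) ^ 2 + ε) * (1 + 2 * ε)) < 1 := by
  have h1 := eventually_nhdsGT_of_tendsto (a := 1)
    (f := fun ε => 2 * θ * (((1 + ε) / (1 - ε) ^ 2 + ε) * (1 + 2 * ε)))
    (by
      have : ContinuousAt (fun ε : ℝ => (1 + ε) / (1 - ε) ^ 2) 0 :=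
        ContinuousAt.div (by fun_prop) (by fun_prop) (by norm_num)
      fun_prop) (by norm_num; linarith)
  have h2 := eventually_nhdsGT_of_tendsto (f := fun ε : ℝ => ε) (a := min (1 / 4) θ)
    continuousAt_id (by simp [hθ0])
  obtain ⟨ε, ⟨h3, h4⟩, _, h5⟩ := (h1.and h2).exists
  exact ⟨ε, h3, (h5.trans_le (min_le_left _ _)).le, (h5.trans_le (min_le_right _ _)).le, h4⟩

lemma exists_chernoff_params {ε : ℝ} (hε0 : 0 < ε) (hε1 : ε ≤ 1) :
    ∃ ξ r κ ω : ℝ, 0 < ξ ∧ 2 * ξ < 1 ∧ 0 < r ∧ r ≤ 1 ∧ 0 < κ ∧ 0 < ω ∧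
      r ^ (-κ) * Real.exp (ω * (1 - ε) / 2) *
          (r * (√(1 - 2 * ξ))⁻¹ + (√(1 - 2 * ξ + ω))⁻¹) < 1 := by
  have hξ : 0 < ε ^ 2 / 16 := by positivity
  have hsq : ε ^ 2 ≤ 1 := by nlinarith
  set y := 1 - 2 * (ε ^ 2 / 16) + ε / 2 with hy
  have hy0 : 0 < y := by rw [hy]; nlinarith
  have hexp : Real.exp (ε / 2 * (1 - ε) / 2) * (√y)⁻¹ < 1 := by
    have h1 : Real.exp (ε / 2 * (1 - ε)) < y := by
      have h2 := Real.abs_exp_sub_one_sub_id_le (x := ε / 2 * (1 - ε))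
        (by rw [abs_le]; constructor <;> nlinarith)
      have h3 := (abs_le.mp h2).2
      have h4 : (ε / 2 * (1 - ε)) ^ 2 ≤ ε ^ 2 / 4 := by
        have : (1 - ε) ^ 2 ≤ 1 := by nlinarith
        nlinarith [sq_nonneg ε]
      rw [hy]
      nlinarith
    rw [← div_eq_mul_inv, div_lt_one (Real.sqrt_pos.mpr hy0), Real.exp_half]
    exact Real.sqrt_lt_sqrt (Real.exp_pos _).le h1
  have h1 := eventually_nhdsGT_of_tendsto (a := 1)
    (f := fun r => Real.exp (ε / 2 * (1 - ε) / 2) * (r * (√(1 - 2 * (ε ^ 2 / 16)))⁻¹ + (√y)⁻¹))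
    (by fun_prop) (by simpa using hexp)
  have h2 := eventually_nhdsGT_of_tendsto (f := fun r : ℝ => r) (a := 1)
    continuousAt_id zero_lt_one
  obtain ⟨r, ⟨hr0, hr⟩, _, hr1⟩ := (h1.and h2).exists
  have h3 := eventually_nhdsGT_of_tendsto (a := 1)
    (f := fun κ => r ^ (-κ) * (Real.exp (ε / 2 * (1 - ε) / 2) *
      (r * (√(1 - 2 * (ε ^ 2 / 16)))⁻¹ + (√y)⁻¹)))
    (by
      have : ContinuousAt (fun κ : ℝ => r ^ (-κ)) 0 :=
        (Real.continuous_const_rpow hr0.ne').continuousAt.comp (by fun_prop)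
      exact this.mul continuousAt_const) (by simpa using hr)
  obtain ⟨κ, hκ0, hκ⟩ := h3.exists
  refine ⟨ε ^ 2 / 16, r, κ, ε / 2, hξ, by linarith, hr0, hr1.le, hκ0, by positivity, ?_⟩
  rw [mul_assoc]
  exact hκ

lemma chernoff_base_lt_one :
    ((2 : ℝ) ^ (-16 : ℝ)) ^ (-(3 / 4 : ℝ)) * Real.exp (2 ^ 32 * (1 / 2 ^ 32) / 2) *
      ((2 : ℝ) ^ (-16 : ℝ) * (√(1 - 2 * (1 / 8)))⁻¹ + (√(1 - 2 * (1 / 8) + 2 ^ 32))⁻¹) < 1 := by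
  have h1 : ((2 : ℝ) ^ (-16 : ℝ)) ^ (-(3 / 4 : ℝ)) = 2 ^ 12 := by
    rw [← Real.rpow_mul (by norm_num), ← Real.rpow_natCast]; norm_num
  have h2 : (2 : ℝ) ^ (-16 : ℝ) = 1 / 2 ^ 16 := by
    rw [Real.rpow_neg (by norm_num), one_div, ← Real.rpow_natCast]; norm_num
  have h3 : Real.exp (2 ^ 32 * (1 / 2 ^ 32) / 2) ≤ 2 := by
    rw [Real.exp_half, Real.sqrt_le_left (by norm_num)]
    norm_num
    linarith [Real.exp_one_lt_d9]
  have h4 : (√(1 - 2 * (1 / 8)))⁻¹ ≤ 2 := by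
    rw [inv_le_comm₀ (Real.sqrt_pos.mpr (by norm_num)) (by norm_num)]
    exact Real.le_sqrt_of_sq_le (by norm_num)
  have h5 : (√(1 - 2 * (1 / 8) + 2 ^ 32))⁻¹ ≤ 1 / 2 ^ 16 := by
    rw [inv_le_comm₀ (Real.sqrt_pos.mpr (by norm_num)) (by norm_num)]
    exact Real.le_sqrt_of_sq_le (by norm_num)
  rw [h1, h2]
  calc _ ≤ (2 : ℝ) ^ 12 * 2 * (1 / 2 ^ 16 * 2 + 1 / 2 ^ 16) := by gcongr
    _ < 1 := by norm_num

lemma exp_neg_one_mul_lt_one : Real.exp (-1) * (√(1 / 2 - 2 * (1 / 16)))⁻¹ < 1 := by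
  have h1 : (3 / 5 : ℝ) ≤ √(1 / 2 - 2 * (1 / 16)) := Real.le_sqrt_of_sq_le (by norm_num)
  have h2 : 0 < √(1 / 2 - 2 * (1 / 16)) := by linarith
  rw [Real.exp_neg, ← mul_inv]
  refine inv_lt_one_of_one_lt₀ ?_
  nlinarith [Real.exp_one_gt_d9]

lemma eventually_exp_mul_pow_le_one {u : ℕ → ℝ} (hu : Tendsto (fun n => u n / n) atTop (nhds 0))
    {C D b : ℝ} (hC : 0 ≤ C) (hD : 0 ≤ D) (hb0 : 0 ≤ b) (hb : b < 1) :
    ∀ᶠ n in atTop, D * Real.exp (C * u n) * b ^ n ≤ 1 := by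
  obtain ⟨ζ, hζ0, hζ⟩ := (eventually_nhdsGT_of_tendsto (a := 1)
    (f := fun ζ => Real.exp (C * ζ) * b) (by fun_prop) (by simpa using hb)).exists
  have h1 : Tendsto (fun n : ℕ => D * (Real.exp (C * ζ) * b) ^ n) atTop (nhds (D * 0)) :=
    (tendsto_pow_atTop_nhds_zero_of_lt_one (by positivity) hζ).const_mul D
  rw [mul_zero] at h1
  filter_upwards [h1.eventually (gt_mem_nhds zero_lt_one), hu.eventually (gt_mem_nhds hζ0),
    eventually_gt_atTop 0] with n h2 h3 h4
  have hn : (0 : ℝ) < n := by exact_mod_cast h4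
  rw [div_lt_iff₀ hn] at h3
  refine le_trans ?_ h2.le
  rw [mul_pow, ← Real.exp_nat_mul, mul_assoc]
  have h5 : C * u n ≤ n * (C * ζ) := by nlinarith
  have h6 := Real.exp_le_exp.mpr h5
  gcongr

namespace Model

variable (M : Model)

lemma q_le (n : ℕ) : M.q n ≤ n := by
  unfold q
  have := Set.ncard_le_ncard (Set.subset_univ {i : Fin n | M.β0 n i ≠ 0})
  simpa [Set.ncard_univ] using this

lemma sqnorm_signal_le {n : ℕ} {c M₀ : ℝ}
    (hc : ∀ v : Fin n → ℝ, sqnorm (M.K n *ᵥ v) ≤ c ^ 2 * sqnorm v)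
    (hM : ∀ i, |M.β0 n i| < M₀) : sqnorm (M.K n *ᵥ M.β0 n) ≤ c ^ 2 * M₀ ^ 2 * M.q n := by
  classical
  have h1 : sqnorm (M.β0 n) ≤ M₀ ^ 2 * M.q n := by
    have hq : M.q n = (Finset.univ.filter fun i => M.β0 n i ≠ 0).card := by
      rw [q, ← Set.ncard_coe_finset]; simp
    rw [sqnorm_eq_sum, ← Finset.sum_filter_of_ne (p := fun i => M.β0 n i ≠ 0)
      (fun i _ h => fun h0 => h (by rw [h0]; ring)), hq, mul_comm, ← nsmul_eq_mul]
    refine Finset.sum_le_card_nsmul _ _ _ fun i _ => ?_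
    rw [← sq_abs]
    exact pow_le_pow_left₀ (abs_nonneg _) (hM i).le 2
  calc _ ≤ c ^ 2 * sqnorm (M.β0 n) := hc _
    _ ≤ c ^ 2 * (M₀ ^ 2 * M.q n) := mul_le_mul_of_nonneg_left h1 (sq_nonneg c)
    _ = _ := by ring

lemma exp_neg_le_normFactor {δ : ℝ} (hδ : 0 < δ)
    (hmom : IntegrableOn (fun x => x ^ ((1 : ℝ) + δ) * M.pr x) (Set.Ioi (0 : ℝ)))
    {n : ℕ} (hτ : 0 < M.τsq n) (c : ℝ)
    (h : c ^ 2 * M.τsq n * (∫ x in Set.Ioi (0 : ℝ), x * M.pr x) ≤ 1) :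
    Real.exp (-(c ^ 2 * (∫ x in Set.Ioi (0 : ℝ), x * M.pr x) * (n * M.τsq n))) ≤
      M.normFactor n c := by
  have hp := M.integrableOn_pr
  have hm := M.integrableOn_mul_pr hδ hmom
  set m := ∫ x in Set.Ioi (0 : ℝ), x * M.pr x with hm_def
  have hm0 : 0 ≤ m := setIntegral_nonneg measurableSet_Ioi fun x hx =>
    mul_nonneg (le_of_lt hx) (M.hpr_nonneg x)
  set u := c ^ 2 * M.τsq n * m with hu
  have hu0 : 0 ≤ u := by positivity
  have hpt : ∀ x ∈ Set.Ioi (0 : ℝ), M.pr x - c ^ 2 * M.τsq n / 2 * (x * M.pr x) ≤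
      M.pr x * (√(1 + c ^ 2 * M.τsq n * x))⁻¹ := fun x hx => by
    have hx0 : (0 : ℝ) < x := hx
    set y := c ^ 2 * M.τsq n * x with hy
    have hy0 : 0 ≤ y := by positivity
    have h1 : 1 - y / 2 ≤ (√(1 + y))⁻¹ := by
      have h2 : √(1 + y) ≤ 1 + y / 2 := Real.sqrt_le_iff.mpr ⟨by linarith, by nlinarith⟩
      have h3 : 0 < √(1 + y) := Real.sqrt_pos.mpr (by linarith)
      calc 1 - y / 2 ≤ (1 + y / 2)⁻¹ := by
            rw [← one_div, le_div_iff₀ (by linarith)]; nlinarith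
        _ ≤ _ := by gcongr
    calc _ = M.pr x * (1 - y / 2) := by rw [hy]; ring
      _ ≤ _ := mul_le_mul_of_nonneg_left h1 (M.hpr_nonneg x)
  have hint : 1 - u / 2 ≤ ∫ x in Set.Ioi (0 : ℝ), M.pr x * (√(1 + c ^ 2 * M.τsq n * x))⁻¹ := by
    have e1 : ∫ x in Set.Ioi (0 : ℝ), (M.pr x - c ^ 2 * M.τsq n / 2 * (x * M.pr x)) =
        1 - u / 2 := by
      rw [integral_sub hp (hm.const_mul _), integral_const_mul, M.hpr_int, hu]
      ring
    rw [← e1]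
    refine setIntegral_mono_on (hp.sub (hm.const_mul _)) ?_ measurableSet_Ioi hpt
    refine hp.mul_bdd (c := 1) (Measurable.aestronglyMeasurable (by fun_prop)) ?_
    filter_upwards [ae_restrict_mem measurableSet_Ioi] with x hx
    have hx0 : (0 : ℝ) < x := hx
    rw [Real.norm_eq_abs, abs_of_nonneg (by positivity)]
    refine inv_le_one_of_one_le₀ (Real.one_le_sqrt.mpr ?_)
    have : 0 ≤ c ^ 2 * M.τsq n * x := by positivity
    linarith
  have hexp : Real.exp (-u) ≤ 1 - u / 2 := by
    have h1 := Real.add_one_le_exp u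
    rw [Real.exp_neg]
    calc (Real.exp u)⁻¹ ≤ (u + 1)⁻¹ := by gcongr
      _ ≤ 1 - u / 2 := by
        rw [inv_le_iff_one_le_mul₀ (by linarith)]
        nlinarith
  unfold normFactor
  calc _ = Real.exp (-u) ^ n := by rw [← Real.exp_nat_mul]; congr 1; rw [hu]; ring
    _ ≤ _ := pow_le_pow_left₀ (Real.exp_pos _).le (hexp.trans hint) n

lemma exists_rates (hτpos : ∀ n, 0 < M.τsq n) {δ t : ℝ} (hδ : 0 < δ) (ht : 0 < t)
    (hτ : ∃ C > (0 : ℝ), ∃ N : ℕ, ∀ n ≥ N,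
      M.τsq n ≤ C * ((n : ℝ) ^ (-(1 : ℝ) - 1 / (1 + δ)) * M.q n)) :
    ∃ C > 0, ∃ ρ : ℕ → ℝ, ∀ᶠ n : ℕ in atTop, (1 : ℝ) ≤ M.q n ∧ n * M.τsq n ≤ C * M.q n ∧
      n * M.meanBound t n ≤ C * M.q n ∧ 0 < ρ n ∧ M.tailBound δ t n ≤ ρ n ∧ ρ n ≤ C / n ∧
      n * ρ n ^ (1 / (2 + δ)) ≤ C * M.q n := by
  obtain ⟨C₀, hC₀, N, hN⟩ := hτ
  set m := ∫ x in Set.Ioi (0 : ℝ), x * M.pr x with hm_def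
  set m' := ∫ x in Set.Ioi (0 : ℝ), x ^ (1 + δ) * M.pr x with hm'_def
  have hm0 : 0 ≤ m := setIntegral_nonneg measurableSet_Ioi fun x hx =>
    mul_nonneg (le_of_lt hx) (M.hpr_nonneg x)
  have hm'0 : 0 ≤ m' := setIntegral_nonneg measurableSet_Ioi fun x hx =>
    mul_nonneg (Real.rpow_nonneg (le_of_lt hx) _) (M.hpr_nonneg x)
  set D := (C₀ / t) ^ (1 + δ) * (m' + 1) with hD
  have hD0 : 0 < D := by positivity
  set E := D ^ (1 / (2 + δ)) with hE
  have hE0 : 0 < E := by positivity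
  refine ⟨C₀ + C₀ * m / t + D + E, by positivity,
    fun n => D * ((n : ℝ) ^ (-(2 + δ)) * (M.q n : ℝ) ^ (1 + δ)), ?_⟩
  filter_upwards [eventually_ge_atTop N, eventually_gt_atTop 0] with n hn hn0
  have hn' : (0 : ℝ) < n := by exact_mod_cast hn0
  have hn1 : (1 : ℝ) ≤ n := by exact_mod_cast hn0
  have hτn := hN n hn
  have hτ0 := hτpos n
  have hq : (1 : ℝ) ≤ M.q n := by
    rcases Nat.eq_zero_or_pos (M.q n) with h | h
    · rw [h] at hτn; simp at hτn; linarith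
    · exact_mod_cast h
  have hqn : (M.q n : ℝ) ≤ n := by exact_mod_cast M.q_le n
  have hq0 : (0 : ℝ) < M.q n := by linarith
  set q := (M.q n : ℝ)
  have h1 : n * M.τsq n ≤ C₀ * q := by
    have h2 : (n : ℝ) ^ (-(1 : ℝ) - 1 / (1 + δ)) ≤ (n : ℝ) ^ (-1 : ℝ) :=
      Real.rpow_le_rpow_of_exponent_le hn1 (by have : 0 ≤ 1 / (1 + δ) := by positivity
                                               linarith)
    rw [Real.rpow_neg_one] at h2
    calc n * M.τsq n ≤ n * (C₀ * ((n : ℝ)⁻¹ * q)) := by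
          refine mul_le_mul_of_nonneg_left (hτn.trans ?_) hn'.le
          gcongr
      _ = C₀ * q := by field_simp
  have hpos1 : 0 ≤ C₀ * m / t * q := by positivity
  have hpos2 : 0 ≤ C₀ * q := by positivity
  have hpos3 : 0 ≤ D * q := by positivity
  have hpos4 : 0 ≤ E * q := by positivity
  refine ⟨hq, by linarith, ?_, by positivity, ?_, ?_, ?_⟩
  · have : n * M.meanBound t n = n * M.τsq n * (m / t) := by
      rw [meanBound, ← hm_def]; ring
    rw [this]
    have h2 := mul_le_mul_of_nonneg_right h1 (show 0 ≤ m / t by positivity)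
    have h3 : C₀ * q * (m / t) = C₀ * m / t * q := by ring
    linarith
  · rw [tailBound, ← hm'_def]
    have h2 : M.τsq n / t ≤ C₀ / t * ((n : ℝ) ^ (-(1 : ℝ) - 1 / (1 + δ)) * q) := by
      rw [div_le_iff₀ ht]
      refine hτn.trans_eq ?_
      field_simp
    calc _ ≤ (C₀ / t * ((n : ℝ) ^ (-(1 : ℝ) - 1 / (1 + δ)) * q)) ^ (1 + δ) * (m' + 1) := by
          gcongr
          linarith
      _ = _ := by
        rw [Real.mul_rpow (by positivity) (by positivity), Real.mul_rpow (by positivity)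
          hq0.le, ← Real.rpow_mul hn'.le, hD]
        have : (-(1 : ℝ) - 1 / (1 + δ)) * (1 + δ) = -(2 + δ) := by field_simp; ring
        rw [this]
        ring
  · have h2 : (n : ℝ) ^ (-(2 + δ)) * q ^ (1 + δ) ≤ 1 / n := by
      calc _ ≤ (n : ℝ) ^ (-(2 + δ)) * (n : ℝ) ^ (1 + δ) := by gcongr
        _ = 1 / n := by
          rw [← Real.rpow_add hn', one_div, ← Real.rpow_neg_one]; congr 1; ring
    calc _ ≤ D * (1 / n) := mul_le_mul_of_nonneg_left h2 hD0.le
      _ = D / n := by ring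
      _ ≤ _ := by
        gcongr
        have : 0 ≤ C₀ * m / t := by positivity
        linarith
  · have h2 : n * (D * ((n : ℝ) ^ (-(2 + δ)) * q ^ (1 + δ))) ^ (1 / (2 + δ)) =
        E * q ^ ((1 + δ) / (2 + δ)) := by
      rw [Real.mul_rpow hD0.le (by positivity),
        Real.mul_rpow (x := (n : ℝ) ^ (-(2 + δ))) (y := q ^ (1 + δ)) (by positivity) (by positivity),
        ← Real.rpow_mul hn'.le, ← Real.rpow_mul hq0.le]
      have e1 : -(2 + δ) * (1 / (2 + δ)) = -1 := by field_simp
      have e2 : (1 + δ) * (1 / (2 + δ)) = (1 + δ) / (2 + δ) := by ring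
      rw [e1, e2, Real.rpow_neg_one, ← hE]
      field_simp
    rw [h2]
    have h3 : q ^ ((1 + δ) / (2 + δ)) ≤ q := by
      calc _ ≤ q ^ (1 : ℝ) := Real.rpow_le_rpow_of_exponent_le hq
            (by rw [div_le_one (by positivity)]; linarith)
        _ = q := Real.rpow_one q
    have := mul_le_mul_of_nonneg_left h3 hE0.le
    linarith

end Model

lemma eventually_rpow_mul_add_le {ρ : ℕ → ℝ} {C κ D w : ℝ} (hκ : 0 < κ) (hD : 0 < D)
    (hw : 0 < w) (hρ : ∀ᶠ n in atTop, 0 < ρ n ∧ ρ n ≤ C / n) :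
    ∀ᶠ n : ℕ in atTop, ρ n ^ (κ * n) * D ^ (5 / 8 * (n : ℝ)) +
      ρ n ^ (3 / 4 * (n : ℝ)) * (w * n) ^ (5 / 8 * (n : ℝ)) ≤ 2 * (1 / 8) ^ n := by
  have hρ0 : Tendsto ρ atTop (nhds 0) := by
    refine tendsto_of_tendsto_of_tendsto_of_le_of_le' tendsto_const_nhds
      (tendsto_const_div_atTop_nhds_zero_nat C) (hρ.mono fun n h => h.1.le)
      (hρ.mono fun n h => h.2)
  have h1 : Tendsto (fun n => ρ n ^ κ * D ^ (5 / 8 : ℝ)) atTop (nhds 0) := by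
    simpa [Real.zero_rpow hκ.ne'] using
      (hρ0.rpow_const (Or.inr hκ.le)).mul_const (D ^ (5 / 8 : ℝ))
  have h2 : Tendsto (fun n => ρ n ^ (1 / 8 : ℝ) * (C * w) ^ (5 / 8 : ℝ)) atTop (nhds 0) := by
    simpa using (hρ0.rpow_const (p := (1 / 8 : ℝ)) (Or.inr (by norm_num))).mul_const
      ((C * w) ^ (5 / 8 : ℝ))
  have h8 : (0 : ℝ) < 1 / 8 := by norm_num
  filter_upwards [hρ, h1.eventually (gt_mem_nhds h8), h2.eventually (gt_mem_nhds h8),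
    eventually_gt_atTop 0] with n hn h3 h4 hn0
  have hn' : (0 : ℝ) < n := by exact_mod_cast hn0
  obtain ⟨hp, hle⟩ := hn
  have h5 : ρ n ^ (3 / 4 : ℝ) * (w * n) ^ (5 / 8 : ℝ) ≤ 1 / 8 := by
    refine le_trans ?_ h4.le
    have e1 : ρ n ^ (3 / 4 : ℝ) = ρ n ^ (1 / 8 : ℝ) * ρ n ^ (5 / 8 : ℝ) := by
      rw [← Real.rpow_add hp]; norm_num
    rw [e1, mul_assoc, ← Real.mul_rpow hp.le (by positivity)]
    have h6 : ρ n * (w * n) ≤ C * w := by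
      rw [le_div_iff₀ hn'] at hle
      nlinarith
    gcongr
  have e1 : ρ n ^ (κ * n) * D ^ (5 / 8 * (n : ℝ)) = (ρ n ^ κ * D ^ (5 / 8 : ℝ)) ^ n := by
    rw [Real.rpow_mul hp.le, Real.rpow_mul hD.le, Real.rpow_natCast, Real.rpow_natCast, mul_pow]
  have e2 : ρ n ^ (3 / 4 * (n : ℝ)) * (w * n) ^ (5 / 8 * (n : ℝ)) =
      (ρ n ^ (3 / 4 : ℝ) * (w * n) ^ (5 / 8 : ℝ)) ^ n := by
    rw [Real.rpow_mul hp.le, Real.rpow_mul (by positivity), Real.rpow_natCast,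
      Real.rpow_natCast, mul_pow]
  rw [e1, e2, two_mul]
  exact add_le_add (pow_le_pow_left₀ (by positivity) h3.le n)
    (pow_le_pow_left₀ (by positivity) h5 n)

lemma Model.eventually_chernoff_le_one {M : Model} (hA3 : M.CondA3) {S ξ b : ℝ} (hS : 0 ≤ S)
    (hξ : 0 < ξ) (hb0 : 0 ≤ b) (hb : b < 1)
    (hμ : ∀ᶠ n in atTop, sqnorm (M.K n *ᵥ M.β0 n) ≤ S * M.q n) :
    ∀ᶠ n in atTop, 2 * M.σ0sq / ξ *
      Real.exp (sqnorm (M.K n *ᵥ M.β0 n) / (2 * M.σ0sq * ξ)) * b ^ n ≤ 1 := by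
  have hv := M.hσ0
  filter_upwards [eventually_exp_mul_pow_le_one hA3 (C := S / (2 * M.σ0sq * ξ))
    (D := 2 * M.σ0sq / ξ) (by positivity) (by positivity) hb0 hb, hμ] with n h1 h2
  refine le_trans ?_ h1
  have : sqnorm (M.K n *ᵥ M.β0 n) / (2 * M.σ0sq * ξ) ≤ S / (2 * M.σ0sq * ξ) * M.q n := by
    rw [div_mul_eq_mul_div]
    gcongr
  gcongr

end RVM

/-- **Weakened-moment version of Theorem 1 (Remark 5).** Under (A1)–(A3), if for some `δ > 0`
the prior has a finite `(1+δ)`-th moment, `∫ λ^{2(1+δ)} π(λ²) dλ² < ∞`, and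
`τₙ² ⪯ n^{−1 − 1/(1+δ)} qₙ`, then `E₀ ‖E(Kₙβₙ | Yₙ) − Kₙβ₀ₙ‖² ⪯ qₙ` as `n → ∞`. -/
theorem theorem1_weak_moment (M : RVM.Model) (hτpos : ∀ n, 0 < M.τsq n)
    (hA1 : M.CondA1) (hA2 : M.CondA2) (hA3 : M.CondA3)
    (δ : ℝ) (hδ : 0 < δ)
    (hmom : MeasureTheory.IntegrableOn
      (fun x => x ^ ((1 : ℝ) + δ) * M.pr x) (Set.Ioi (0 : ℝ)))
    (hτ : ∃ C > (0 : ℝ), ∃ N : ℕ, ∀ n ≥ N,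
      M.τsq n ≤ C * ((n : ℝ) ^ (-(1 : ℝ) - 1 / (1 + δ)) * M.q n)) :
    ∃ C > (0 : ℝ), ∃ N : ℕ, ∀ n ≥ N,
      M.E0 n (fun Y => sqnorm (M.K n *ᵥ M.postMean n Y - M.K n *ᵥ M.β0 n)) ≤
        C * M.q n := by
  obtain ⟨c₁, c₂, hc₁, hc₁₂, N₁, hN₁⟩ := hA1
  obtain ⟨M₀, hM₀⟩ := hA2
  have hc₂ : 0 < c₂ := hc₁.trans_le hc₁₂
  have hv := M.hσ0
  have hb := M.hb
  set v := M.σ0sq with hv_def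
  have hθ0 : 0 < 1 / (2 + δ) := by positivity
  have hθ2 : 2 * (1 / (2 + δ)) < 1 := by rw [mul_one_div, div_lt_one (by positivity)]; linarith
  obtain ⟨ε, hε0, hε1, hεθ, hα⟩ := exists_moment_params hθ0 hθ2
  obtain ⟨ξ, r, κ, ω, hξ, hξ1, hr, hr1, hκ, hω, hbase⟩ := exists_chernoff_params hε0
    (by linarith : ε ≤ 1)
  have hε' : 0 < 1 - ε := by linarith
  set θ := 1 / (2 + δ) with hθ_def
  set t := ε / c₂ ^ 2 with ht_def
  have ht : 0 < t := by positivity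
  have htc : t * c₂ ^ 2 ≤ ε := by rw [ht_def, div_mul_cancel₀ _ (by positivity)]
  obtain ⟨C, hC, ρ, hrates⟩ := M.exists_rates hτpos hδ ht hτ
  set m := ∫ x in Set.Ioi (0 : ℝ), x * M.pr x with hm_def
  have hm0 : 0 ≤ m := setIntegral_nonneg measurableSet_Ioi fun x hx =>
    mul_nonneg (le_of_lt hx) (M.hpr_nonneg x)
  set D := 5 / ((1 - ε) * (1 / 2 ^ 32)) with hD
  have hD0 : 0 < D := by positivity
  set S := c₂ ^ 2 * M₀ ^ 2 with hS
  have hS0 : 0 ≤ S := by positivity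
  set A := ((1 + ε) / (1 - ε) ^ 2 + ε) * (1 + 2 * ε) with hA
  set s := (√(1 - 2 * θ * A))⁻¹ with hs
  have hs0 : 0 ≤ s := by positivity
  set C₁ := c₂ ^ 2 * m * C with hC₁
  have hC₁0 : 0 ≤ C₁ := by positivity
  set CL := C₁ + s * (2 * C) with hCL
  set η := θ * ε / (2 * v) with hη
  have hη0 : 0 < η := by positivity
  have hμ : ∀ᶠ n in atTop, sqnorm (M.K n *ᵥ M.β0 n) ≤ S * M.q n := by
    filter_upwards [eventually_ge_atTop N₁] with n hn
    exact M.sqnorm_signal_le (sqnorm_mulVec_le (M.hK n) hc₂ (hN₁ n hn).2) (hM₀ n)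
  have hF1 := Model.eventually_chernoff_le_one hA3 hS0 hξ (by positivity) hbase hμ
  have hF2 := Model.eventually_chernoff_le_one hA3 hS0 (ξ := 1 / 8) (by norm_num) (by positivity)
    chernoff_base_lt_one hμ
  have hF3 := Model.eventually_chernoff_le_one hA3 hS0 (ξ := 1 / 16) (by norm_num) (by positivity)
    exp_neg_one_mul_lt_one hμ
  have hsplit := eventually_rpow_mul_add_le (ρ := ρ) (C := C) hκ hD0
    (w := 5 * v / M.b) (by positivity) (hrates.mono fun n h => ⟨h.2.2.2.1, h.2.2.2.2.2.1⟩)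
  have hdecay := eventually_exp_mul_pow_le_one hA3 (C := C₁ + C) (D := 8 * v) (b := 1 / 2)
    (by positivity) (by positivity) (by norm_num) (by norm_num)
  have hsmall := (hA3.const_mul C₁).eventually (gt_mem_nhds (show C₁ * 0 < 1 by simp))
  have hρ1 := (tendsto_const_div_atTop_nhds_zero_nat C).eventually (gt_mem_nhds zero_lt_one)
  have hlarge := tendsto_natCast_atTop_atTop (R := ℝ) |>.eventually_ge_atTop
    (max (M.a / ε) (M.b / v))
  have hmain : ∀ᶠ n in atTop,
      M.E0 n (fun Y => sqnorm (M.K n *ᵥ M.postMean n Y - M.K n *ᵥ M.β0 n)) ≤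
        (2 * (1 + (CL + S / (2 * v) + 3) / η + 3) + 2 * S) * M.q n := by
    filter_upwards [eventually_ge_atTop N₁, eventually_gt_atTop 0, hrates, hμ, hF1, hF2, hF3,
      hsplit, hdecay, hsmall, hρ1, hlarge] with n hn hn0 ⟨hq1, hnτ, hnp, hρ0, htail, hρC, hρθ⟩
      hμn hF1 hF2 hF3 hsplit hdecay hsmall hρ1 hlarge
    have hn' : (0 : ℝ) < n := by exact_mod_cast hn0
    have hτn := hτpos n
    have hc := sqnorm_mulVec_le (M.hK n) hc₂ (hN₁ n hn).2
    have hp0 := M.meanBound_nonneg ht hτn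
    set q := (M.q n : ℝ)
    set p := M.meanBound t n
    set Δ := Real.exp (c₂ ^ 2 * m * (n * M.τsq n)) with hΔ
    have hΔ1 : 1 ≤ Δ := Real.one_le_exp (by positivity)
    have hΔq : Δ ≤ Real.exp (C₁ * q) := Real.exp_le_exp.mpr <| by
      calc _ ≤ c₂ ^ 2 * m * (C * q) := by gcongr
        _ = _ := by rw [hC₁]; ring
    have hΔN : 1 ≤ Δ * M.normFactor n c₂ := by
      have h1 : c₂ ^ 2 * M.τsq n * m ≤ 1 := by
        refine le_trans ?_ hsmall.le
        rw [← mul_div_assoc, le_div_iff₀ hn']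
        calc _ = c₂ ^ 2 * m * (n * M.τsq n) := by ring
          _ ≤ c₂ ^ 2 * m * (C * q) := by gcongr
          _ = _ := by rw [hC₁]; ring
      calc (1 : ℝ) = Δ * Real.exp (-(c₂ ^ 2 * m * (n * M.τsq n))) := by
            rw [hΔ, ← Real.exp_add]; simp
        _ ≤ _ := mul_le_mul_of_nonneg_left (M.exp_neg_le_normFactor hδ hmom hτn c₂ h1)
            (by positivity)
    have hna : n + M.a ≤ (1 + ε) * n := by
      have := (le_max_left _ _).trans hlarge
      rw [div_le_iff₀ hε0] at this
      linarith
    have hbn : M.b ≤ n * M.σ0sq := by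
      have := (le_max_right _ _).trans hlarge
      rwa [div_le_iff₀ hv] at this
    have hB : 4 * (n * M.σ0sq) * (2 ^ n * (Δ * (1 + p) ^ n * (ρ n ^ (κ * n) *
        D ^ (5 / 8 * (n : ℝ)) + ρ n ^ (3 / 4 * (n : ℝ)) *
          (5 * (n * M.σ0sq) / M.b) ^ (5 / 8 * (n : ℝ))))) ≤ 1 := by
      have e1 : 5 * (n * M.σ0sq) / M.b = 5 * v / M.b * n := by ring
      rw [e1]
      refine le_trans ?_ hdecay
      have h1 : (1 + p) ^ n ≤ Real.exp (C * q) := by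
        calc _ ≤ Real.exp p ^ n := by gcongr; linarith [Real.add_one_le_exp p]
          _ = Real.exp (n * p) := by rw [Real.exp_nat_mul]
          _ ≤ _ := Real.exp_le_exp.mpr hnp
      have h2 : (n : ℝ) ≤ 2 ^ n := by exact_mod_cast Nat.lt_two_pow_self.le
      calc _ ≤ 4 * (2 ^ n * v) * (2 ^ n * (Real.exp (C₁ * q) * Real.exp (C * q) *
            (2 * (1 / 8) ^ n))) := by gcongr
        _ = 8 * v * (Real.exp (C₁ * q) * Real.exp (C * q)) *
            ((2 : ℝ) ^ n * 2 ^ n * (1 / 8) ^ n) := by ring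
        _ = _ := by
          rw [← Real.exp_add, ← mul_pow, ← mul_pow, add_mul]
          norm_num
    have hfin := Model.E0_le_of_bounds hτn ht hδ hmom hc hε0 hε1 htc hn0 hna hΔ1 hΔN hρ0
      (hρC.trans hρ1.le) htail le_rfl rfl hεθ hθ2.le hA hα (κ := κ) (c' := 1 / 2 ^ 32)
      (by norm_num) (by norm_num) hD hbn
      (by obtain ⟨H, h1, h2, h3, h4⟩ := exists_bound_qf_small (n := n) (M := M) (κ := κ)
            (c := 1 - ε) hξ hξ1 hr hr1 hω
          exact ⟨H, h1, h2, h3, h4.trans hF1⟩)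
      (by obtain ⟨H, h1, h2, h3, h4⟩ := exists_bound_qf_small (n := n) (M := M) (κ := 3 / 4)
            (c := 1 / 2 ^ 32) (ξ := 1 / 8) (r := (2 : ℝ) ^ (-16 : ℝ)) (ω := 2 ^ 32)
            (by norm_num) (by norm_num) (by positivity)
            (Real.rpow_le_one_of_one_le_of_nonpos (by norm_num) (by norm_num)) (by norm_num)
          exact ⟨H, h1, h2, h3, h4.trans hF2⟩)
      (by obtain ⟨H, h1, h2, h3, h4⟩ := exists_bound_sqnorm_large (n := n) (M := M)
            (ξ := 1 / 16) (by norm_num) (by norm_num)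
          exact ⟨H, h1, h2, h3, h4.trans hF3⟩)
      hB (CL * q)
    refine hfin.trans ?_
    have hL : Real.exp (-(CL * q)) * (3 * (Δ * Real.exp (s * (n * ρ n ^ θ + n * p)))) ≤ 3 := by
      have h1 : Real.exp (s * (n * ρ n ^ θ + n * p)) ≤ Real.exp (s * (C * q + C * q)) := by
        gcongr
      calc _ ≤ Real.exp (-(CL * q)) *
            (3 * (Real.exp (C₁ * q) * Real.exp (s * (C * q + C * q)))) := by gcongr
        _ = 3 * (Real.exp (-(CL * q)) * (Real.exp (C₁ * q) * Real.exp (s * (C * q + C * q)))) := by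
          ring
        _ = 3 := by
          rw [← Real.exp_add, ← Real.exp_add, hCL]
          ring_nf
          simp
        _ ≤ 3 := le_rfl
    calc _ ≤ 2 * (1 + (CL * q + S * q / (2 * v) + 3) / η + 3) + 2 * (S * q) := by gcongr
      _ ≤ 2 * (1 * q + (CL * q + S * q / (2 * v) + 3 * q) / η + 3 * q) + 2 * (S * q) := by
        gcongr <;> linarith
      _ = _ := by ring
  obtain ⟨N, hN⟩ := eventually_atTop.mp hmain
  exact ⟨_, by positivity, N, hN⟩
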